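/- Let R be a Hecke operator on V and assume the quantum integers [k]_q = 1 + q + ⋯ + q^{k−1} are nonzero in K for every integer k ≥ 1. Let P_S(X) = Σ_{n≥0} s_n X^n and P_E(X) = Σ_{n≥0} e_n X^n in ℚ[[X]], and define rationals p_n (n ≥ 1) by the identity X·P_S'(X) = P_S(X)·Σ_{n≥1} p_n X^n (possible since P_S has constant term 1). Then X·P_E'(X) = P_E(X)·Σ_{n≥1} p_n² X^n; equivalently, P_E(t) = P_S(t) ⋆ P_S(t), the λ-ring product of P_S with itself. (Relation between the Poincaré series of E and of S, equations (23)–(24)) -/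

import Mathlib

open TensorProduct

/-- The Yang–Baxter equation for an operator `R` on `V ⊗ V`, stated on `(V ⊗ V) ⊗ V`:
`(R ⊗ 1)(1 ⊗ R)(R ⊗ 1) = (1 ⊗ R)(R ⊗ 1)(1 ⊗ R)`, where `1 ⊗ R` is transported along
the associator. -/
def YangBaxter (K : Type*) [Field K] (V : Type*) [AddCommGroup V] [Module K V]
    (R : V ⊗[K] V →ₗ[K] V ⊗[K] V) : Prop :=
  let R₁ : (V ⊗[K] V) ⊗[K] V →ₗ[K] (V ⊗[K] V) ⊗[K] V := LinearMap.rTensor V R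
  let R₂ : (V ⊗[K] V) ⊗[K] V →ₗ[K] (V ⊗[K] V) ⊗[K] V :=
    (TensorProduct.assoc K V V V).symm.toLinearMap ∘ₗ LinearMap.lTensor V R ∘ₗ
      (TensorProduct.assoc K V V V).toLinearMap
  R₁ ∘ₗ R₂ ∘ₗ R₁ = R₂ ∘ₗ R₁ ∘ₗ R₂

/-- A Hecke operator on `V` for the parameter `q`: the Yang–Baxter equation together
with the Hecke equation `(R + 1)(R − q) = 0`. -/
def IsHecke (K : Type*) [Field K] (V : Type*) [AddCommGroup V] [Module K V]
    (q : K) (R : V ⊗[K] V →ₗ[K] V ⊗[K] V) : Prop :=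
  YangBaxter K V R ∧ (R + LinearMap.id) ∘ₗ (R - q • LinearMap.id) = 0

/-- The multiplication map `V ⊗ V → T(V)` of the tensor algebra. -/
noncomputable def quadMul (K : Type*) [Field K] (V : Type*) [AddCommGroup V] [Module K V] :
    V ⊗[K] V →ₗ[K] TensorAlgebra K V :=
  LinearMap.mul' K (TensorAlgebra K V) ∘ₗ
    TensorProduct.map (TensorAlgebra.ι K) (TensorAlgebra.ι K)

/-- The relation on `T(V)` identifying the image of `W ⊆ V ⊗ V` with zero; quotienting
by (the two-sided ideal generated by) it yields the quadratic algebra `T(V)/⟨W⟩`. -/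
def quadRel (K : Type*) [Field K] (V : Type*) [AddCommGroup V] [Module K V]
    (W : Submodule K (V ⊗[K] V)) : TensorAlgebra K V → TensorAlgebra K V → Prop :=
  fun a b => b = 0 ∧ ∃ w ∈ W, a = quadMul K V w

/-- The dimension of the `n`-th homogeneous component of the quadratic algebra
`T(V)/⟨W⟩`, realised as the image of the degree-`n` component of `T(V)` in the
quotient algebra. -/
noncomputable def quadDim (K : Type*) [Field K] (V : Type*) [AddCommGroup V] [Module K V]
    (W : Submodule K (V ⊗[K] V)) (n : ℕ) : ℕ :=
  Module.finrank K
    (Submodule.map (RingQuot.mkAlgHom K (quadRel K V W)).toLinearMap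
      (LinearMap.range (TensorAlgebra.ι K (M := V)) ^ n))

/-- `λ_n`, the dimension of the `n`-th homogeneous component of `Λ = T(V)/⟨Im(R+1)⟩`. -/
noncomputable def lambdaDim (K : Type*) [Field K] (V : Type*) [AddCommGroup V] [Module K V]
    (R : V ⊗[K] V →ₗ[K] V ⊗[K] V) (n : ℕ) : ℕ :=
  quadDim K V (LinearMap.range (R + LinearMap.id)) n

/-- `s_n`, the dimension of the `n`-th homogeneous component of `S = T(V)/⟨Im(R−q)⟩`. -/
noncomputable def sDim (K : Type*) [Field K] (V : Type*) [AddCommGroup V] [Module K V]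
    (q : K) (R : V ⊗[K] V →ₗ[K] V ⊗[K] V) (n : ℕ) : ℕ :=
  quadDim K V (LinearMap.range (R - q • LinearMap.id)) n

section EBialgebra

open Module

variable (K : Type*) [Field K] (V : Type*) [AddCommGroup V] [Module K V]
  [FiniteDimensional K V]

/-- The dual operator `R^*` on `V^* ⊗ V^*`, obtained from the transpose of `R` via the
canonical identification `V^* ⊗ V^* ≅ (V ⊗ V)^*`. -/
noncomputable def dualOp (R : V ⊗[K] V →ₗ[K] V ⊗[K] V) :
    (Dual K V ⊗[K] Dual K V) →ₗ[K] (Dual K V ⊗[K] Dual K V) :=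
  (TensorProduct.dualDistribEquiv K V V).symm.toLinearMap ∘ₗ
    R.dualMap ∘ₗ (TensorProduct.dualDistribEquiv K V V).toLinearMap

/-- The operator `R̄ = θ(R^{*−1} ⊗ R)θ` on `(V^* ⊗ V) ⊗ (V^* ⊗ V)`, where `θ`
interchanges the second and third tensor factors and `Rinv = R⁻¹`. -/
noncomputable def barOp (R Rinv : V ⊗[K] V →ₗ[K] V ⊗[K] V) :
    ((Dual K V ⊗[K] V) ⊗[K] (Dual K V ⊗[K] V)) →ₗ[K]
      ((Dual K V ⊗[K] V) ⊗[K] (Dual K V ⊗[K] V)) :=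
  (TensorProduct.tensorTensorTensorComm K (Dual K V) V (Dual K V) V).symm.toLinearMap ∘ₗ
    TensorProduct.map (dualOp K V Rinv) R ∘ₗ
    (TensorProduct.tensorTensorTensorComm K (Dual K V) V (Dual K V) V).toLinearMap

/-- `e_n`, the dimension of the `n`-th homogeneous component of the bialgebra
`E = T(V^* ⊗ V)/⟨Im(R̄ − 1)⟩`; here `Im(R̄ − 1)` is the subspace spanned by the
elements `y = R̄x − x`, i.e. those `y` with `R̄x = x + y` for some `x`. -/
noncomputable def eDim (R Rinv : V ⊗[K] V →ₗ[K] V ⊗[K] V) (n : ℕ) : ℕ :=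
  quadDim K (Dual K V ⊗[K] V)
    (Submodule.span K {y | ∃ x, barOp K V R Rinv x = x + y}) n

end EBialgebra

namespace HeckeP
open Finset

section Alg
variable {K A B : Type*} [Field K] [Ring A] [Algebra K A] [Ring B] [Algebra K B]

/-- Hecke relations for `T 0, …, T (n-2)`. -/
structure HRel (q : K) (T : ℕ → A) (n : ℕ) : Prop where
  quad : ∀ i, i + 1 < n → T i * T i = (q - 1) • T i + q • (1 : A)
  braid : ∀ i, i + 2 < n → T i * T (i + 1) * T i = T (i + 1) * T i * T (i + 1)
  comm : ∀ i j, i + 1 < j → j + 1 < n → T i * T j = T j * T i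

lemma HRel.mono {q : K} {T : ℕ → A} {n m : ℕ} (h : HRel q T n) (hm : m ≤ n) : HRel q T m :=
  ⟨fun i hi => h.quad i (by omega), fun i hi => h.braid i (by omega),
   fun i j hi hj => h.comm i j hi (by omega)⟩

/-- relative trace -/
noncomputable def Tr (q : K) (T : ℕ → A) : ℕ → A →ₗ[K] A
  | 0 => 0
  | m + 1 => LinearMap.id + q⁻¹ • (Tr q T m ∘ₗ
      LinearMap.mulLeft K (T (m - 1)) ∘ₗ LinearMap.mulRight K (T (m - 1)))

lemma Tr_zero (q : K) (T : ℕ → A) (b : A) : Tr q T 0 b = 0 := rfl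

lemma Tr_succ (q : K) (T : ℕ → A) (m : ℕ) (b : A) :
    Tr q T (m + 1) b = b + q⁻¹ • Tr q T m (T (m - 1) * (b * T (m - 1))) := rfl

lemma Tr_mul_left (q : K) (T : ℕ → A) (m : ℕ) : ∀ (z b : A),
    (∀ i, i + 1 < m → z * T i = T i * z) → Tr q T m (z * b) = z * Tr q T m b := by
  induction m with
  | zero => intro z b _; simp [Tr_zero]
  | succ m ih =>
    intro z b hz
    rw [Tr_succ, Tr_succ, mul_add, mul_smul_comm]
    congr 2
    rcases m with _ | m
    · simp [Tr_zero]
    · rw [← ih z _ (fun i hi => hz i (by omega))]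
      congr 1
      have := hz m (by omega)
      simp only [Nat.add_sub_cancel]
      rw [← mul_assoc z, this]; simp only [mul_assoc]

lemma Tr_mul_right (q : K) (T : ℕ → A) (m : ℕ) : ∀ (z b : A),
    (∀ i, i + 1 < m → z * T i = T i * z) → Tr q T m (b * z) = Tr q T m b * z := by
  induction m with
  | zero => intro z b _; simp [Tr_zero]
  | succ m ih =>
    intro z b hz
    rw [Tr_succ, Tr_succ, add_mul, smul_mul_assoc]
    congr 2
    rcases m with _ | m
    · simp [Tr_zero]
    · rw [← ih z _ (fun i hi => hz i (by omega))]
      congr 1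
      have := hz m (by omega)
      simp only [Nat.add_sub_cancel]
      simp only [mul_assoc]
      rw [this]

lemma Tr_comm {q : K} (hq : q ≠ 0) {T : ℕ → A} {n : ℕ} (h : HRel q T n) (m : ℕ) (hm : m ≤ n) :
    ∀ (b : A), (∀ i, i + 2 < m → b * T i = T i * b) →
      ∀ i, i + 1 < m → Tr q T m b * T i = T i * Tr q T m b := by
  induction m with
  | zero => intro b _ i hi; omega
  | succ m ih =>
    intro b hb i hi
    rcases m with _ | m
    · omega
    by_cases him : i < m
    · have h1 := ih (by omega) (T m * (b * T m)) (fun j hj => by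
        have e1 := hb j (by omega)
        have e2 := h.comm j m (by omega) (by omega)
        rw [mul_assoc, mul_assoc, ← e2, ← mul_assoc b, e1, ← mul_assoc, ← mul_assoc, ← e2]
        simp only [mul_assoc]) i (by omega)
      rw [Tr_succ, add_mul, mul_add, smul_mul_assoc, mul_smul_comm, Nat.add_sub_cancel, h1,
        hb i (by omega)]
    · obtain rfl : i = m := by omega
      have hqd := h.quad i (by omega)
      have key : (b + q⁻¹ • (T i * (b * T i))) * T i = T i * (b + q⁻¹ • (T i * (b * T i))) := by
        have l : (T i * (b * T i)) * T i = (q - 1) • (T i * (b * T i)) + q • (T i * b) := by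
          rw [mul_assoc, mul_assoc, hqd]
          simp only [mul_add, mul_smul_comm, mul_one]
        have r : T i * (T i * (b * T i)) = (q - 1) • (T i * (b * T i)) + q • (b * T i) := by
          rw [← mul_assoc, hqd]
          simp only [add_mul, smul_mul_assoc, one_mul]
        rw [add_mul, mul_add, smul_mul_assoc, mul_smul_comm, l, r]
        simp only [smul_add, smul_smul, inv_mul_cancel₀ hq, one_smul]
        abel
      rw [Tr_succ, Nat.add_sub_cancel, Tr_succ, smul_add, ← add_assoc, add_mul, mul_add, key]
      congr 1
      rw [smul_mul_assoc, smul_mul_assoc, mul_smul_comm, mul_smul_comm]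
      congr 2
      rcases i with _ | i
      · simp [Tr_zero]
      · have hc : ∀ j, j + 1 < i + 1 → T (i+1) * T j = T j * T (i+1) := fun j hj =>
          (h.comm j (i+1) (by omega) (by omega)).symm
        rw [← Tr_mul_right q T _ _ _ hc, ← Tr_mul_left q T _ _ _ hc]
        congr 1
        have hbr := h.braid i (by omega)
        have hbb := hb i (by omega)
        simp only [Nat.add_sub_cancel]
        have e1 : T i * (T (i+1) * (b * T (i+1)) * T i) * T (i+1)
          = T i * T (i+1) * b * (T (i+1) * T i * T (i+1)) := by simp only [mul_assoc]
        have e2 : T (i+1) * (T i * (T (i+1) * (b * T (i+1)) * T i))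
          = T (i+1) * T i * T (i+1) * b * (T (i+1) * T i) := by simp only [mul_assoc]
        rw [e1, e2, ← hbr]
        have e3 : T i * T (i+1) * b * (T i * T (i+1) * T i)
          = T i * T (i+1) * (b * T i) * (T (i+1) * T i) := by simp only [mul_assoc]
        rw [e3, hbb]
        simp only [mul_assoc]

lemma Tr_map (q : K) (T : ℕ → A) (f : A →ₐ[K] B) (m : ℕ) : ∀ b,
    f (Tr q T m b) = Tr q (fun i => f (T i)) m (f b) := by
  induction m with
  | zero => intro b; simp [Tr_zero]
  | succ m ih => intro b; simp [Tr_succ, ih]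

/-- Jucys–Murphy elements -/
noncomputable def JM (q : K) (T : ℕ → A) : ℕ → A
  | 0 => 1
  | k + 1 => q⁻¹ • (T k * JM q T k * T k)

lemma JM_comm_T {q : K} (hq : q ≠ 0) {T : ℕ → A} {n : ℕ} (h : HRel q T n) (k : ℕ) (hk : k < n) :
    ∀ i, i + 1 < n → (i + 1 < k ∨ k < i) → JM q T k * T i = T i * JM q T k := by
  induction k using Nat.strong_induction_on with
  | _ k ih =>
    intro i hi hik
    rcases k with _ | k
    · simp [JM]
    · simp only [JM, smul_mul_assoc, mul_smul_comm]
      congr 1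
      by_cases hki : i + 1 = k
      · subst hki
        simp only [JM, smul_mul_assoc, mul_smul_comm]
        congr 1
        have hc := ih i (by omega) (by omega) (i+1) (by omega) (by omega)
        have hb := h.braid i (by omega)
        have e1 : T (i+1) * (T i * JM q T i * T i) * T (i+1) * T i
          = T (i+1) * T i * JM q T i * (T i * T (i+1) * T i) := by simp only [mul_assoc]
        have e2 : T i * (T (i+1) * (T i * JM q T i * T i) * T (i+1))
          = (T i * T (i+1) * T i) * JM q T i * (T i * T (i+1)) := by simp only [mul_assoc]
        rw [e1, e2, hb]
        have e3 : T (i+1) * T i * JM q T i * (T (i+1) * T i * T (i+1))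
          = T (i+1) * T i * (JM q T i * T (i+1)) * (T i * T (i+1)) := by simp only [mul_assoc]
        rw [e3, hc]; simp only [mul_assoc]
      · have hc := ih k (by omega) (by omega) i hi (by omega)
        have ht : T k * T i = T i * T k := by
          rcases hik with h' | h'
          · exact (h.comm i k (by omega) (by omega)).symm
          · exact h.comm k i (by omega) (by omega)
        rw [mul_assoc, ht, ← mul_assoc, mul_assoc (T k), hc, ← mul_assoc, ht]
        simp only [mul_assoc]

/-- elements commuting with `T i` for `i < k` commute with `JM k`. -/
lemma comm_JM {q : K} {T : ℕ → A} (k : ℕ) (z : A) (hz : ∀ i, i < k → z * T i = T i * z) :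
    z * JM q T k = JM q T k * z := by
  induction k with
  | zero => simp [JM]
  | succ k ih =>
    have h1 := ih (fun i hi => hz i (by omega))
    have h2 := hz k (by omega)
    simp only [JM, smul_mul_assoc, mul_smul_comm]
    congr 1
    rw [mul_assoc _ _ z, ← h2, ← mul_assoc, ← mul_assoc, h2, mul_assoc (T k), h1]
    simp only [mul_assoc]
    rw [h2]

lemma JM_comm_JM {q : K} (hq : q ≠ 0) {T : ℕ → A} {n : ℕ} (h : HRel q T n) {k l : ℕ}
    (hk : k < n) (hl : l < n) : JM q T k * JM q T l = JM q T l * JM q T k := by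
  wlog hkl : l ≤ k generalizing k l
  · exact (this hl hk (by omega)).symm
  rcases eq_or_lt_of_le hkl with rfl | hlt
  · rfl
  · exact comm_JM l _ (fun i hi => JM_comm_T hq h k hk i (by omega) (by omega))

lemma T_isUnit {q : K} (hq : q ≠ 0) {T : ℕ → A} {n : ℕ} (h : HRel q T n) {i : ℕ} (hi : i + 1 < n) :
    IsUnit (T i) := by
  have := h.quad i hi
  refine isUnit_iff_exists.mpr ⟨q⁻¹ • (T i - (q - 1) • 1), ?_, ?_⟩
  · rw [mul_smul_comm, mul_sub, this, mul_smul_comm, mul_one, add_sub_cancel_left, smul_smul,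
      inv_mul_cancel₀ hq, one_smul]
  · rw [smul_mul_assoc, sub_mul, this, smul_mul_assoc, one_mul, add_sub_cancel_left, smul_smul,
      inv_mul_cancel₀ hq, one_smul]

lemma JM_isUnit {q : K} (hq : q ≠ 0) {T : ℕ → A} {n : ℕ} (h : HRel q T n) (k : ℕ) (hk : k < n) :
    IsUnit (JM q T k) := by
  induction k with
  | zero => simp [JM]
  | succ k ih =>
    have h1 := T_isUnit hq h hk
    have h2 := ih (by omega)
    have : q⁻¹ • (T k * JM q T k * T k) = algebraMap K A q⁻¹ * (T k * JM q T k * T k) := by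
      rw [Algebra.smul_def]
    rw [JM, this]
    exact (((isUnit_iff_ne_zero.mpr (inv_ne_zero hq)).map (algebraMap K A))).mul
      ((h1.mul h2).mul h1)

lemma Tr_T {q : K} (hq : q ≠ 0) {T : ℕ → A} {n : ℕ} (h : HRel q T n) (m : ℕ) (hm : m < n) :
    (q - 1) • Tr q T m (T (m - 1)) = q • (JM q T m - 1) := by
  induction m with
  | zero => simp [Tr_zero, JM]
  | succ m ih =>
    have ih := ih (by omega)
    have hqd := h.quad m (by omega)
    have e : Tr q T (m + 1) (T m) = T m + q⁻¹ • (T m * Tr q T m (T (m-1)) * T m) := by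
      rw [Tr_succ]
      congr 2
      rcases m with _ | m
      · simp [Tr_zero]
      · have hc : ∀ j, j + 1 < m + 1 → T (m+1) * T j = T j * T (m+1) := fun j hj =>
          (h.comm j (m+1) (by omega) (by omega)).symm
        rw [← Tr_mul_left q T _ _ _ hc, ← Tr_mul_right q T _ _ _ hc]
        congr 1
        simp only [Nat.add_sub_cancel]
        rw [← mul_assoc, h.braid m (by omega)]
    have e2 : (q - 1) • (T m * Tr q T m (T (m-1)) * T m)
        = T m * ((q - 1) • Tr q T m (T (m-1))) * T m := by
      simp only [mul_smul_comm, smul_mul_assoc]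
    simp only [Nat.add_sub_cancel]
    rw [e, smul_add, smul_comm (q-1) q⁻¹, e2, ih, JM]
    simp only [mul_smul_comm, smul_mul_assoc, mul_sub, sub_mul, mul_one, hqd, smul_sub, smul_add,
      smul_smul, inv_mul_cancel₀ hq, mul_inv_cancel₀ hq, one_smul]
    match_scalars <;> field_simp <;> ring

/-- one-step recursion for the generating function of relative traces -/
lemma Tr_res {q : K} (hq : q ≠ 0) {T : ℕ → A} {n : ℕ} (h : HRel q T n) (u : K) (m : ℕ)
    (hm : m < n) (X Y : A)
    (hX : 0 < m → X * (algebraMap K A u - JM q T (m - 1)) = 1)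
    (hX' : 0 < m → (algebraMap K A u - JM q T (m - 1)) * X = 1)
    (hY : Y * (algebraMap K A u - JM q T m) = 1)
    (hY' : (algebraMap K A u - JM q T m) * Y = 1) :
    Tr q T (m + 1) Y = (u - 1) • (JM q T m * Y * Y) +
      Tr q T m X * (1 + (-((q - 1) ^ 2 / q) * u) • (JM q T m * Y * Y)) := by
  rcases m with _ | m
  · simp only [Tr_succ, Tr_zero, JM] at *
    have : (u - 1) • Y = 1 := by
      have e : (u - 1) • Y = Y * (algebraMap K A u - 1) := by
        rw [mul_sub, mul_one, sub_smul, one_smul, Algebra.smul_def, Algebra.commutes]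
      rw [e, hY]
    simp only [smul_zero, add_zero, zero_mul, one_mul]
    rw [← smul_mul_assoc, this, one_mul]
  replace hX := hX (by omega)
  replace hX' := hX' (by omega)
  simp only [Nat.add_sub_cancel] at hX hX'
  set t := T m with ht
  set x := JM q T m with hx
  set y := JM q T (m+1) with hy
  set U := algebraMap K A u with hU
  set Q := algebraMap K A (q - 1) with hQ
  have hqd : t * t = Q * t + algebraMap K A q := by
    have := h.quad m (by omega)
    rw [← ht] at this
    rw [this, Algebra.smul_def, Algebra.smul_def, mul_one]
  have hUc : ∀ a, U * a = a * U := fun a => Algebra.commutes u a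
  have hQc : ∀ a, Q * a = a * Q := fun a => Algebra.commutes (q-1) a
  have hqc : ∀ a, algebraMap K A q * a = a * algebraMap K A q := fun a => Algebra.commutes q a
  have hyq : algebraMap K A q * y = t * x * t := by
    rw [hy, JM, Algebra.smul_def, ← mul_assoc, ← map_mul, mul_inv_cancel₀ hq, map_one, one_mul]
  have hunit : IsUnit t := T_isUnit hq h (by omega)
  have htx : t * x = y * t - Q * y := by
    apply hunit.mul_right_cancel
    rw [← hyq, sub_mul, mul_assoc y, hqd, mul_add, hqc, ← mul_assoc y, ← hQc, mul_assoc,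
      add_sub_cancel_left]
  have hxt : x * t = t * y - Q * y := by
    apply hunit.mul_left_cancel
    rw [← mul_assoc, ← hyq, mul_sub, ← mul_assoc t, hqd, add_mul, ← mul_assoc t, ← hQc,
      mul_assoc, add_sub_cancel_left]
  have hxy : x * y = y * x := JM_comm_JM hq h (by omega) (by omega)
  have hYy : Y * y = y * Y := by
    have : Y * (U - y) = (U - y) * Y := by rw [hY, hY']
    rw [mul_sub, sub_mul, hUc] at this
    exact sub_right_injective this
  have hXx : X * x = x * X := by
    have : X * (U - x) = (U - x) * X := by rw [hX, hX']
    rw [mul_sub, sub_mul, hUc] at this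
    exact sub_right_injective this
  have hXy : X * y = y * X := by
    have h1 : (U - x) * y = y * (U - x) := by rw [sub_mul, mul_sub, hUc, hxy]
    calc X * y = X * (y * (U - x)) * X := by rw [mul_assoc, mul_assoc, hX', mul_one]
      _ = X * ((U - x) * y) * X := by rw [h1]
      _ = y * X := by rw [← mul_assoc, hX, one_mul]
  have hXY : X * Y = Y * X := by
    have h1 : X * (U - y) = (U - y) * X := by rw [sub_mul, mul_sub, hUc, hXy]
    calc X * Y = Y * ((U - y) * X) * Y := by rw [← mul_assoc Y, hY, one_mul]
      _ = Y * X := by rw [← h1, mul_assoc, mul_assoc, hY', mul_one]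
  have r1 : t * Y = X * t + Q * (X * y * Y) := by
    have h1 : (U - x) * t = t * (U - y) + Q * y := by
      rw [sub_mul, mul_sub, hxt, hUc]; abel
    calc t * Y = X * ((U - x) * t) * Y := by rw [← mul_assoc X, hX, one_mul]
      _ = X * t * ((U - y) * Y) + X * (Q * y) * Y := by
        rw [h1, mul_add, add_mul]; simp only [mul_assoc]
      _ = _ := by rw [hY', mul_one, ← mul_assoc X, ← hQc]; simp only [mul_assoc]
  have r2 : Y * t = t * X + Q * (Y * y * X) := by
    have h1 : t * (U - x) = (U - y) * t + Q * y := by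
      rw [sub_mul, mul_sub, htx, hUc]; abel
    calc Y * t = Y * (t * (U - x)) * X := by rw [mul_assoc, mul_assoc, hX', mul_one]
      _ = (Y * (U - y)) * t * X + Y * (Q * y) * X := by
        rw [h1, mul_add, add_mul]; simp only [mul_assoc]
      _ = _ := by rw [hY, one_mul, ← mul_assoc Y, ← hQc]; simp only [mul_assoc]
  -- the key rewriting
  have xt : X * t = t * Y - Q * (X * (y * Y)) := by rw [r1]; simp only [mul_assoc]; abel
  have key : t * (Y * t) = Q * (t * Y) - Q * Q * (X * (y * Y)) + algebraMap K A q * X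
      + Q * (y * Y * t * Y) - Q * Q * (X * (y * y * Y * Y)) := by
    have a1 : t * (Y * t) = Q * (X * t) + algebraMap K A q * X + Q * (X * (y * (Y * t))) := by
      rw [← mul_assoc, r1, add_mul, mul_assoc X, hqd, mul_add, ← mul_assoc X Q, ← hQc, ← hqc]
      simp only [mul_assoc]
    have a2 : X * (y * (Y * t)) = y * Y * t * Y - Q * (X * (y * y * Y * Y)) := by
      have b1 : Y * t * Y = Y * X * t + Q * (Y * (X * (y * Y))) := by
        rw [mul_assoc, r1, mul_add, ← mul_assoc Y Q, ← hQc]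
        simp only [mul_assoc]
      have b2 : y * Y * t * Y = X * (y * (Y * t)) + Q * (X * (y * y * Y * Y)) := by
        calc y * Y * t * Y = y * (Y * t * Y) := by simp only [mul_assoc]
          _ = y * (Y * X * t) + Q * (y * (Y * (X * (y * Y)))) := by
            rw [b1, mul_add, ← mul_assoc y Q, ← hQc]; simp only [mul_assoc]
          _ = _ := by
            congr 1
            · rw [← hXY, ← mul_assoc y, ← mul_assoc y, ← hXy]; simp only [mul_assoc]
            · congr 1
              rw [← mul_assoc Y X, ← hXY, ← mul_assoc (X * Y), mul_assoc X Y y, hYy,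
                ← mul_assoc y, ← mul_assoc y X, ← hXy]
              simp only [mul_assoc]
      rw [b2]; abel
    rw [a1, a2, xt]
    simp only [mul_sub, mul_assoc]
    abel
  have hycomm : ∀ j, j + 1 < m + 1 → y * T j = T j * y := fun j hj =>
    JM_comm_T hq h (m+1) hm j (by omega) (by omega)
  have hYcomm : ∀ j, j + 1 < m + 1 → Y * T j = T j * Y := fun j hj => by
    have h1 := hycomm j hj
    have h2 : T j * (U - y) = (U - y) * T j := by rw [sub_mul, mul_sub, hUc, h1]
    calc Y * T j = Y * (T j * (U - y)) * Y := by rw [mul_assoc, mul_assoc, hY', mul_one]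
      _ = T j * Y := by rw [h2, ← mul_assoc, hY, one_mul]
  have cm : ∀ a b : A, (∀ j, j + 1 < m + 1 → a * T j = T j * a) →
      (∀ j, j + 1 < m + 1 → b * T j = T j * b) → (∀ j, j + 1 < m + 1 → a * b * T j = T j * (a * b)) := by
    intro a b ha hb j hj
    rw [mul_assoc, hb j hj, ← mul_assoc, ha j hj, mul_assoc]
  have hτ : Q * Tr q T (m+1) t = algebraMap K A q * (y - 1) := by
    have := Tr_T hq h (m+1) hm
    simp only [Nat.add_sub_cancel] at this
    rw [← ht, Algebra.smul_def, Algebra.smul_def] at this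
    exact this
  set C := Tr q T (m+1) X with hC
  have hQcomm : ∀ j, j + 1 < m + 1 → Q * T j = T j * Q := fun j _ => hQc _
  have hqcomm : ∀ j, j + 1 < m + 1 → algebraMap K A q * T j = T j * algebraMap K A q :=
    fun j _ => hqc _
  have hTr : Tr q T (m+1) (t * (Y * t)) = algebraMap K A q * ((y - 1) * Y) -
      Q * Q * (C * (y * Y)) + algebraMap K A q * C + algebraMap K A q * (y * Y * (y - 1) * Y)
      - Q * Q * (C * (y * y * Y * Y)) := by
    rw [key, map_sub, map_add, map_add, map_sub]
    congr 1; congr 1; congr 1; congr 1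
    · rw [Tr_mul_left _ _ _ _ _ hQcomm, Tr_mul_right _ _ _ _ _ hYcomm, ← mul_assoc, hτ, mul_assoc]
    · rw [Tr_mul_left _ _ _ _ _ (cm _ _ hQcomm hQcomm),
        Tr_mul_right _ _ _ _ _ (cm _ _ hycomm hYcomm)]
    · rw [Tr_mul_left _ _ _ _ _ hqcomm]
    · rw [Tr_mul_left _ _ _ _ _ hQcomm, Tr_mul_right _ _ _ _ _ hYcomm,
        Tr_mul_left _ _ _ _ _ (cm _ _ hycomm hYcomm), ← mul_assoc, ← mul_assoc, hQc,
        mul_assoc (y * Y) Q, hτ, ← mul_assoc (y * Y), ← hqc]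
      simp only [mul_assoc]
    · rw [Tr_mul_left _ _ _ _ _ (cm _ _ hQcomm hQcomm),
        Tr_mul_right _ _ _ _ _ (cm _ _ (cm _ _ (cm _ _ hycomm hycomm) hYcomm) hYcomm)]
  rw [Tr_succ, Nat.add_sub_cancel, hTr]
  -- final algebra
  have yY : y * Y = u • Y - 1 := by
    have : U * Y - y * Y = 1 := by rw [← sub_mul, hY']
    rw [Algebra.smul_def, ← this]; abel
  have hQQ : ∀ a, q⁻¹ • (Q * Q * a) = ((q-1)^2/q) • a := by
    intro a
    rw [hQ, ← map_mul, ← Algebra.smul_def, smul_smul]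
    congr 1; field_simp
  have hqq : ∀ a, q⁻¹ • (algebraMap K A q * a) = a := by
    intro a
    rw [← Algebra.smul_def, smul_smul, inv_mul_cancel₀ hq, one_smul]
  rw [smul_sub, smul_add, smul_add, smul_sub, hqq, hqq, hqq, hQQ, hQQ]
  have e1 : y * y * Y * Y = u • (y * Y * Y) - y * Y := by
    calc y * y * Y * Y = y * (y * Y) * Y := by simp only [mul_assoc]
      _ = y * (u • Y - 1) * Y := by rw [yY]
      _ = _ := by rw [mul_sub, sub_mul, mul_smul_comm, smul_mul_assoc, mul_one]
  have e2 : y * Y * (y - 1) * Y = u • (y * Y * Y) - y * Y - y * Y * Y := by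
    rw [mul_sub, sub_mul, mul_one, mul_assoc y Y y, hYy, ← mul_assoc y y, e1]
  rw [e1, e2, mul_add, mul_one, mul_smul_comm, sub_mul, one_mul, mul_sub, mul_smul_comm,
    smul_sub, smul_smul]
  module

end Alg
end HeckeP

namespace HeckeP
open Finset

lemma no_field {K L : Type*} [Field K] [Field L] [Algebra K L] (q : K) (hq : q ≠ 0)
    (hroot : ∀ k : ℕ, 1 ≤ k → q ^ k ≠ 1) (n : ℕ) (hn : 1 ≤ n) (a : ℕ → L) (ha : a 0 = 1)
    (U : Set K) (hU : U.Infinite)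
    (h : ∀ u ∈ U, ∏ k ∈ range n, (algebraMap K L u - a k) ^ 2 =
      ∏ k ∈ range n, ((algebraMap K L u - algebraMap K L q * a k) *
        (algebraMap K L u - (algebraMap K L q)⁻¹ * a k))) : False := by
  have hpoly : ∏ k ∈ range n, (Polynomial.X - Polynomial.C (a k)) ^ 2 =
      ∏ k ∈ range n, ((Polynomial.X - Polynomial.C (algebraMap K L q * a k)) *
        (Polynomial.X - Polynomial.C ((algebraMap K L q)⁻¹ * a k))) := by
    apply Polynomial.eq_of_infinite_eval_eq
    refine Set.Infinite.mono ?_ (hU.image (f := algebraMap K L)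
      ((algebraMap K L).injective.injOn))
    rintro _ ⟨u, hu, rfl⟩
    simpa [Polynomial.eval_prod] using h u hu
  have step : ∀ k < n, ∃ j < n, a j = algebraMap K L q * a k := by
    intro k hk
    have := congrArg (Polynomial.eval (algebraMap K L q * a k)) hpoly
    rw [Polynomial.eval_prod, Polynomial.eval_prod, eq_comm,
      prod_eq_zero (mem_range.mpr hk) (by simp), eq_comm, prod_eq_zero_iff] at this
    obtain ⟨j, hj, hj'⟩ := this
    refine ⟨j, mem_range.mp hj, ?_⟩
    simp [sub_eq_zero] at hj'
    exact hj'.symm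
  have pw : ∀ i : ℕ, ∃ j < n, a j = algebraMap K L q ^ i := by
    intro i
    induction i with
    | zero => exact ⟨0, by omega, by simp [ha]⟩
    | succ i ih =>
      obtain ⟨j, hj, e⟩ := ih
      obtain ⟨l, hl, e'⟩ := step j hj
      exact ⟨l, hl, by rw [e', e, pow_succ']⟩
  choose f hf hfe using pw
  obtain ⟨i, hi, j, hj, hij, he⟩ := Finset.exists_ne_map_eq_of_card_lt_of_maps_to
    (s := range (n+1)) (t := range n) (by simp) (f := f) (fun i _ => by simpa using hf i)
  wlog hlt : i < j generalizing i j
  · exact this j hj i hi hij.symm he.symm (by omega)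
  have e : algebraMap K L q ^ i = algebraMap K L q ^ j := by rw [← hfe, ← hfe, he]
  rw [← map_pow, ← map_pow] at e
  have e := (algebraMap K L).injective e
  apply hroot (j - i) (by omega)
  have : q ^ i * q ^ (j - i) = q ^ i * 1 := by rw [← pow_add, mul_one, e]; congr 1; omega
  exact mul_left_cancel₀ (pow_ne_zero _ hq) this

lemma fld_id {K F : Type*} [Field K] [Field F] [Algebra K F] (q : K) (hq : q ≠ 0) (u : K) (a w : F)
    (w1 : w * (algebraMap K F u - a) = 1) :
    (1 + algebraMap K F (-((q - 1) ^ 2 / q) * u) * (a * w * w)) *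
        (algebraMap K F u - a) ^ 2 = (algebraMap K F u - algebraMap K F q * a) *
        (algebraMap K F u - (algebraMap K F q)⁻¹ * a) := by
  have hqL : algebraMap K F q ≠ 0 := by simpa using hq
  have : (1 + algebraMap K F (-((q - 1) ^ 2 / q) * u) * (a * w * w)) *
        (algebraMap K F u - a) ^ 2 = (algebraMap K F u - a) ^ 2 +
        algebraMap K F (-((q - 1) ^ 2 / q) * u) * a * (w * (algebraMap K F u - a)) ^ 2 := by
          ring
  rw [this, w1]
  simp only [map_mul, map_neg, map_div₀, map_pow, map_sub, map_one]
  field_simp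
  ring

lemma unit_inf {K G : Type*} [Field K] [Ring G] [Algebra K G] [FiniteDimensional K G] (a : G) :
    {u : K | ¬ IsUnit (algebraMap K G u - a)}.Finite := by
  nontriviality G
  have hIntK : IsIntegral K a := Algebra.IsIntegral.isIntegral a
  refine Set.Finite.subset ((minpoly K a).rootSet_finite K) ?_
  intro u hu
  have hu' : u ∈ spectrum K a := hu
  have := spectrum.subset_polynomial_aeval a (minpoly K a) ⟨u, hu', rfl⟩
  rw [minpoly.aeval, spectrum.zero_eq] at this
  rw [Polynomial.mem_rootSet_of_ne (minpoly.ne_zero hIntK)]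
  simpa using this

section
variable {K A : Type*} [Field K] [Ring A] [Algebra K A]

lemma G_prod {q : K} (hq : q ≠ 0) {T : ℕ → A} {n : ℕ} (h : HRel q T n) (u : K) (hu : u ≠ 1)
    (X : ℕ → A) (hX : ∀ k < n, X k * (algebraMap K A u - JM q T k) = 1)
    (hX' : ∀ k < n, (algebraMap K A u - JM q T k) * X k = 1) (m : ℕ) (hm : m < n) :
    1 + (-((q - 1) ^ 2 / q) * u / (u - 1)) • Tr q T (m + 1) (X m) =
     (1 + (-((q - 1) ^ 2 / q) * u / (u - 1)) • Tr q T m (X (m - 1))) *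
      (1 + (-((q - 1) ^ 2 / q) * u) • (JM q T m * X m * X m)) := by
  rw [Tr_res hq h u m hm (X (m - 1)) (X m) (fun _ => hX _ (by omega)) (fun _ => hX' _ (by omega))
    (hX _ hm) (hX' _ hm)]
  have : u - 1 ≠ 0 := sub_ne_zero.mpr hu
  rw [add_mul, one_mul, smul_mul_assoc, smul_add, smul_smul, div_mul_cancel₀ _ this, add_assoc]

lemma Tr_one_q {T : ℕ → A} {n : ℕ} (h : HRel (1:K) T n) (m : ℕ) (hm : m ≤ n) :
    Tr (1:K) T m 1 = (m : K) • (1 : A) := by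
  induction m with
  | zero => simp [Tr_zero]
  | succ m ih =>
    rw [Tr_succ]
    rcases m with _ | m
    · simp [Tr_zero]
    · have := h.quad m (by omega)
      simp only [Nat.add_sub_cancel, one_mul]
      rw [this, sub_self, zero_smul, zero_add, one_smul, ih (by omega)]
      push_cast
      simp only [inv_one, one_smul, add_smul]
      abel

lemma comm_inv {a b X : A} (hX : X * a = 1) (hX' : a * X = 1) (h : b * a = a * b) :
    X * b = b * X := by
  calc X * b = X * (b * a) * X := by rw [mul_assoc, mul_assoc, hX', mul_one]
    _ = b * X := by rw [h, ← mul_assoc, hX, one_mul]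

lemma exists_y [CharZero K] [FiniteDimensional K A] {q : K} (hq : q ≠ 0)
    (hqi : ∀ k : ℕ, 1 ≤ k → (∑ i ∈ range k, q ^ i) ≠ 0) {T : ℕ → A} {n : ℕ} (hn : 1 ≤ n)
    (h : HRel q T n) (hgen : Algebra.adjoin K {a | ∃ i, i + 1 < n ∧ a = T i} = ⊤) :
    ∃ y : A, (∀ i, i + 2 < n → y * T i = T i * y) ∧ Tr q T n y = 1 := by
  by_cases hq1 : q = 1
  · subst hq1
    refine ⟨((n : K)⁻¹) • 1, fun i _ => by simp, ?_⟩
    rw [map_smul, Tr_one_q h n le_rfl, smul_smul, inv_mul_cancel₀ (by exact_mod_cast (by omega)),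
      one_smul]
  have hroot : ∀ k : ℕ, 1 ≤ k → q ^ k ≠ 1 := by
    intro k hk he
    have := geom_sum_mul q k
    rw [he, sub_self] at this
    exact (mul_ne_zero (hqi k hk) (sub_ne_zero.mpr hq1)) this
  have hcen : ∀ z : A, (∀ i, i + 1 < n → z * T i = T i * z) → z ∈ Subalgebra.center K A := by
    intro z hz
    rw [Subalgebra.mem_center_iff]
    intro b
    have hb : b ∈ Algebra.adjoin K {a | ∃ i, i + 1 < n ∧ a = T i} := by rw [hgen]; trivial
    induction hb using Algebra.adjoin_induction with
    | mem x hx => obtain ⟨i, hi, rfl⟩ := hx; exact (hz i hi).symm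
    | algebraMap r => exact Algebra.commutes r z
    | add x y _ _ hx hy => rw [add_mul, mul_add, hx, hy]
    | mul x y _ _ hx hy => rw [mul_assoc, hy, ← mul_assoc, hx, mul_assoc]
  have hTrc : ∀ y, (∀ i, i + 2 < n → y * T i = T i * y) → Tr q T n y ∈ Subalgebra.center K A :=
    fun y hy => hcen _ (Tr_comm hq h n le_rfl y hy)
  let Z := Subalgebra.center K A
  let I : Ideal Z :=
    { carrier := {z | ∃ y : A, (∀ i, i + 2 < n → y * T i = T i * y) ∧ Tr q T n y = z}
      add_mem' := by
        rintro a b ⟨y, hy, hya⟩ ⟨y', hy', hyb⟩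
        refine ⟨y + y', fun i hi => by rw [add_mul, mul_add, hy i hi, hy' i hi], ?_⟩
        rw [map_add, hya, hyb]; rfl
      zero_mem' := ⟨0, by simp, by simp⟩
      smul_mem' := by
        rintro c a ⟨y, hy, hya⟩
        have hc := Subalgebra.mem_center_iff.mp c.2
        refine ⟨c * y, fun i hi => by rw [mul_assoc, hy i hi, ← mul_assoc, ← hc, mul_assoc], ?_⟩
        rw [Tr_mul_left _ _ _ _ _ (fun i _ => (hc _).symm), hya]; rfl }
  by_cases hI : I = ⊤
  · obtain ⟨y, hy, hy1⟩ : (1 : Z) ∈ I := by rw [hI]; trivial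
    exact ⟨y, hy, hy1⟩
  exfalso
  let s : Set A := {a | a ∈ Z ∨ ∃ k < n, a = JM q T k}
  have hs : ∀ a ∈ s, ∀ b ∈ s, a * b = b * a := by
    rintro a (ha | ⟨k, hk, rfl⟩) b (hb | ⟨l, hl, rfl⟩)
    · exact (Subalgebra.mem_center_iff.mp ha _).symm
    · exact (Subalgebra.mem_center_iff.mp ha _).symm
    · exact Subalgebra.mem_center_iff.mp hb _
    · exact JM_comm_JM hq h hk hl
  let G := Algebra.adjoin K s
  let _ : CommRing G := Algebra.adjoinCommRingOfComm K hs
  have hZG : Z ≤ G := fun z hz => Algebra.subset_adjoin (Or.inl hz)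
  let f : Z →+* G := (Subalgebra.inclusion hZG).toRingHom
  have hfi : Function.Injective f := Subalgebra.inclusion_injective hZG
  haveI : FiniteDimensional K G := FiniteDimensional.finiteDimensional_submodule G.toSubmodule
  have hfint : f.IsIntegral := by
    intro x
    have : IsIntegral K x := Algebra.IsIntegral.isIntegral x
    obtain ⟨p, hp, hp'⟩ := this
    refine ⟨p.map (algebraMap K Z), hp.map _, ?_⟩
    rw [Polynomial.eval₂_map]
    exact hp'
  have hIG : I.map f ≠ ⊤ := fun e => hI ((Ideal.map_eq_top_iff f hfi hfint).mp e)
  obtain ⟨M, hM, hIM⟩ := Ideal.exists_le_maximal _ hIG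
  let _ : Field (G ⧸ M) := Ideal.Quotient.field M
  let L : ℕ → G := fun k => if hk : k < n then
    ⟨JM q T k, Algebra.subset_adjoin (Or.inr ⟨k, hk, rfl⟩)⟩ else 0
  have hL : ∀ k < n, ((L k : G) : A) = JM q T k := fun k hk => by simp [L, hk]
  have hL0 : L 0 = 1 := by
    apply Subtype.ext; rw [hL 0 (by omega)]; rfl
  let U : Set K := {u | u ≠ 1 ∧ ∀ k ∈ range n, IsUnit (algebraMap K G u - L k)}
  have hU : U.Infinite := by
    have hfin : (Uᶜ).Finite := by
      refine Set.Finite.subset (Set.Finite.union (Set.finite_singleton (1:K))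
        (Set.Finite.biUnion (range n).finite_toSet (fun k _ => unit_inf (K := K) (L k)))) ?_
      intro u hu
      simp only [U, Set.mem_compl_iff, Set.mem_setOf_eq, not_and_or, not_forall] at hu
      rcases hu with hu | ⟨k, hk, hu⟩
      · left; simpa using hu
      · right; exact Set.mem_biUnion (by simpa using hk) hu
    intro hfin'
    haveI := Set.finite_univ_iff.mp (by
      have := hfin'.union hfin; rwa [Set.union_compl_self] at this)
    exact not_finite K
  let π : G →+* G ⧸ M := Ideal.Quotient.mk M
  refine no_field (L := G ⧸ M) q hq hroot n hn (fun k => π (L k)) (by simp [hL0]) U hU ?_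
  rintro u ⟨hu1, hu⟩
  choose! W hW using fun k (hk : k ∈ range n) => (isUnit_iff_exists.mp (hu k hk))
  have hW1 : ∀ k < n, (algebraMap K G u - L k) * W k = 1 := fun k hk => (hW k (by simpa using hk)).1
  have hW2 : ∀ k < n, W k * (algebraMap K G u - L k) = 1 := fun k hk => (hW k (by simpa using hk)).2
  have hA1 : ∀ k < n, (algebraMap K A u - JM q T k) * (W k : A) = 1 := fun k hk => by
    rw [← hL k hk]; exact congrArg Subtype.val (hW1 k hk)
  have hA2 : ∀ k < n, (W k : A) * (algebraMap K A u - JM q T k) = 1 := fun k hk => by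
    rw [← hL k hk]; exact congrArg Subtype.val (hW2 k hk)
  let g : ℕ → G := fun k => 1 + (-((q - 1) ^ 2 / q) * u) • (L k * W k * W k)
  have hg : ∀ m ≤ n, 1 + (-((q - 1) ^ 2 / q) * u / (u - 1)) • Tr q T m (W (m - 1) : A) =
      ((∏ k ∈ range m, g k : G) : A) := by
    intro m hm
    induction m with
    | zero => simp [Tr_zero]
    | succ m ih =>
      have := G_prod hq h u hu1 (fun k => (W k : A)) hA2 hA1 m (by omega)
      simp only [Nat.add_sub_cancel]
      rw [this, ih (by omega), prod_range_succ, ← hL m (by omega)]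
      rfl
  have hyW : ∀ i, i + 2 < n → (W (n-1) : A) * T i = T i * (W (n-1) : A) := by
    intro i hi
    apply comm_inv (hA2 (n-1) (by omega)) (hA1 (n-1) (by omega))
    rw [mul_sub, sub_mul, JM_comm_T hq h (n-1) (by omega) i (by omega) (by omega),
      Algebra.commutes u (T i)]
  let z : Z := ⟨Tr q T n (W (n-1) : A), hTrc _ hyW⟩
  have hz : z ∈ I := ⟨_, hyW, rfl⟩
  have hzM : f z ∈ M := hIM (Ideal.mem_map_of_mem f hz)
  have hprod : ∏ k ∈ range n, g k = 1 + algebraMap K G (-((q - 1) ^ 2 / q) * u / (u - 1)) * f z := by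
    apply Subtype.ext
    rw [← hg n le_rfl, Algebra.smul_def]
    rfl
  have hπ : ∏ k ∈ range n, π (g k) = 1 := by
    rw [← map_prod, hprod, map_add, map_one, map_mul]
    have : π (f z) = 0 := Ideal.Quotient.eq_zero_iff_mem.mpr hzM
    rw [this, mul_zero, add_zero]
  have hπK : ∀ c : K, π (algebraMap K G c) = algebraMap K (G ⧸ M) c := fun c => rfl
  calc ∏ k ∈ range n, (algebraMap K (G ⧸ M) u - π (L k)) ^ 2
      = ∏ k ∈ range n, (π (g k) * (algebraMap K (G ⧸ M) u - π (L k)) ^ 2) := by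
        rw [prod_mul_distrib, hπ, one_mul]
    _ = _ := by
      apply prod_congr rfl
      intro k hk
      have hk := mem_range.mp hk
      have w1 : π (W k) * (algebraMap K (G ⧸ M) u - π (L k)) = 1 := by
        rw [← hπK, ← map_sub, ← map_mul, hW2 k hk, map_one]
      have e : π (g k) = 1 + algebraMap K (G ⧸ M) (-((q - 1) ^ 2 / q) * u) *
          (π (L k) * π (W k) * π (W k)) := by
        simp only [g]
        rw [Algebra.smul_def, map_add, map_one, ← hπK, map_mul π, map_mul π, map_mul π]
      rw [e]
      exact fld_id q hq u _ _ w1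

end
end HeckeP

namespace HeckeP
open Finset

section
variable {K A : Type*} [Field K] [Ring A] [Algebra K A]

lemma Tr_congr (q : K) {T T' : ℕ → A} (m : ℕ) (h : ∀ i, i + 1 < m → T i = T' i) :
    ∀ b, Tr q T m b = Tr q T' m b := by
  induction m with
  | zero => intro b; rfl
  | succ m ih =>
    intro b
    rw [Tr_succ, Tr_succ]
    rcases m with _ | m
    · rfl
    · rw [ih (fun i hi => h i (by omega)), h (m + 1 - 1) (by omega)]

/-- the subalgebra generated by `T 0, …, T (n-2)` -/
def Asub (K : Type*) {A : Type*} [Field K] [Ring A] [Algebra K A] (T : ℕ → A) (n : ℕ) :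
    Subalgebra K A := Algebra.adjoin K {a | ∃ i, i + 1 < n ∧ a = T i}

lemma T_mem_Asub {T : ℕ → A} {n i : ℕ} (hi : i + 1 < n) : T i ∈ Asub K T n :=
  Algebra.subset_adjoin ⟨i, hi, rfl⟩

lemma Asub_mono {T : ℕ → A} {n m : ℕ} (h : m ≤ n) : Asub K T m ≤ Asub K T n :=
  Algebra.adjoin_mono (by rintro a ⟨i, hi, rfl⟩; exact ⟨i, by omega, rfl⟩)

/-- span of the two sided multiplications -/
def Inn (K : Type*) {A : Type*} [Field K] [Ring A] [Algebra K A] (T : ℕ → A) (n : ℕ) :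
    Submodule K (A →ₗ[K] A) :=
  Submodule.span K {φ | ∃ a ∈ Asub K T n, ∃ b ∈ Asub K T n,
    φ = LinearMap.mulLeft K a ∘ₗ LinearMap.mulRight K b}

lemma Inn_mk {T : ℕ → A} {n : ℕ} {a b : A} (ha : a ∈ Asub K T n) (hb : b ∈ Asub K T n) :
    LinearMap.mulLeft K a ∘ₗ LinearMap.mulRight K b ∈ Inn K T n :=
  Submodule.subset_span ⟨a, ha, b, hb, rfl⟩

lemma Inn_id {T : ℕ → A} {n : ℕ} : LinearMap.id ∈ Inn K T n := by
  convert Inn_mk (one_mem (Asub K T n)) (one_mem (Asub K T n))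
  ext; simp

lemma Inn_mono {T : ℕ → A} {n m : ℕ} (h : m ≤ n) : Inn K T m ≤ Inn K T n := by
  apply Submodule.span_mono
  rintro _ ⟨a, ha, b, hb, rfl⟩
  exact ⟨a, Asub_mono h ha, b, Asub_mono h hb, rfl⟩

lemma Inn_comp {T : ℕ → A} {n : ℕ} {φ ψ : A →ₗ[K] A} (hφ : φ ∈ Inn K T n) (hψ : ψ ∈ Inn K T n) :
    φ ∘ₗ ψ ∈ Inn K T n := by
  induction hφ using Submodule.span_induction with
  | mem x hx =>
    obtain ⟨a, ha, b, hb, rfl⟩ := hx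
    induction hψ using Submodule.span_induction with
    | mem y hy =>
      obtain ⟨c, hc, d, hd, rfl⟩ := hy
      have e : (LinearMap.mulLeft K a ∘ₗ LinearMap.mulRight K b) ∘ₗ
          (LinearMap.mulLeft K c ∘ₗ LinearMap.mulRight K d) =
          LinearMap.mulLeft K (a * c) ∘ₗ LinearMap.mulRight K (d * b) := by
        ext z; simp [mul_assoc]
      rw [e]
      exact Inn_mk (mul_mem ha hc) (mul_mem hd hb)
    | zero => simp
    | add x y _ _ hx hy => rw [LinearMap.comp_add]; exact add_mem hx hy
    | smul r x _ hx => rw [LinearMap.comp_smul]; exact Submodule.smul_mem _ _ hx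
  | zero => simp
  | add x y _ _ hx hy => rw [LinearMap.add_comp]; exact add_mem hx hy
  | smul r x _ hx => rw [LinearMap.smul_comp]; exact Submodule.smul_mem _ _ hx

lemma Inn_Tr (q : K) {T : ℕ → A} {n : ℕ} (m : ℕ) (hm : m ≤ n) : Tr q T m ∈ Inn K T n := by
  induction m with
  | zero => exact zero_mem _
  | succ m ih =>
    rcases m with _ | m
    · have : Tr q T (0+1) = LinearMap.id := by ext; simp [Tr_succ, Tr_zero]
      rw [this]; exact Inn_id
    · refine add_mem Inn_id (Submodule.smul_mem _ _ (Inn_comp (ih (by omega)) (Inn_mk ?_ ?_)))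
      all_goals exact T_mem_Asub (by omega)

lemma exists_proj [CharZero K] [FiniteDimensional K A] {q : K} (hq : q ≠ 0)
    (hqi : ∀ k : ℕ, 1 ≤ k → (∑ i ∈ range k, q ^ i) ≠ 0) {T : ℕ → A} {n : ℕ}
    (h : HRel q T n) : ∃ P ∈ Inn K T n, (∀ F i, i + 1 < n → P F * T i = T i * P F) ∧
      (∀ F, (∀ i, i + 1 < n → F * T i = T i * F) → P F = F) := by
  induction n with
  | zero => exact ⟨LinearMap.id, Inn_id, fun F i hi => by omega, fun F _ => rfl⟩
  | succ n ih =>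
    obtain ⟨P, hP, hP1, hP2⟩ := ih (h.mono (by omega))
    obtain ⟨y, hyA, hy, hy1⟩ : ∃ y ∈ Asub K T (n+1), (∀ i, i + 2 < n + 1 → y * T i = T i * y) ∧
        Tr q T (n+1) y = 1 := by
      let S : Subalgebra K A := Asub K T (n+1)
      let T' : ℕ → S := fun i => if hi : i + 1 < n + 1 then ⟨T i, T_mem_Asub hi⟩ else 0
      have hT' : ∀ i, i + 1 < n + 1 → ((T' i : S) : A) = T i := fun i hi => by
        simp only [T', dif_pos hi]
      have hrel : HRel q T' (n+1) := by
        refine ⟨fun i hi => ?_, fun i hi => ?_, fun i j hi hj => ?_⟩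
        · apply Subtype.ext
          push_cast
          rw [hT' i hi]; exact h.quad i hi
        · apply Subtype.ext
          push_cast
          rw [hT' i (by omega), hT' (i+1) (by omega)]; exact h.braid i hi
        · apply Subtype.ext
          push_cast
          rw [hT' i (by omega), hT' j (by omega)]; exact h.comm i j hi hj
      have hgen : Algebra.adjoin K {a | ∃ i, i + 1 < n + 1 ∧ a = T' i} = ⊤ := by
        have := Algebra.adjoin_adjoin_coe_preimage (R := K) (s := {a | ∃ i, i + 1 < n + 1 ∧ a = T i})
        refine Eq.trans ?_ this
        congr 1
        ext x
        constructor
        · rintro ⟨i, hi, rfl⟩; exact ⟨i, hi, hT' i hi⟩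
        · rintro ⟨i, hi, hx⟩; exact ⟨i, hi, Subtype.ext (by rw [hT' i hi]; exact hx)⟩
      obtain ⟨y, hy, hy1⟩ := exists_y hq hqi (by omega) hrel hgen
      refine ⟨y, y.2, fun i hi => ?_, ?_⟩
      · have := congrArg Subtype.val (hy i hi)
        push_cast at this
        rwa [hT' i (by omega)] at this
      · have := Tr_map q T' S.val (n+1) y
        rw [hy1] at this
        rw [Tr_congr q (T' := fun i => S.val (T' i)) (n+1) (fun i hi => (hT' i hi).symm)]
        exact this.symm
    refine ⟨Tr q T (n+1) ∘ₗ (LinearMap.mulLeft K y ∘ₗ LinearMap.mulRight K 1) ∘ₗ P,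
      Inn_comp (Inn_Tr q _ le_rfl) (Inn_comp (Inn_mk hyA (one_mem _)) (Inn_mono (by omega) hP)),
      ?_, ?_⟩
    · intro F i hi
      simp only [LinearMap.comp_apply, LinearMap.mulLeft_apply, LinearMap.mulRight_apply, mul_one]
      apply Tr_comm hq h (n+1) le_rfl _ _ i hi
      intro j hj
      rw [mul_assoc, hP1 F j (by omega), ← mul_assoc, hy j (by omega), mul_assoc]
    · intro F hF
      simp only [LinearMap.comp_apply, LinearMap.mulLeft_apply, LinearMap.mulRight_apply, mul_one]
      rw [hP2 F (fun i hi => hF i (by omega)), Tr_mul_right _ _ _ _ _ hF, hy1, one_mul]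

end
end HeckeP

namespace HeckeP
open Finset Matrix

section
variable {K : Type*} [Field K] {X Y : Type*} [Fintype X] [Fintype Y] [DecidableEq X] [DecidableEq Y]

lemma HRel.prod {A B : Type*} [Ring A] [Algebra K A] [Ring B] [Algebra K B] {q : K} {T : ℕ → A}
    {T' : ℕ → B} {n : ℕ} (h : HRel q T n) (h' : HRel q T' n) :
    HRel q (fun i => (T i, T' i)) n :=
  ⟨fun i hi => Prod.ext (h.quad i hi) (h'.quad i hi),
   fun i hi => Prod.ext (h.braid i hi) (h'.braid i hi),
   fun i j hi hj => Prod.ext (h.comm i j hi hj) (h'.comm i j hi hj)⟩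

lemma HRel.map {A B : Type*} [Ring A] [Algebra K A] [Ring B] [Algebra K B] {q : K} {T : ℕ → A}
    {n : ℕ} (h : HRel q T n) (f : A →ₐ[K] B) : HRel q (fun i => f (T i)) n :=
  ⟨fun i hi => by rw [← map_mul, h.quad i hi]; simp,
   fun i hi => by simp only [← map_mul]; rw [h.braid i hi],
   fun i j hi hj => by simp only [← map_mul]; rw [h.comm i j hi hj]⟩

lemma trace_lr (a : Matrix X X K) (b : Matrix Y Y K)
    (φ : Matrix X Y K →ₗ[K] Matrix X Y K) (h : ∀ F, φ F = a * F * b) :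
    LinearMap.trace K _ φ = a.trace * b.trace := by
  rw [LinearMap.trace_eq_matrix_trace K (Matrix.stdBasis K X Y), Matrix.trace]
  simp only [Matrix.diag, LinearMap.toMatrix_apply, h]
  rw [Fintype.sum_prod_type, Matrix.trace, Matrix.trace, sum_mul_sum]
  apply sum_congr rfl; intro i _
  apply sum_congr rfl; intro j _
  rw [Matrix.stdBasis_eq_single]
  simp [Matrix.stdBasis, Pi.basis_repr, Matrix.mul_apply, Matrix.single_apply, Pi.basisFun_repr,
    ite_and]

/-- block diagonal embedding -/
def bl (K X Y : Type*) [Field K] [Fintype X] [Fintype Y] [DecidableEq X] [DecidableEq Y] :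
    (Matrix X X K × Matrix Y Y K) →ₐ[K] Matrix (X ⊕ Y) (X ⊕ Y) K :=
  AlgHom.ofLinearMap
    { toFun := fun p => fromBlocks p.1 0 0 p.2
      map_add' := fun a b => by simp [fromBlocks_add]
      map_smul' := fun r a => by simp [fromBlocks_smul] }
    (by simp [fromBlocks_one]) (by intro a b; simp [fromBlocks_multiply])

lemma bl_apply (p : Matrix X X K × Matrix Y Y K) : bl K X Y p = fromBlocks p.1 0 0 p.2 := rfl

/-- inclusion of the (1,1) block -/
def inc11 : Matrix X X K →ₗ[K] Matrix (X ⊕ Y) (X ⊕ Y) K :=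
  { toFun := fun F => fromBlocks F 0 0 0
    map_add' := fun a b => by simp [fromBlocks_add]
    map_smul' := fun r a => by simp [fromBlocks_smul] }

/-- inclusion of the (1,2) block -/
def inc12 : Matrix X Y K →ₗ[K] Matrix (X ⊕ Y) (X ⊕ Y) K :=
  { toFun := fun F => fromBlocks 0 F 0 0
    map_add' := fun a b => by simp [fromBlocks_add]
    map_smul' := fun r a => by simp [fromBlocks_smul] }

/-- projection to the (1,1) block -/
def pr11 : Matrix (X ⊕ Y) (X ⊕ Y) K →ₗ[K] Matrix X X K :=
  { toFun := fun F => F.toBlocks₁₁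
    map_add' := fun a b => by ext; simp [toBlocks₁₁]
    map_smul' := fun r a => by ext; simp [toBlocks₁₁] }

/-- projection to the (1,2) block -/
def pr12 : Matrix (X ⊕ Y) (X ⊕ Y) K →ₗ[K] Matrix X Y K :=
  { toFun := fun F => F.toBlocks₁₂
    map_add' := fun a b => by ext; simp [toBlocks₁₂]
    map_smul' := fun r a => by ext; simp [toBlocks₁₂] }

/-- right multiplication by a matrix -/
def mulR (Ξ : Matrix Y Y K) : Matrix X Y K →ₗ[K] Matrix X Y K :=
  { toFun := fun F => F * Ξ
    map_add' := fun a b => by rw [Matrix.add_mul]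
    map_smul' := fun r a => by simp }

lemma mulR_apply (Ξ : Matrix Y Y K) (F : Matrix X Y K) : mulR Ξ F = F * Ξ := rfl

lemma pr11_mul (M : Matrix (X ⊕ Y) (X ⊕ Y) K) (p : Matrix X X K × Matrix Y Y K) :
    pr11 (M * bl K X Y p) = pr11 M * p.1 := by
  conv_lhs => rw [← fromBlocks_toBlocks M]
  simp [pr11, bl_apply, fromBlocks_multiply]

lemma mul_pr11 (M : Matrix (X ⊕ Y) (X ⊕ Y) K) (p : Matrix X X K × Matrix Y Y K) :
    pr11 (bl K X Y p * M) = p.1 * pr11 M := by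
  conv_lhs => rw [← fromBlocks_toBlocks M]
  simp [pr11, bl_apply, fromBlocks_multiply]

lemma pr12_mul (M : Matrix (X ⊕ Y) (X ⊕ Y) K) (p : Matrix X X K × Matrix Y Y K) :
    pr12 (M * bl K X Y p) = pr12 M * p.2 := by
  conv_lhs => rw [← fromBlocks_toBlocks M]
  simp [pr12, bl_apply, fromBlocks_multiply]

lemma mul_pr12 (M : Matrix (X ⊕ Y) (X ⊕ Y) K) (p : Matrix X X K × Matrix Y Y K) :
    pr12 (bl K X Y p * M) = p.1 * pr12 M := by
  conv_lhs => rw [← fromBlocks_toBlocks M]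
  simp [pr12, bl_apply, fromBlocks_multiply]

lemma bl_inc11 (F : Matrix X X K) (p : Matrix X X K × Matrix Y Y K) :
    bl K X Y p * inc11 F = inc11 (p.1 * F) := by
  simp [inc11, bl_apply, fromBlocks_multiply]

lemma inc11_bl (F : Matrix X X K) (p : Matrix X X K × Matrix Y Y K) :
    inc11 F * bl K X Y p = inc11 (F * p.1) := by
  simp [inc11, bl_apply, fromBlocks_multiply]

lemma bl_inc12 (F : Matrix X Y K) (p : Matrix X X K × Matrix Y Y K) :
    bl K X Y p * inc12 F = inc12 (p.1 * F) := by
  simp [inc12, bl_apply, fromBlocks_multiply]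

lemma inc12_bl (F : Matrix X Y K) (p : Matrix X X K × Matrix Y Y K) :
    inc12 F * bl K X Y p = inc12 (F * p.2) := by
  simp [inc12, bl_apply, fromBlocks_multiply]

lemma pr11_inc11 (F : Matrix X X K) : pr11 (inc11 F : Matrix (X ⊕ Y) (X ⊕ Y) K) = F := by
  simp [pr11, inc11]

lemma pr12_inc12 (F : Matrix X Y K) : pr12 (inc12 F : Matrix (X ⊕ Y) (X ⊕ Y) K) = F := by
  simp [pr12, inc12]

theorem two_proj [CharZero K] {q : K} (hq : q ≠ 0)
    (hqi : ∀ k : ℕ, 1 ≤ k → (∑ i ∈ range k, q ^ i) ≠ 0) {n : ℕ}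
    {T : ℕ → Matrix X X K} {T' : ℕ → Matrix Y Y K} (h : HRel q T n) (h' : HRel q T' n)
    (Ξ : Matrix Y Y K) (hΞ : ∀ i, i + 1 < n → T' i * Ξ = Ξ * T' i)
    (hχ : ∀ a ∈ Asub K (fun i => (T i, T' i)) n, a.1.trace = (Ξ * a.2).trace) :
    ∃ (P₁ : Matrix X X K →ₗ[K] Matrix X X K) (P₂ : Matrix X Y K →ₗ[K] Matrix X Y K),
      (∀ F i, i + 1 < n → P₁ F * T i = T i * P₁ F) ∧
      (∀ F, (∀ i, i + 1 < n → F * T i = T i * F) → P₁ F = F) ∧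
      (∀ F i, i + 1 < n → P₂ F * T' i = T i * P₂ F) ∧
      (∀ F, (∀ i, i + 1 < n → F * T' i = T i * F) → P₂ F = F) ∧
      (∀ F, P₂ (F * Ξ) = P₂ F * Ξ) ∧
      LinearMap.trace K _ P₁ = LinearMap.trace K _ (mulR Ξ ∘ₗ P₂) := by
  obtain ⟨P, hP, hP1, hP2⟩ := exists_proj hq hqi ((h.prod h').map (bl K X Y))
  have hmem : ∀ a ∈ Asub K (fun i => bl K X Y (T i, T' i)) n,
      ∃ p ∈ Asub K (fun i => (T i, T' i)) n, a = bl K X Y p := by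
    intro a ha
    have e : Asub K (fun i => bl K X Y (T i, T' i)) n =
        (Asub K (fun i => (T i, T' i)) n).map (bl K X Y) := by
      rw [Asub, Asub, AlgHom.map_adjoin]
      congr 1
      ext x; constructor
      · rintro ⟨i, hi, rfl⟩; exact ⟨_, ⟨i, hi, rfl⟩, rfl⟩
      · rintro ⟨_, ⟨i, hi, rfl⟩, rfl⟩; exact ⟨i, hi, rfl⟩
    rw [e] at ha
    obtain ⟨p, hp, rfl⟩ := ha
    exact ⟨p, hp, rfl⟩
  have hcomm : ∀ p ∈ Asub K (fun i => (T i, T' i)) n, p.2 * Ξ = Ξ * p.2 := by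
    intro p hp
    induction hp using Algebra.adjoin_induction with
    | mem x hx => obtain ⟨i, hi, rfl⟩ := hx; exact hΞ i hi
    | algebraMap r => exact Algebra.commutes r Ξ
    | add x y _ _ hx hy => simp only [Prod.snd_add, add_mul, mul_add, hx, hy]
    | mul x y _ _ hx hy => simp only [Prod.snd_mul]; rw [mul_assoc, hy, ← mul_assoc, hx, mul_assoc]
  refine ⟨pr11 ∘ₗ P ∘ₗ inc11, pr12 ∘ₗ P ∘ₗ inc12, ?_, ?_, ?_, ?_, ?_, ?_⟩
  · intro F i hi
    have := congrArg pr11 (hP1 (inc11 F) i hi)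
    rwa [pr11_mul, mul_pr11] at this
  · intro F hF
    have := hP2 (inc11 F) (fun i hi => by
      simp only [inc11_bl, bl_inc11]; rw [hF i hi])
    simp only [LinearMap.comp_apply, this, pr11_inc11]
  · intro F i hi
    have := congrArg pr12 (hP1 (inc12 F) i hi)
    rwa [pr12_mul, mul_pr12] at this
  · intro F hF
    have := hP2 (inc12 F) (fun i hi => by
      simp only [inc12_bl, bl_inc12]; rw [hF i hi])
    simp only [LinearMap.comp_apply, this, pr12_inc12]
  · intro F
    simp only [LinearMap.comp_apply]
    clear hP1 hP2
    induction hP using Submodule.span_induction with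
    | mem φ hφ =>
      obtain ⟨a, ha, b, hb, rfl⟩ := hφ
      obtain ⟨a, ha, rfl⟩ := hmem a ha
      obtain ⟨b, hb', rfl⟩ := hmem b hb
      simp only [LinearMap.comp_apply, LinearMap.mulLeft_apply, LinearMap.mulRight_apply,
        inc12_bl, bl_inc12, pr12_inc12]
      rw [Matrix.mul_assoc F, ← hcomm b hb']
      simp only [Matrix.mul_assoc]
    | zero => simp
    | add x y _ _ hx hy => simp only [LinearMap.add_apply, map_add, hx, hy, Matrix.add_mul]
    | smul r x _ hx => simp only [LinearMap.smul_apply, map_smul, hx, Matrix.smul_mul]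
  · clear hP1 hP2
    induction hP using Submodule.span_induction with
    | mem φ hφ =>
      obtain ⟨a, ha, b, hb, rfl⟩ := hφ
      obtain ⟨a, ha, rfl⟩ := hmem a ha
      obtain ⟨b, hb', rfl⟩ := hmem b hb
      rw [trace_lr a.1 b.1, trace_lr a.1 (Ξ * b.2), hχ b hb']
      · intro F
        simp only [LinearMap.comp_apply, LinearMap.mulLeft_apply, LinearMap.mulRight_apply,
          inc12_bl, bl_inc12, pr12_inc12, mulR_apply]
        rw [← hcomm b hb']; simp only [Matrix.mul_assoc]
      · intro F
        simp only [LinearMap.comp_apply, LinearMap.mulLeft_apply, LinearMap.mulRight_apply,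
          inc11_bl, bl_inc11, pr11_inc11]
        simp only [Matrix.mul_assoc]
    | zero => simp
    | add x y _ _ hx hy =>
      simp only [LinearMap.add_comp, LinearMap.comp_add, map_add, hx, hy]
    | smul r x _ hx =>
      simp only [LinearMap.smul_comp, LinearMap.comp_smul, map_smul, hx]

end
end HeckeP

namespace HeckeP
open Finset

section
variable {K A B : Type*} [Field K] [Ring A] [Algebra K A] [Ring B] [Algebra K B]

/-- quantum integer -/
def qi (q : K) (n : ℕ) : K := ∑ i ∈ range n, q ^ i

lemma qi_succ' (q : K) (n : ℕ) : qi q (n + 1) = 1 + q * qi q n := by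
  rw [qi, sum_range_succ', qi, mul_sum, add_comm]
  simp [pow_succ']

/-- sum over minimal coset representatives -/
def SS (T : ℕ → A) : ℕ → A
  | 0 => 1
  | m + 1 => 1 + T m * SS T m

/-- the q-symmetrizer -/
noncomputable def sym (q : K) (T : ℕ → A) : ℕ → A
  | 0 => 1
  | m + 1 => (qi q (m + 1))⁻¹ • (sym q T m * SS T m)

lemma SS_comm {T : ℕ → A} (m : ℕ) (z : A) (hz : ∀ i, i < m → z * T i = T i * z) :
    z * SS T m = SS T m * z := by
  induction m with
  | zero => simp [SS]
  | succ m ih =>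
    rw [SS, mul_add, add_mul, mul_one, one_mul, ← mul_assoc, hz m (by omega), mul_assoc, mul_assoc,
      ih (fun i hi => hz i (by omega))]

lemma sym_comm {q : K} {T : ℕ → A} (m : ℕ) (z : A) (hz : ∀ i, i + 1 < m → z * T i = T i * z) :
    z * sym q T m = sym q T m * z := by
  induction m with
  | zero => simp [sym]
  | succ m ih =>
    rw [sym, mul_smul_comm, smul_mul_assoc, ← mul_assoc, ih (fun i hi => hz i (by omega)),
      mul_assoc, mul_assoc, SS_comm m z (fun i hi => hz i (by omega))]

lemma SS_map (T : ℕ → A) (f : A →ₐ[K] B) (m : ℕ) : f (SS T m) = SS (fun i => f (T i)) m := by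
  induction m with
  | zero => simp [SS]
  | succ m ih => simp [SS, ih]

lemma sym_map (q : K) (T : ℕ → A) (f : A →ₐ[K] B) (m : ℕ) :
    f (sym q T m) = sym q (fun i => f (T i)) m := by
  induction m with
  | zero => simp [sym]
  | succ m ih => simp [sym, ih, SS_map]

lemma SS_congr {T T' : ℕ → A} (m : ℕ) (h : ∀ i, i < m → T i = T' i) : SS T m = SS T' m := by
  induction m with
  | zero => rfl
  | succ m ih => rw [SS, SS, h m (by omega), ih (fun i hi => h i (by omega))]

lemma sym_congr (q : K) {T T' : ℕ → A} (m : ℕ) (h : ∀ i, i + 1 < m → T i = T' i) :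
    sym q T m = sym q T' m := by
  induction m with
  | zero => rfl
  | succ m ih =>
    rw [sym, sym, ih (fun i hi => h i (by omega)), SS_congr m (fun i hi => h i (by omega))]

lemma SS_mem {T : ℕ → A} (m : ℕ) : SS T m ∈ Asub K T (m + 1) := by
  induction m with
  | zero => exact one_mem _
  | succ m ih => exact add_mem (one_mem _) (mul_mem (T_mem_Asub (by omega)) (Asub_mono (by omega) ih))

lemma sym_mem (q : K) {T : ℕ → A} (m : ℕ) : sym q T m ∈ Asub K T m := by
  induction m with
  | zero => exact one_mem _
  | succ m ih =>
    exact Subalgebra.smul_mem _ (mul_mem (Asub_mono (by omega) ih) (SS_mem m)) _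

lemma SS_abs {q : K} {T : ℕ → A} {n : ℕ} (h : HRel q T n) (m : ℕ) (hm : m < n) :
    ∀ e : A, (∀ k, k + 1 < m → e * T k = q • e) →
      ∀ i, i < m → e * SS T m * T i = q • (e * SS T m) := by
  induction m with
  | zero => intro e _ i hi; omega
  | succ m ih =>
    intro e he i hi
    rcases Nat.lt_or_ge i m with him | him
    · have := ih (by omega) (e * T m) (fun k hk => by
        rw [mul_assoc, ← h.comm k m (by omega) (by omega), ← mul_assoc, he k (by omega),
          smul_mul_assoc]) i him
      rw [SS, mul_add, add_mul, mul_one, he i (by omega), ← mul_assoc, this, smul_add]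
    · obtain rfl : i = m := by omega
      have hqd := h.quad i (by omega)
      rcases i with _ | i
      · simp only [SS, mul_one]
        rw [mul_assoc, add_mul, one_mul, hqd, mul_add, mul_add, mul_add, mul_smul_comm,
          mul_smul_comm, mul_one]
        module
      · have hc : T (i+1) * SS T i = SS T i * T (i+1) := SS_comm i _ (fun j hj =>
          (h.comm j (i+1) (by omega) (by omega)).symm)
        have hb := h.braid i (by omega)
        have e1 : e * (T (i+1) * (T i * SS T i)) * T (i+1) = q • (e * (T (i+1) * (T i * SS T i))) := by
          calc e * (T (i+1) * (T i * SS T i)) * T (i+1)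
              = e * (T (i+1) * T i * (SS T i * T (i+1))) := by simp only [mul_assoc]
            _ = e * (T (i+1) * T i * T (i+1) * SS T i) := by rw [← hc]; simp only [mul_assoc]
            _ = e * T i * (T (i+1) * T i * SS T i) := by rw [← hb]; simp only [mul_assoc]
            _ = _ := by rw [he i (by omega), smul_mul_assoc]; simp only [mul_assoc]
        have e2 : e * T (i+1) * T (i+1) = (q-1) • (e * T (i+1)) + q • e := by
          rw [mul_assoc, hqd, mul_add, mul_smul_comm, mul_smul_comm, mul_one]
        rw [SS, SS, mul_add (T (i+1)), mul_one, mul_add, mul_add, mul_one, add_mul, add_mul, e1, e2]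
        module

lemma sym_abs {q : K} {T : ℕ → A} {n : ℕ} (h : HRel q T n) (m : ℕ) (hm : m ≤ n) :
      ∀ i, i + 1 < m → sym q T m * T i = q • sym q T m := by
  induction m with
  | zero => intro i hi; omega
  | succ m ih =>
    intro i hi
    rw [sym, smul_mul_assoc, SS_abs h m (by omega) _ (ih (by omega)) i (by omega), smul_comm]

lemma SS_aug {M : Type*} [AddCommGroup M] [Module K M] (q : K) {T : ℕ → A} (m : ℕ)
    (L : A →ₗ[K] M) (hL : ∀ a i, i < m → L (a * T i) = q • L a) (a : A) :
    L (a * SS T m) = qi q (m + 1) • L a := by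
  induction m generalizing a with
  | zero => simp [SS, qi]
  | succ m ih =>
    rw [SS, mul_add, mul_one, map_add, ← mul_assoc, ih (fun a i hi => hL a i (by omega)),
      hL a m (by omega), smul_smul, qi_succ' q (m+1), add_smul, one_smul, mul_comm]

lemma sym_aug {M : Type*} [AddCommGroup M] [Module K M] {q : K} (hqi : ∀ k : ℕ, 1 ≤ k → qi q k ≠ 0)
    {T : ℕ → A} (m : ℕ)
    (L : A →ₗ[K] M) (hL : ∀ a i, i + 1 < m → L (a * T i) = q • L a) (a : A) :
    L (a * sym q T m) = L a := by
  induction m generalizing a with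
  | zero => simp [sym]
  | succ m ih =>
    rw [sym, mul_smul_comm, map_smul, ← mul_assoc, SS_aug q m L (fun a i hi => hL a i (by omega)),
      smul_smul, inv_mul_cancel₀ (hqi _ (by omega)), one_smul, ih (fun a i hi => hL a i (by omega))]

open MulOpposite in
lemma HRel.op {q : K} {T : ℕ → A} {n : ℕ} (h : HRel q T n) : HRel q (fun i => op (T i)) n :=
  ⟨fun i hi => by rw [← op_mul, h.quad i hi]; simp,
   fun i hi => by
    simp only [← op_mul]; rw [← mul_assoc, h.braid i hi, mul_assoc],
   fun i j hi hj => by simp only [← op_mul]; rw [h.comm i j hi hj]⟩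

open MulOpposite in
lemma sym_abs_left {q : K} (hqi : ∀ k : ℕ, 1 ≤ k → qi q k ≠ 0) {T : ℕ → A} {n : ℕ}
    (h : HRel q T n) (m : ℕ) (hm : m ≤ n) :
    ∀ i, i + 1 < m → T i * sym q T m = q • sym q T m := by
  let s' := unop (sym q (fun i => op (T i)) m)
  have habs : ∀ i, i + 1 < m → T i * s' = q • s' := by
    intro i hi
    have := congrArg unop (sym_abs h.op m hm i hi)
    simpa using this
  have e1 : sym q T m * s' = s' := by
    have := sym_aug hqi (T := T) m (LinearMap.mulRight K s') (fun a i hi => by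
      simp only [LinearMap.mulRight_apply]
      rw [mul_assoc, habs i hi, mul_smul_comm]) 1
    simpa using this
  have e2 : sym q T m * s' = sym q T m := by
    have := sym_aug hqi (T := fun i => op (T i)) m
      (LinearMap.mulLeft K (sym q T m) ∘ₗ (opLinearEquiv K).symm.toLinearMap) (fun a i hi => by
      simp only [LinearMap.mulLeft_apply, LinearMap.comp_apply, LinearEquiv.coe_coe,
        coe_opLinearEquiv_symm, unop_mul, unop_op]
      rw [← mul_assoc, sym_abs h m hm i hi, smul_mul_assoc]) 1
    simpa using this
  have : sym q T m = s' := by rw [← e2, e1]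
  rw [this]; exact habs

lemma sym_idem {q : K} (hqi : ∀ k : ℕ, 1 ≤ k → qi q k ≠ 0) {T : ℕ → A} {n : ℕ}
    (h : HRel q T n) (m : ℕ) (hm : m ≤ n) : sym q T m * sym q T m = sym q T m := by
  have := sym_aug hqi (T := T) m (LinearMap.mulRight K (sym q T m)) (fun a i hi => by
      simp only [LinearMap.mulRight_apply]
      rw [mul_assoc, sym_abs_left hqi h m hm i hi, mul_smul_comm]) 1
  simpa using this

end
end HeckeP

namespace HeckeP
open Finset Matrix

section
variable {K : Type*} [Field K] {ι : Type*} [Fintype ι] [DecidableEq ι]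

/-- words of length n -/
abbrev Wd (ι : Type*) (n : ℕ) := Fin n → ι

/-- generator acting on letters i, i+1 -/
def Tm (R : Matrix (ι × ι) (ι × ι) K) (n i : ℕ) : Matrix (Wd ι n) (Wd ι n) K :=
  Matrix.of fun w v => if h : i + 1 < n then
    (if ∀ j : Fin n, (j : ℕ) ≠ i → (j : ℕ) ≠ i + 1 → w j = v j then
      R (w ⟨i, by omega⟩, w ⟨i + 1, h⟩) (v ⟨i, by omega⟩, v ⟨i + 1, h⟩) else 0) else 0

lemma Tm_apply (R : Matrix (ι × ι) (ι × ι) K) {n i : ℕ} (h : i + 1 < n) (w v : Wd ι n) :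
    Tm R n i w v = if ∀ j : Fin n, (j : ℕ) ≠ i → (j : ℕ) ≠ i + 1 → w j = v j then
      R (w ⟨i, by omega⟩, w ⟨i + 1, h⟩) (v ⟨i, by omega⟩, v ⟨i + 1, h⟩) else 0 := by
  simp [Tm, h]

/-- tensor product of operators on words -/
def ten {m k : ℕ} (A : Matrix (Wd ι m) (Wd ι m) K) (B : Matrix (Wd ι k) (Wd ι k) K) :
    Matrix (Wd ι (m + k)) (Wd ι (m + k)) K :=
  (A.kronecker B).submatrix (Fin.appendEquiv m k).symm (Fin.appendEquiv m k).symm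

lemma ten_apply {m k : ℕ} (A : Matrix (Wd ι m) (Wd ι m) K) (B : Matrix (Wd ι k) (Wd ι k) K)
    (w v : Wd ι (m + k)) : ten A B w v =
      A (fun j => w (Fin.castAdd k j)) (fun j => v (Fin.castAdd k j)) *
      B (fun j => w (Fin.natAdd m j)) (fun j => v (Fin.natAdd m j)) := rfl

lemma ten_mul {m k : ℕ} (A A' : Matrix (Wd ι m) (Wd ι m) K) (B B' : Matrix (Wd ι k) (Wd ι k) K) :
    ten A B * ten A' B' = ten (A * A') (B * B') := by
  rw [ten, ten, ten, submatrix_mul_equiv]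
  congr 1
  exact (mul_kronecker_mul A A' B B').symm

lemma ten_one {m k : ℕ} : ten (1 : Matrix (Wd ι m) (Wd ι m) K) (1 : Matrix (Wd ι k) (Wd ι k) K) = 1 := by
  have : (1 : Matrix (Wd ι m) (Wd ι m) K).kronecker (1 : Matrix (Wd ι k) (Wd ι k) K) = 1 :=
    one_kronecker_one
  rw [ten, this, submatrix_one_equiv]

lemma ten_trace {m k : ℕ} (A : Matrix (Wd ι m) (Wd ι m) K) (B : Matrix (Wd ι k) (Wd ι k) K) :
    (ten A B).trace = A.trace * B.trace := by
  have : (A.kronecker B).trace = A.trace * B.trace := trace_kronecker A B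
  rw [← this]
  exact Fintype.sum_equiv (Fin.appendEquiv m k).symm _ _ (fun x => rfl)

/-- A ↦ A ⊗ 1 -/
def embL (K ι : Type*) [Field K] [Fintype ι] [DecidableEq ι] (m k : ℕ) :
    Matrix (Wd ι m) (Wd ι m) K →ₐ[K] Matrix (Wd ι (m + k)) (Wd ι (m + k)) K :=
  AlgHom.ofLinearMap
    { toFun := fun A => ten A 1
      map_add' := fun a b => by ext; simp [ten_apply, add_mul]
      map_smul' := fun r a => by ext; simp [ten_apply, mul_assoc] }
    ten_one (by intro a b; simp [ten_mul])

/-- B ↦ 1 ⊗ B -/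
def embR (K ι : Type*) [Field K] [Fintype ι] [DecidableEq ι] (m k : ℕ) :
    Matrix (Wd ι k) (Wd ι k) K →ₐ[K] Matrix (Wd ι (m + k)) (Wd ι (m + k)) K :=
  AlgHom.ofLinearMap
    { toFun := fun A => ten 1 A
      map_add' := fun a b => by ext; simp [ten_apply, mul_add]
      map_smul' := fun r a => by ext; simp [ten_apply]; ring }
    ten_one (by intro a b; simp [ten_mul])

lemma embL_apply {m k : ℕ} (A : Matrix (Wd ι m) (Wd ι m) K) : embL K ι m k A = ten A 1 := rfl
lemma embR_apply {m k : ℕ} (A : Matrix (Wd ι k) (Wd ι k) K) : embR K ι m k A = ten 1 A := rfl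

lemma embL_mul_embR {m k : ℕ} (A : Matrix (Wd ι m) (Wd ι m) K) (B : Matrix (Wd ι k) (Wd ι k) K) :
    embL K ι m k A * embR K ι m k B = ten A B := by
  rw [embL_apply, embR_apply, ten_mul, mul_one, one_mul]

lemma embR_mul_embL {m k : ℕ} (A : Matrix (Wd ι m) (Wd ι m) K) (B : Matrix (Wd ι k) (Wd ι k) K) :
    embR K ι m k B * embL K ι m k A = ten A B := by
  rw [embL_apply, embR_apply, ten_mul, mul_one, one_mul]

lemma Tm_embL (R : Matrix (ι × ι) (ι × ι) K) {m k i : ℕ} (hi : i + 1 < m) :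
    Tm R (m + k) i = embL K ι m k (Tm R m i) := by
  ext w v
  rw [embL_apply, ten_apply, Tm_apply R (by omega : i + 1 < m + k), Tm_apply R hi, Matrix.one_apply]
  have e : (∀ j : Fin (m + k), (j : ℕ) ≠ i → (j : ℕ) ≠ i + 1 → w j = v j) ↔
      (∀ j : Fin m, (j : ℕ) ≠ i → (j : ℕ) ≠ i + 1 → w (Fin.castAdd k j) = v (Fin.castAdd k j)) ∧
      (fun j => w (Fin.natAdd m j)) = (fun j => v (Fin.natAdd m j)) := by
    rw [Fin.forall_fin_add, funext_iff]
    refine and_congr Iff.rfl (forall_congr' fun j => ?_)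
    simp only [Fin.val_natAdd]
    exact ⟨fun h => h (by omega) (by omega), fun h _ _ => h⟩
  by_cases h1 : ∀ j : Fin m, (j : ℕ) ≠ i → (j : ℕ) ≠ i + 1 → w (Fin.castAdd k j) = v (Fin.castAdd k j)
  · by_cases h2 : (fun j => w (Fin.natAdd m j)) = (fun j => v (Fin.natAdd m j))
    · rw [if_pos (e.mpr ⟨h1, h2⟩), if_pos h1, if_pos h2, mul_one]; rfl
    · rw [if_neg (fun h => h2 (e.mp h).2), if_neg h2, mul_zero]
  · rw [if_neg (fun h => h1 (e.mp h).1), if_neg h1, zero_mul]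

lemma Tm_embR (R : Matrix (ι × ι) (ι × ι) K) {m k i : ℕ} (hi : i + 1 < k) :
    Tm R (m + k) (m + i) = embR K ι m k (Tm R k i) := by
  ext w v
  rw [embR_apply, ten_apply, Tm_apply R (by omega : m + i + 1 < m + k), Tm_apply R hi,
    Matrix.one_apply]
  have e : (∀ j : Fin (m + k), (j : ℕ) ≠ m + i → (j : ℕ) ≠ m + i + 1 → w j = v j) ↔
      (fun j => w (Fin.castAdd k j)) = (fun j => v (Fin.castAdd k j)) ∧
      (∀ j : Fin k, (j : ℕ) ≠ i → (j : ℕ) ≠ i + 1 → w (Fin.natAdd m j) = v (Fin.natAdd m j)) := by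
    rw [Fin.forall_fin_add, funext_iff]
    refine and_congr (forall_congr' fun j => ?_) (forall_congr' fun j => ?_)
    · simp only [Fin.val_castAdd]
      exact ⟨fun h => h (by omega) (by omega), fun h _ _ => h⟩
    · simp only [Fin.val_natAdd]
      exact ⟨fun h a b => h (by omega) (by omega), fun h a b => h (by omega) (by omega)⟩
  by_cases h1 : ∀ j : Fin k, (j : ℕ) ≠ i → (j : ℕ) ≠ i + 1 → w (Fin.natAdd m j) = v (Fin.natAdd m j)
  · by_cases h2 : (fun j => w (Fin.castAdd k j)) = (fun j => v (Fin.castAdd k j))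
    · rw [if_pos (e.mpr ⟨h2, h1⟩), if_pos h1, if_pos h2, one_mul]; rfl
    · rw [if_neg (fun h => h2 (e.mp h).1), if_neg h2, zero_mul]
  · rw [if_neg (fun h => h1 (e.mp h).2), if_neg h1, mul_zero]

/-- A Hecke datum: an R-matrix with weights -/
structure HD (q : K) (R : Matrix (ι × ι) (ι × ι) K) (x : ι → K) : Prop where
  quad : R * R = (q - 1) • R + q • (1 : Matrix (ι × ι) (ι × ι) K)
  braid : Tm R 3 0 * Tm R 3 1 * Tm R 3 0 = Tm R 3 1 * Tm R 3 0 * Tm R 3 1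
  wt : ∀ a b c d, x a * x b * R (a, b) (c, d) = R (a, b) (c, d) * (x c * x d)

lemma Tm_two (R : Matrix (ι × ι) (ι × ι) K) :
    Tm R 2 0 = R.submatrix (finTwoArrowEquiv ι) (finTwoArrowEquiv ι) := by
  ext w v
  rw [Tm_apply R (by omega), if_pos]
  · rfl
  · intro j; omega

lemma HD.hrel {q : K} {R : Matrix (ι × ι) (ι × ι) K} {x : ι → K} (h : HD q R x) (n : ℕ) :
    HRel q (Tm R n) n := by
  refine ⟨fun i hi => ?_, fun i hi => ?_, fun i j hi hj => ?_⟩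
  · obtain ⟨k, rfl⟩ : ∃ k, n = i + (2 + k) := ⟨n - i - 2, by omega⟩
    have e : Tm R (i + (2 + k)) i = (embR K ι i (2+k)) (embL K ι 2 k (Tm R 2 0)) := by
      rw [← Tm_embL R (by omega), ← Tm_embR R (by omega)]; rfl
    have q2 : Tm R 2 0 * Tm R 2 0 = (q - 1) • Tm R 2 0 + q • (1 : Matrix (Wd ι 2) (Wd ι 2) K) := by
      rw [Tm_two, submatrix_mul_equiv, h.quad]
      ext w v
      simp [Matrix.one_apply, funext_iff, Fin.forall_fin_two]
    rw [e, ← map_mul, ← map_mul, q2]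
    simp
  · obtain ⟨k, rfl⟩ : ∃ k, n = i + (3 + k) := ⟨n - i - 3, by omega⟩
    have e : Tm R (i + (3 + k)) i = (embR K ι i (3+k)) (embL K ι 3 k (Tm R 3 0)) := by
      rw [← Tm_embL R (by omega), ← Tm_embR R (by omega)]; rfl
    have e' : Tm R (i + (3 + k)) (i + 1) = (embR K ι i (3+k)) (embL K ι 3 k (Tm R 3 1)) := by
      rw [← Tm_embL R (by omega), ← Tm_embR R (by omega)]
    rw [e, e']
    simp only [← map_mul]
    rw [h.braid]
  · obtain ⟨l, rfl⟩ : ∃ l, j = (i + 2) + l := ⟨j - (i + 2), by omega⟩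
    obtain ⟨k, rfl⟩ : ∃ k, n = (i + 2) + (l + 2 + k) := ⟨n - (i + 2) - (l + 2), by omega⟩
    rw [Tm_embL R (by omega), Tm_embR R (by omega), embL_mul_embR, embR_mul_embL]

/-- diagonal weight matrix -/
def Xi (x : ι → K) (n : ℕ) : Matrix (Wd ι n) (Wd ι n) K := Matrix.diagonal fun w => ∏ j, x (w j)

lemma Xi_add (x : ι → K) (m k : ℕ) : Xi x (m + k) = ten (Xi x m) (Xi x k) := by
  ext w v
  rw [ten_apply, Xi, Xi, Xi, diagonal_apply, diagonal_apply, diagonal_apply]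
  by_cases h : w = v
  · subst h; simp [Fin.prod_univ_add]
  · rw [if_neg h]
    by_cases h1 : (fun j => w (Fin.castAdd k j)) = (fun j => v (Fin.castAdd k j))
    · by_cases h2 : (fun j => w (Fin.natAdd m j)) = (fun j => v (Fin.natAdd m j))
      · exfalso; apply h
        funext j
        refine Fin.addCases (fun j => congrFun h1 j) (fun j => congrFun h2 j) j
      · rw [if_neg h2, mul_zero]
    · rw [if_neg h1, zero_mul]

lemma HD.Xi_comm {q : K} {R : Matrix (ι × ι) (ι × ι) K} {x : ι → K} (h : HD q R x) (n : ℕ) :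
    ∀ i, i + 1 < n → Tm R n i * Xi x n = Xi x n * Tm R n i := by
  intro i hi
  obtain ⟨k, rfl⟩ : ∃ k, n = i + (2 + k) := ⟨n - i - 2, by omega⟩
  have e : Tm R (i + (2 + k)) i = (embR K ι i (2+k)) (embL K ι 2 k (Tm R 2 0)) := by
    rw [← Tm_embL R (by omega), ← Tm_embR R (by omega)]; rfl
  have q2 : Tm R 2 0 * Xi x 2 = Xi x 2 * Tm R 2 0 := by
    rw [Tm_two, Xi]
    ext w v
    rw [mul_diagonal, diagonal_mul]
    simp only [submatrix_apply, finTwoArrowEquiv_apply, Fin.prod_univ_two]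
    exact (h.wt _ _ _ _).symm
  rw [e, Xi_add, Xi_add, embR_apply, embL_apply, ten_mul, ten_mul, ten_mul, ten_mul, q2]
  simp

/-- weighted trace -/
def chi (x : ι → K) (n : ℕ) : Matrix (Wd ι n) (Wd ι n) K →ₗ[K] K :=
  Matrix.traceLinearMap _ K K ∘ₗ LinearMap.mulLeft K (Xi x n)

lemma chi_apply (x : ι → K) (n : ℕ) (a : Matrix (Wd ι n) (Wd ι n) K) :
    chi x n a = (Xi x n * a).trace := rfl

lemma chi_ten (x : ι → K) {m k : ℕ} (a : Matrix (Wd ι m) (Wd ι m) K)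
    (b : Matrix (Wd ι k) (Wd ι k) K) : chi x (m + k) (ten a b) = chi x m a * chi x k b := by
  rw [chi_apply, Xi_add, ten_mul, ten_trace, chi_apply, chi_apply]

lemma chi_zero (x : ι → K) : chi x 0 1 = 1 := by
  rw [chi_apply, mul_one, Xi, trace_diagonal]; simp

lemma HD.comm_Asub {q : K} {R : Matrix (ι × ι) (ι × ι) K} {x : ι → K} (h : HD q R x) {n : ℕ}
    {a : Matrix (Wd ι n) (Wd ι n) K} (ha : a ∈ Asub K (Tm R n) n) : a * Xi x n = Xi x n * a := by
  induction ha using Algebra.adjoin_induction with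
  | mem a ha => obtain ⟨i, hi, rfl⟩ := ha; exact h.Xi_comm n i hi
  | algebraMap r => exact Algebra.commutes r _
  | add x y _ _ hx hy => rw [add_mul, mul_add, hx, hy]
  | mul x y _ _ hx hy => rw [mul_assoc, hy, ← mul_assoc, hx, mul_assoc]

lemma HD.chi_comm {q : K} {R : Matrix (ι × ι) (ι × ι) K} {x : ι → K} (h : HD q R x) {n : ℕ}
    {a : Matrix (Wd ι n) (Wd ι n) K} (ha : a ∈ Asub K (Tm R n) n) (b : Matrix (Wd ι n) (Wd ι n) K) :
    chi x n (a * b) = chi x n (b * a) := by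
  rw [chi_apply, chi_apply, ← mul_assoc, ← h.comm_Asub ha, mul_assoc, trace_mul_comm, mul_assoc]

end
end HeckeP

namespace HeckeP
open Finset Matrix

section
variable {K A B : Type*} [Field K] [Ring A] [Algebra K A] [Ring B] [Algebra K B]

/-- `T_a T_{a+1} ⋯ T_{a+l-1}` -/
def chain (T : ℕ → A) : ℕ → ℕ → A
  | _, 0 => 1
  | a, l + 1 => T a * chain T (a + 1) l

lemma chain_succ (T : ℕ → A) (a l : ℕ) : chain T a (l + 1) = T a * chain T (a + 1) l := rfl

lemma chain_comm {T : ℕ → A} (l : ℕ) : ∀ (a : ℕ) (z : A)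
    (_ : ∀ i, a ≤ i → i < a + l → z * T i = T i * z), z * chain T a l = chain T a l * z := by
  induction l with
  | zero => intro a z _; simp [chain]
  | succ l ih =>
    intro a z hz
    rw [chain, ← mul_assoc, hz a le_rfl (by omega), mul_assoc, mul_assoc,
      ih (a+1) z (fun i h1 h2 => hz i (by omega) (by omega))]

lemma chain_map (T : ℕ → A) (f : A →ₐ[K] B) (l : ℕ) : ∀ a,
    f (chain T a l) = chain (fun i => f (T i)) a l := by
  induction l with
  | zero => intro a; simp [chain]
  | succ l ih => intro a; simp [chain, ih]

lemma chain_congr {T T' : ℕ → A} (l : ℕ) : ∀ a b,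
    (∀ i, i < l → T (a + i) = T' (b + i)) → chain T a l = chain T' b l := by
  induction l with
  | zero => intro a b _; rfl
  | succ l ih =>
    intro a b h
    rw [chain, chain, ih (a+1) (b+1) (fun i hi => by
      have := h (i+1) (by omega)
      rwa [show a + (i+1) = a + 1 + i by ring, show b + (i+1) = b + 1 + i by ring] at this)]
    have := h 0 (by omega)
    simp only [add_zero] at this
    rw [this]

lemma chain_mem {T : ℕ → A} {n : ℕ} (l : ℕ) : ∀ a, a + l < n → chain T a l ∈ Asub K T n := by
  induction l with
  | zero => intro a _; exact one_mem _
  | succ l ih => intro a h; exact mul_mem (T_mem_Asub (by omega)) (ih _ (by omega))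

lemma Asub_comm {T : ℕ → A} {m : ℕ} {z : A} (hz : ∀ i, i + 1 < m → z * T i = T i * z) {a : A}
    (ha : a ∈ Asub K T m) : z * a = a * z := by
  induction ha using Algebra.adjoin_induction with
  | mem a ha => obtain ⟨i, hi, rfl⟩ := ha; exact hz i hi
  | algebraMap r => exact (Algebra.commutes r _).symm
  | add x y _ _ hx hy => rw [add_mul, mul_add, hx, hy]
  | mul x y _ _ hx hy => rw [mul_assoc, ← hy, ← mul_assoc, hx, mul_assoc]

/-- the bimodule `A_{l+1} + A_{l+1} T_l A_{l+1}` -/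
def Dl (K : Type*) {A : Type*} [Field K] [Ring A] [Algebra K A] (T : ℕ → A) (l : ℕ) :
    Submodule K A :=
  (Asub K T (l + 1)).toSubmodule ⊔ Submodule.span K {a | ∃ b ∈ Asub K T (l + 1),
    ∃ c ∈ Asub K T (l + 1), a = b * T l * c}

lemma Dl_ind {T : ℕ → A} {l : ℕ} {p : A → Prop} (h0 : p 0) (hadd : ∀ x y, p x → p y → p (x + y))
    (hs : ∀ (r : K) x, p x → p (r • x)) (h1 : ∀ b ∈ Asub K T (l + 1), p b)
    (h2 : ∀ b ∈ Asub K T (l + 1), ∀ c ∈ Asub K T (l + 1), p (b * T l * c)) :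
    ∀ a ∈ Dl K T l, p a := by
  intro a ha
  obtain ⟨x, hx, y, hy, rfl⟩ := Submodule.mem_sup.mp ha
  refine hadd _ _ (h1 _ hx) ?_
  induction hy using Submodule.span_induction with
  | mem y hy => obtain ⟨b, hb, c, hc, rfl⟩ := hy; exact h2 b hb c hc
  | zero => exact h0
  | add x y _ _ hx hy => exact hadd _ _ (hx (Submodule.add_mem_sup ‹_› ‹_›)) (hy (Submodule.add_mem_sup ‹_› ‹_›))
  | smul r x _ hx => exact hs _ _ (hx (Submodule.add_mem_sup ‹_› ‹_›))

lemma Dl_left {T : ℕ → A} {l : ℕ} {b : A} (hb : b ∈ Asub K T (l + 1)) : b ∈ Dl K T l :=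
  Submodule.mem_sup_left hb

lemma Dl_mid {T : ℕ → A} {l : ℕ} {b c : A} (hb : b ∈ Asub K T (l + 1)) (hc : c ∈ Asub K T (l + 1)) :
    b * T l * c ∈ Dl K T l :=
  Submodule.mem_sup_right (Submodule.subset_span ⟨b, hb, c, hc, rfl⟩)

lemma Asub_one {T : ℕ → A} {b : A} (hb : b ∈ Asub K T 1) : ∃ r : K, b = algebraMap K A r := by
  have : {a | ∃ i, i + 1 < 1 ∧ a = T i} = ∅ := by ext; simp
  rw [Asub, this, Algebra.adjoin_empty] at hb
  obtain ⟨r, rfl⟩ := Algebra.mem_bot.mp hb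
  exact ⟨r, rfl⟩

lemma Asub_le_Dl_aux {T : ℕ → A} (l : ℕ)
    (key : ∀ b ∈ Asub K T (l + 1), T l * b * T l ∈ Dl K T l) :
    ∀ a ∈ Asub K T (l + 2), a ∈ Dl K T l := by
  have hL : ∀ b ∈ Asub K T (l + 1), ∀ d ∈ Dl K T l, b * d ∈ Dl K T l := by
    intro b hb
    refine Dl_ind (by simp) (fun x y hx hy => by rw [mul_add]; exact add_mem hx hy)
      (fun r x hx => by rw [mul_smul_comm]; exact Submodule.smul_mem _ _ hx)
      (fun c hc => Dl_left (mul_mem hb hc)) (fun c hc d hd => ?_)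
    rw [← mul_assoc, ← mul_assoc]; exact Dl_mid (mul_mem hb hc) hd
  have hR : ∀ b ∈ Asub K T (l + 1), ∀ d ∈ Dl K T l, d * b ∈ Dl K T l := by
    intro b hb
    refine Dl_ind (by simp) (fun x y hx hy => by rw [add_mul]; exact add_mem hx hy)
      (fun r x hx => by rw [smul_mul_assoc]; exact Submodule.smul_mem _ _ hx)
      (fun c hc => Dl_left (mul_mem hc hb)) (fun c hc d hd => ?_)
    rw [mul_assoc]; exact Dl_mid hc (mul_mem hd hb)
  have hT : ∀ d ∈ Dl K T l, T l * d ∈ Dl K T l := by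
    refine Dl_ind (by simp) (fun x y hx hy => by rw [mul_add]; exact add_mem hx hy)
      (fun r x hx => by rw [mul_smul_comm]; exact Submodule.smul_mem _ _ hx)
      (fun c hc => ?_) (fun c hc d hd => ?_)
    · have := Dl_mid (T := T) (one_mem (Asub K T (l+1))) hc
      rwa [one_mul] at this
    · rw [← mul_assoc, ← mul_assoc]; exact hR _ hd _ (key c hc)
  have : ∀ a ∈ Asub K T (l + 2), ∀ d ∈ Dl K T l, a * d ∈ Dl K T l := by
    intro a ha
    induction ha using Algebra.adjoin_induction with
    | mem a ha =>
      obtain ⟨i, hi, rfl⟩ := ha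
      intro d hd
      rcases Nat.lt_or_ge i l with h | h
      · exact hL _ (T_mem_Asub (by omega)) d hd
      · rw [show i = l by omega]; exact hT d hd
    | algebraMap r => intro d hd; rw [← Algebra.smul_def]; exact Submodule.smul_mem _ _ hd
    | add x y _ _ hx hy => intro d hd; rw [add_mul]; exact add_mem (hx d hd) (hy d hd)
    | mul x y _ _ hx hy => intro d hd; rw [mul_assoc]; exact hx _ (hy d hd)
  intro a ha
  have := this a ha 1 (Dl_left (one_mem _))
  rwa [mul_one] at this

lemma Asub_le_Dl {q : K} {T : ℕ → A} {n : ℕ} (h : HRel q T n) (l : ℕ) (hl : l + 2 ≤ n) :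
    ∀ a ∈ Asub K T (l + 2), a ∈ Dl K T l := by
  have base : ∀ l, l + 2 ≤ n → ∀ b ∈ Asub K T (l + 1), b * T l = T l * b →
      T l * b * T l ∈ Dl K T l := by
    intro l hl b hb hc
    rw [← hc, mul_assoc, h.quad l (by omega), mul_add, mul_smul_comm, mul_smul_comm, mul_one]
    refine add_mem (Submodule.smul_mem _ _ ?_) (Submodule.smul_mem _ _ (Dl_left hb))
    have := Dl_mid (T := T) hb (one_mem (Asub K T (l+1)))
    rwa [mul_one] at this
  induction l with
  | zero =>
    refine Asub_le_Dl_aux _ (fun b hb => ?_)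
    obtain ⟨r, rfl⟩ := Asub_one hb
    exact base 0 hl _ hb (Algebra.commutes _ _)
  | succ l ih =>
    refine Asub_le_Dl_aux _ (fun b hb => ?_)
    refine Dl_ind (K := K) (T := T) (l := l) (p := fun b => T (l+1) * b * T (l+1) ∈ Dl K T (l+1))
      (by simp) (fun x y hx hy => by rw [mul_add, add_mul]; exact add_mem hx hy)
      (fun r x hx => by rw [mul_smul_comm, smul_mul_assoc]; exact Submodule.smul_mem _ _ hx)
      (fun c hc => ?_) (fun c hc d hd => ?_) b (ih (by omega) b hb)
    · refine base (l+1) hl c (Asub_mono (by omega) hc) ?_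
      exact (Asub_comm (fun i hi => (h.comm i (l+1) (by omega) (by omega)).symm) hc).symm
    · have e1 : T (l+1) * c = c * T (l+1) :=
        Asub_comm (fun i hi => (h.comm i (l+1) (by omega) (by omega)).symm) hc
      have e2 : T (l+1) * d = d * T (l+1) :=
        Asub_comm (fun i hi => (h.comm i (l+1) (by omega) (by omega)).symm) hd
      have : T (l+1) * (c * T l * d) * T (l+1) = (c * T l) * T (l+1) * (T l * d) := by
        calc _ = (T (l+1) * c) * T l * (d * T (l+1)) := by noncomm_ring
          _ = c * (T (l+1) * T l * T (l+1)) * d := by rw [e1, ← e2]; noncomm_ring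
          _ = _ := by rw [← h.braid l (by omega)]; noncomm_ring
      rw [this]
      exact Dl_mid (mul_mem (Asub_mono (by omega) hc) (T_mem_Asub (by omega)))
        (mul_mem (T_mem_Asub (by omega)) (Asub_mono (by omega) hd))

end
end HeckeP

namespace HeckeP
open Finset Matrix

section
variable {K A B : Type*} [Field K] [Ring A] [Algebra K A] [Ring B] [Algebra K B]

lemma Asub_map {T : ℕ → A} {n : ℕ} (f : A →ₐ[K] B) {a : A} (ha : a ∈ Asub K T n) :
    f a ∈ Asub K (fun i => f (T i)) n := by
  induction ha using Algebra.adjoin_induction with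
  | mem a ha => obtain ⟨i, hi, rfl⟩ := ha; exact T_mem_Asub (T := fun i => f (T i)) hi
  | algebraMap r => rw [AlgHom.commutes]; exact Subalgebra.algebraMap_mem _ _
  | add x y _ _ hx hy => rw [map_add]; exact add_mem hx hy
  | mul x y _ _ hx hy => rw [map_mul]; exact mul_mem hx hy

lemma Asub_lift {T : ℕ → A} {T' : ℕ → B} {n : ℕ} (f : A →ₐ[K] B)
    (h : ∀ i, i + 1 < n → T' i = f (T i)) {b : B} (hb : b ∈ Asub K T' n) :
    ∃ a ∈ Asub K T n, f a = b := by
  induction hb using Algebra.adjoin_induction with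
  | mem a ha => obtain ⟨i, hi, rfl⟩ := ha; exact ⟨T i, T_mem_Asub hi, (h i hi).symm⟩
  | algebraMap r => exact ⟨algebraMap K A r, Subalgebra.algebraMap_mem _ _, AlgHom.commutes _ _⟩
  | add x y _ _ hx hy =>
    obtain ⟨a, ha, rfl⟩ := hx
    obtain ⟨b, hb, rfl⟩ := hy
    exact ⟨a + b, add_mem ha hb, map_add _ _ _⟩
  | mul x y _ _ hx hy =>
    obtain ⟨a, ha, rfl⟩ := hx
    obtain ⟨b, hb, rfl⟩ := hy
    exact ⟨a * b, mul_mem ha hb, map_mul _ _ _⟩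

lemma Asub_fst {T : ℕ → A} {T' : ℕ → B} {n : ℕ} {a : A × B}
    (ha : a ∈ Asub K (fun i => (T i, T' i)) n) : a.1 ∈ Asub K T n :=
  by
  induction ha using Algebra.adjoin_induction with
  | mem a ha => obtain ⟨i, hi, rfl⟩ := ha; exact T_mem_Asub hi
  | algebraMap r => exact Subalgebra.algebraMap_mem _ _
  | add x y _ _ hx hy => exact add_mem hx hy
  | mul x y _ _ hx hy => exact mul_mem hx hy

lemma Asub_snd {T : ℕ → A} {T' : ℕ → B} {n : ℕ} {a : A × B}
    (ha : a ∈ Asub K (fun i => (T i, T' i)) n) : a.2 ∈ Asub K T' n :=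
  by
  induction ha using Algebra.adjoin_induction with
  | mem a ha => obtain ⟨i, hi, rfl⟩ := ha; exact T_mem_Asub hi
  | algebraMap r => exact Subalgebra.algebraMap_mem _ _
  | add x y _ _ hx hy => exact add_mem hx hy
  | mul x y _ _ hx hy => exact mul_mem hx hy

lemma chain_prod (T : ℕ → A) (T' : ℕ → B) (l : ℕ) : ∀ a,
    chain (fun i => (T i, T' i)) a l = (chain T a l, chain T' a l) := by
  induction l with
  | zero => intro a; rfl
  | succ l ih => intro a; rw [chain, ih]; rfl
end

section
variable {K : Type*} [Field K] {ι ι' : Type*} [Fintype ι] [DecidableEq ι] [Fintype ι'] [DecidableEq ι']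

/-- paired generators -/
def TT (R : Matrix (ι × ι) (ι × ι) K) (R' : Matrix (ι' × ι') (ι' × ι') K) (n i : ℕ) :
    Matrix (Wd ι n) (Wd ι n) K × Matrix (Wd ι' n) (Wd ι' n) K := (Tm R n i, Tm R' n i)

lemma chi_chain_ten (R : Matrix (ι × ι) (ι × ι) K) (x : ι → K) {m k : ℕ} (hk : 1 ≤ k)
    (b : Matrix (Wd ι m) (Wd ι m) K) :
    chi x (m + k) (embL K ι m k b * chain (Tm R (m + k)) m (k - 1)) =
      chi x m b * chi x k (chain (Tm R k) 0 (k - 1)) := by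
  have : chain (Tm R (m + k)) m (k - 1) = embR K ι m k (chain (Tm R k) 0 (k - 1)) := by
    rw [chain_map]
    refine chain_congr _ _ _ (fun i hi => ?_)
    rw [Tm_embR R (by omega), zero_add]
  rw [this, embL_mul_embR, chi_ten]

theorem chi_agree {q : K} {R : Matrix (ι × ι) (ι × ι) K} {R' : Matrix (ι' × ι') (ι' × ι') K}
    {x : ι → K} {x' : ι' → K} (hD : HD q R x) (hD' : HD q R' x') (n : ℕ)
    (ht : ∀ k, 1 ≤ k → k ≤ n → chi x k (chain (Tm R k) 0 (k - 1)) =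
      chi x' k (chain (Tm R' k) 0 (k - 1))) :
    ∀ a ∈ Asub K (TT R R' n) n, chi x n a.1 = chi x' n a.2 := by
  induction n using Nat.strong_induction_on with
  | _ n ih =>
  have hT : HRel q (TT R R' n) n := HRel.prod (hD.hrel n) (hD'.hrel n)
  have fstm : ∀ a ∈ Asub K (TT R R' n) n, a.1 ∈ Asub K (Tm R n) n :=
    fun a ha => Asub_fst ha
  have sndm : ∀ a ∈ Asub K (TT R R' n) n, a.2 ∈ Asub K (Tm R' n) n :=
    fun a ha => Asub_snd ha
  have c1 : ∀ a l, (chain (TT R R' n) a l).1 = chain (Tm R n) a l :=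
    fun a l => congrArg Prod.fst (chain_prod (Tm R n) (Tm R' n) l a)
  have c2 : ∀ a l, (chain (TT R R' n) a l).2 = chain (Tm R' n) a l :=
    fun a l => congrArg Prod.snd (chain_prod (Tm R n) (Tm R' n) l a)
  rcases Nat.eq_zero_or_pos n with rfl | hn
  · intro a ha
    obtain ⟨r, rfl⟩ := Asub_one (Asub_mono (by omega : 0 ≤ 1) ha)
    rw [Prod.algebraMap_apply]
    simp only [Algebra.algebraMap_eq_smul_one, map_smul, chi_zero]
  have Q : ∀ j, j < n → ∀ a ∈ Asub K (TT R R' n) (j + 1),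
      chi x n (a * chain (TT R R' n) j (n - 1 - j)).1 =
      chi x' n (a * chain (TT R R' n) j (n - 1 - j)).2 := by
    intro j
    induction j with
    | zero =>
      intro _ a ha
      obtain ⟨r, rfl⟩ := Asub_one ha
      rw [← Algebra.smul_def, Prod.smul_fst, Prod.smul_snd, c1, c2, map_smul, map_smul]
      congr 1
      exact ht n hn le_rfl
    | succ j ihj =>
      intro hj a ha
      refine Dl_ind (K := K) (T := TT R R' n) (l := j)
        (p := fun a => chi x n (a * chain (TT R R' n) (j+1) (n - 1 - (j+1))).1 =
          chi x' n (a * chain (TT R R' n) (j+1) (n - 1 - (j+1))).2)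
        (by simp) (fun x y hx hy => ?_) (fun r x hx => ?_) (fun b hb => ?_) (fun b hb c hc => ?_)
        a (Asub_le_Dl hT j (by omega) a ha)
      · simp only [add_mul, Prod.fst_add, Prod.snd_add, map_add] at hx hy ⊢
        rw [hx, hy]
      · simp only [smul_mul_assoc, Prod.smul_fst, Prod.smul_snd, map_smul] at hx ⊢
        rw [hx]
      · obtain ⟨k, rfl⟩ : ∃ k, n = (j + 1) + k := ⟨n - (j+1), by omega⟩
        obtain ⟨β, hβ, rfl⟩ := Asub_lift (T := TT R R' (j+1))
          (AlgHom.prodMap (embL K ι (j+1) k) (embL K ι' (j+1) k)) (fun i hi => by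
            apply Prod.ext
            · exact Tm_embL R hi
            · exact Tm_embL R' hi) hb
        have e : j + 1 + k - 1 - (j + 1) = k - 1 := by omega
        have := ih (j+1) (by omega) (fun i h1 h2 => ht i h1 (by omega)) β hβ
        rw [e, Prod.fst_mul, Prod.snd_mul, c1, c2]
        refine (chi_chain_ten R x (by omega) _).trans (Eq.trans ?_ (chi_chain_ten R' x' (by omega) _).symm)
        exact congrArg₂ (· * ·) this (ht k (by omega) (by omega))
      · have hcomm : c * chain (TT R R' n) (j+1) (n - 1 - (j+1)) =
            chain (TT R R' n) (j+1) (n - 1 - (j+1)) * c := by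
          refine chain_comm _ _ _ (fun i h1 h2 => (Asub_comm (fun l hl => ?_) hc).symm)
          exact (hT.comm l i (by omega) (by omega)).symm
        have e : b * TT R R' n j * c * chain (TT R R' n) (j+1) (n - 1 - (j+1)) =
            (b * chain (TT R R' n) j (n - 1 - j)) * c := by
          rw [mul_assoc, hcomm, show n - 1 - j = (n - 1 - (j + 1)) + 1 by omega, chain_succ]
          simp only [mul_assoc]
        have hc' := Asub_mono (by omega : j + 1 ≤ n) hc
        rw [e, Prod.fst_mul, Prod.snd_mul, ← hD.chi_comm (fstm c hc'), ← hD'.chi_comm (sndm c hc'),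
          ← Prod.fst_mul, ← Prod.snd_mul, ← mul_assoc]
        exact ihj (by omega) _ (mul_mem hc hb)
  intro a ha
  have := Q (n-1) (by omega) a (by rwa [show n - 1 + 1 = n by omega])
  rwa [show n - 1 - (n - 1) = 0 by omega, chain, mul_one] at this

/-- recursion relating symmetrizers and chains -/
lemma B_step {q : K} (hqi : ∀ k : ℕ, 1 ≤ k → qi q k ≠ 0) {R : Matrix (ι × ι) (ι × ι) K} {x : ι → K}
    (hD : HD q R x) (m k : ℕ) (hm : 1 ≤ m) (hk : 1 ≤ k) :
    qi q (m + 1) * chi x (m + k) (sym q (Tm R (m+k)) (m+1) * chain (Tm R (m+k)) m (k-1)) =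
      chi x m (sym q (Tm R m) m) * chi x k (chain (Tm R k) 0 (k-1)) +
      qi q m * chi x (m + k) (sym q (Tm R (m+k)) m * chain (Tm R (m+k)) (m-1) k) := by
  set T := Tm R (m + k) with hT
  have hr := hD.hrel (m + k)
  obtain ⟨j, rfl⟩ : ∃ j, m = j + 1 := ⟨m - 1, by omega⟩
  have e1 : qi q (j+1+1) * chi x (j+1+k) (sym q T (j+1+1) * chain T (j+1) (k-1)) =
      chi x (j+1+k) (sym q T (j+1) * chain T (j+1) (k-1)) +
      chi x (j+1+k) (sym q T (j+1) * T j * SS T j * chain T (j+1) (k-1)) := by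
    rw [sym, smul_mul_assoc, map_smul, smul_eq_mul, mul_inv_cancel_left₀ (hqi _ (by omega)), SS,
      ← map_add]
    congr 1
    noncomm_ring
  have e2 : SS T j * chain T (j+1) (k-1) = chain T (j+1) (k-1) * SS T j := by
    refine chain_comm _ _ _ (fun i h1 h2 => (SS_comm _ _ (fun l hl => ?_)).symm)
    exact (hr.comm l i (by omega) (by omega)).symm
  have e3 : SS T j * sym q T (j+1) = qi q (j+1) • sym q T (j+1) := by
    have := SS_aug q (T := T) j (LinearMap.mulRight K (sym q T (j+1))) (fun a i hi => by
      simp only [LinearMap.mulRight_apply]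
      rw [mul_assoc, sym_abs_left hqi hr (j+1) (by omega) i (by omega), mul_smul_comm]) 1
    simpa using this
  have hmem : SS T j ∈ Asub K T (j+1+k) := Asub_mono (by omega) (SS_mem j)
  rw [e1]
  congr 1
  · have : sym q T (j+1) = embL K ι (j+1) k (sym q (Tm R (j+1)) (j+1)) := by
      rw [sym_map]; exact sym_congr _ _ (fun i hi => Tm_embL R hi)
    rw [this]; exact chi_chain_ten R x hk _
  · rw [mul_assoc, e2, ← mul_assoc, ← hD.chi_comm hmem, ← mul_assoc, ← mul_assoc, e3,
      smul_mul_assoc, smul_mul_assoc, map_smul, smul_eq_mul]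
    congr 2
    obtain ⟨l, rfl⟩ : ∃ l, k = l + 1 := ⟨k - 1, by omega⟩
    rw [show j + 1 - 1 = j by omega, show l + 1 - 1 = l by omega, chain_succ, mul_assoc]

theorem chain_agree {q : K} (hqi : ∀ k : ℕ, 1 ≤ k → qi q k ≠ 0)
    {R : Matrix (ι × ι) (ι × ι) K} {R' : Matrix (ι' × ι') (ι' × ι') K}
    {x : ι → K} {x' : ι' → K} (hD : HD q R x) (hD' : HD q R' x') (n : ℕ)
    (hs : ∀ k ≤ n, chi x k (sym q (Tm R k) k) = chi x' k (sym q (Tm R' k) k)) :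
    ∀ k, 1 ≤ k → k ≤ n → chi x k (chain (Tm R k) 0 (k - 1)) =
      chi x' k (chain (Tm R' k) 0 (k - 1)) := by
  intro n0
  induction n0 using Nat.strong_induction_on with
  | _ n0 ih =>
  intro h1 h2
  have down : ∀ m k, m + k = n0 → 1 ≤ m →
      chi x n0 (sym q (Tm R n0) m * chain (Tm R n0) (m-1) k) =
      chi x' n0 (sym q (Tm R' n0) m * chain (Tm R' n0) (m-1) k) := by
    intro m k
    induction k generalizing m with
    | zero =>
      intro hmk hm
      obtain rfl : m = n0 := by omega
      rw [chain, chain, mul_one, mul_one]; exact hs _ h2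
    | succ k ihk =>
      intro hmk hm
      subst hmk
      have a1 := B_step hqi hD m (k+1) hm (by omega)
      have a2 := B_step hqi hD' m (k+1) hm (by omega)
      have := ihk (m+1) (by omega) (by omega)
      simp only [Nat.add_sub_cancel] at this a1 a2
      rw [this, a2, hs m (by omega)] at a1
      have i2 := ih (k+1) (by omega) (by omega) (by omega)
      simp only [Nat.add_sub_cancel] at i2
      rw [i2] at a1
      exact (mul_left_cancel₀ (hqi m hm) (add_left_cancel a1)).symm
  have := down 1 (n0 - 1) (by omega) le_rfl
  simpa [sym, SS, qi] using this

end
end HeckeP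

namespace HeckeP
open Finset Matrix

section
variable {K : Type*} [Field K]

/-- the standard Hecke R-matrix -/
def stdR (q : K) (N : ℕ) : Matrix (Fin N × Fin N) (Fin N × Fin N) K :=
  Matrix.of fun p c => if c.1 = c.2 then (if p = c then q else 0) else
    if c.1 < c.2 then (if p = (c.2, c.1) then 1 else 0) else
      (if p = (c.2, c.1) then q else 0) + (if p = c then q - 1 else 0)

/-- swap letters i, i+1 -/
def sw {ι : Type*} {n i : ℕ} (hi : i + 1 < n) (w : Wd ι n) : Wd ι n :=
  w ∘ Equiv.swap ⟨i, by omega⟩ ⟨i + 1, hi⟩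

lemma sw_left {ι : Type*} {n i : ℕ} (hi : i + 1 < n) (w : Wd ι n) :
    sw hi w ⟨i, by omega⟩ = w ⟨i + 1, hi⟩ := by simp [sw]

lemma sw_right {ι : Type*} {n i : ℕ} (hi : i + 1 < n) (w : Wd ι n) :
    sw hi w ⟨i + 1, hi⟩ = w ⟨i, by omega⟩ := by simp [sw]

lemma sw_sw {ι : Type*} {n i : ℕ} (hi : i + 1 < n) (w : Wd ι n) : sw hi (sw hi w) = w := by
  funext j; simp [sw]

lemma eq_iff_agree {ι : Type*} {n i : ℕ} (hi : i + 1 < n) (v w : Wd ι n) :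
    ((∀ j : Fin n, (j : ℕ) ≠ i → (j : ℕ) ≠ i + 1 → v j = w j) ∧
      (v ⟨i, by omega⟩, v ⟨i + 1, hi⟩) = (w ⟨i, by omega⟩, w ⟨i + 1, hi⟩)) ↔ v = w := by
  constructor
  · rintro ⟨h, h2⟩
    rw [Prod.mk.injEq] at h2
    funext j
    by_cases h1 : (j : ℕ) = i
    · have : j = ⟨i, by omega⟩ := Fin.ext h1
      rw [this, h2.1]
    · by_cases h3 : (j : ℕ) = i + 1
      · have : j = ⟨i + 1, hi⟩ := Fin.ext h3
        rw [this, h2.2]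
      · exact h j h1 h3
  · rintro rfl; simp

lemma eq_sw_iff_agree {ι : Type*} {n i : ℕ} (hi : i + 1 < n) (v w : Wd ι n) :
    ((∀ j : Fin n, (j : ℕ) ≠ i → (j : ℕ) ≠ i + 1 → v j = w j) ∧
      (v ⟨i, by omega⟩, v ⟨i + 1, hi⟩) = (w ⟨i + 1, hi⟩, w ⟨i, by omega⟩)) ↔ v = sw hi w := by
  rw [← eq_iff_agree hi v (sw hi w), sw_left, sw_right]
  refine and_congr (forall_congr' fun j => ?_) Iff.rfl
  refine imp_congr_right fun h1 => imp_congr_right fun h2 => ?_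
  rw [sw, Function.comp, Equiv.swap_apply_of_ne_of_ne]
  · intro h; exact h1 (by rw [h])
  · intro h; exact h2 (by rw [h])

lemma Tm_std (q : K) {N n i : ℕ} (hi : i + 1 < n) (v w : Wd (Fin N) n) :
    Tm (stdR q N) n i v w = if w ⟨i, by omega⟩ = w ⟨i + 1, hi⟩ then (if v = w then q else 0) else
      if w ⟨i, by omega⟩ < w ⟨i + 1, hi⟩ then (if v = sw hi w then 1 else 0) else
        (if v = sw hi w then q else 0) + (if v = w then q - 1 else 0) := by
  rw [Tm_apply _ hi]
  have e1 := eq_iff_agree hi v w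
  have e2 := eq_sw_iff_agree hi v w
  by_cases h : ∀ j : Fin n, (j : ℕ) ≠ i → (j : ℕ) ≠ i + 1 → v j = w j
  · rw [if_pos h]
    have e1' : ((v ⟨i, by omega⟩, v ⟨i + 1, hi⟩) = (w ⟨i, by omega⟩, w ⟨i + 1, hi⟩)) ↔ v = w :=
      ⟨fun h2 => e1.mp ⟨h, h2⟩, fun h2 => (e1.mpr h2).2⟩
    have e2' : ((v ⟨i, by omega⟩, v ⟨i + 1, hi⟩) = (w ⟨i + 1, hi⟩, w ⟨i, by omega⟩)) ↔ v = sw hi w :=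
      ⟨fun h2 => e2.mp ⟨h, h2⟩, fun h2 => (e2.mpr h2).2⟩
    simp only [stdR, Matrix.of_apply, e1', e2']
  · have n1 : v ≠ w := fun h2 => h (e1.mpr h2).1
    have n2 : v ≠ sw hi w := fun h2 => h (e2.mpr h2).1
    simp [h, n1, n2]

lemma mul_std {Y : Type*} (q : K) {N n i : ℕ} (hi : i + 1 < n) (F : Matrix Y (Wd (Fin N) n) K)
    (y : Y) (w : Wd (Fin N) n) :
    (F * Tm (stdR q N) n i) y w = if w ⟨i, by omega⟩ = w ⟨i + 1, hi⟩ then q * F y w else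
      if w ⟨i, by omega⟩ < w ⟨i + 1, hi⟩ then F y (sw hi w) else
        q * F y (sw hi w) + (q - 1) * F y w := by
  rw [Matrix.mul_apply]
  simp only [Tm_std q hi]
  split_ifs with h1 h2
  · simp [mul_comm]
  · simp
  · simp [mul_add, sum_add_distrib, mul_comm]

lemma sw0 {ι : Type*} (a b c : ι) (h : 0 + 1 < 3) : sw h ![a, b, c] = ![b, a, c] := by
  funext j; fin_cases j <;> simp [sw, Equiv.swap_apply_def]

lemma sw1 {ι : Type*} (a b c : ι) (h : 1 + 1 < 3) : sw h ![a, b, c] = ![a, c, b] := by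
  funext j; fin_cases j <;> simp [sw, Equiv.swap_apply_def]

lemma std_HD (q : K) {N : ℕ} (x : Fin N → K) : HD q (stdR q N) x := by
  refine ⟨?_, ?_, ?_⟩
  · ext p ⟨c, d⟩
    rw [Matrix.mul_apply]
    rcases lt_trichotomy c d with h | h | h
    · have h1 := h.ne
      have h2 := h.ne'
      have h3 := h.not_gt
      simp [stdR, h, h1, h2, h3, Matrix.one_apply]
      split_ifs <;> ring
    · subst h
      simp [stdR, Matrix.one_apply]
      split_ifs <;> ring
    · have h1 := h.ne
      have h2 := h.ne'
      have h3 := h.not_gt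
      simp [stdR, h, h1, h2, h3, Matrix.one_apply, mul_add, sum_add_distrib]
      split_ifs <;> ring
  · have key : ∀ F : Matrix (Wd (Fin N) 3) (Wd (Fin N) 3) K,
        F * Tm (stdR q N) 3 0 * Tm (stdR q N) 3 1 * Tm (stdR q N) 3 0 =
        F * Tm (stdR q N) 3 1 * Tm (stdR q N) 3 0 * Tm (stdR q N) 3 1 := by
      intro F
      ext y w
      obtain ⟨a, b, c, rfl⟩ : ∃ a b c, w = ![a, b, c] := ⟨w 0, w 1, w 2, by
        funext j; fin_cases j <;> rfl⟩
      have T0 : ∀ (F : Matrix (Wd (Fin N) 3) (Wd (Fin N) 3) K) a b c,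
          (F * Tm (stdR q N) 3 0) y ![a, b, c] = if a = b then q * F y ![a,b,c] else
            if a < b then F y ![b, a, c] else q * F y ![b, a, c] + (q - 1) * F y ![a, b, c] := by
        intro F a b c
        rw [mul_std q (by omega), sw0]
        rfl
      have T1 : ∀ (F : Matrix (Wd (Fin N) 3) (Wd (Fin N) 3) K) a b c,
          (F * Tm (stdR q N) 3 1) y ![a, b, c] = if b = c then q * F y ![a,b,c] else
            if b < c then F y ![a, c, b] else q * F y ![a, c, b] + (q - 1) * F y ![a, b, c] := by
        intro F a b c
        rw [mul_std q (by omega), sw1]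
        rfl
      simp only [T0, T1]
      rcases lt_trichotomy a b with h | h | h <;> rcases lt_trichotomy b c with h' | h' | h' <;>
        rcases lt_trichotomy a c with h_tri | h_tri | h_tri <;>
        first
        | (exfalso; omega)
        | (first | subst h | skip
           first | subst h' | skip
           first | subst h_tri | skip
           simp [*, ne_of_gt, ne_of_lt, not_lt_of_gt] <;> ring)
    simpa using key 1
  · intro a b c d
    simp only [stdR, Matrix.of_apply, Prod.mk.injEq]
    split_ifs <;> simp_all <;> ring

end
end HeckeP

namespace HeckeP
open Finset Matrix

section
variable {K A : Type*} [Field K] [Ring A] [Algebra K A]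

/-- swap on infinite words -/
def swn (i : ℕ) (w : ℕ → ℕ) : ℕ → ℕ := w ∘ Equiv.swap i (i + 1)

lemma swn_left (i : ℕ) (w : ℕ → ℕ) : swn i w i = w (i + 1) := by simp [swn]
lemma swn_right (i : ℕ) (w : ℕ → ℕ) : swn i w (i + 1) = w i := by simp [swn]
lemma swn_of_ne {i j : ℕ} (w : ℕ → ℕ) (h1 : j ≠ i) (h2 : j ≠ i + 1) : swn i w j = w j := by
  rw [swn, Function.comp, Equiv.swap_apply_of_ne_of_ne h1 h2]

/-- termination measure -/
def mu (n : ℕ) (w : ℕ → ℕ) : ℕ := ∑ j ∈ range n, (n - j) * w j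

lemma mu_lt {n i : ℕ} {w : ℕ → ℕ} (hi : i + 1 < n) (hw : w (i + 1) < w i) :
    mu n (swn i w) < mu n w := by
  obtain ⟨k, rfl⟩ : ∃ k, n = i + 1 + 1 + k := ⟨n - (i+2), by omega⟩
  have split : ∀ g : ℕ → ℕ, ∑ j ∈ range (i + 1 + 1 + k), g j =
      (∑ j ∈ range i, g j) + g i + g (i+1) + ∑ j ∈ range k, g (i + 1 + 1 + j) := by
    intro g
    rw [Finset.sum_range_add, sum_range_succ, sum_range_succ]
  rw [mu, mu, split, split]
  have e1 : ∑ j ∈ range i, (i + 1 + 1 + k - j) * swn i w j =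
      ∑ j ∈ range i, (i + 1 + 1 + k - j) * w j := by
    refine sum_congr rfl (fun j hj => ?_)
    rw [mem_range] at hj
    rw [swn_of_ne w (by omega) (by omega)]
  have e2 : ∑ j ∈ range k, (i + 1 + 1 + k - (i + 1 + 1 + j)) * swn i w (i + 1 + 1 + j) =
      ∑ j ∈ range k, (i + 1 + 1 + k - (i + 1 + 1 + j)) * w (i + 1 + 1 + j) := by
    refine sum_congr rfl (fun j hj => ?_)
    rw [swn_of_ne w (by omega) (by omega)]
  rw [e1, e2, swn_left, swn_right, show i + 1 + 1 + k - i = k + 2 by omega,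
    show i + 1 + 1 + k - (i + 1) = k + 1 by omega]
  nlinarith

open Classical in
/-- intertwiner extension of values on sorted words -/
noncomputable def Gx (T : ℕ → A) (n : ℕ) (ε : (ℕ → ℕ) → A) (w : ℕ → ℕ) : A :=
  if h : ∃ i, i + 1 < n ∧ w (i + 1) < w i then
    T h.choose * Gx T n ε (swn h.choose w) else ε w
termination_by mu n w
decreasing_by exact mu_lt h.choose_spec.1 h.choose_spec.2

lemma Gx_sorted (T : ℕ → A) (n : ℕ) (ε : (ℕ → ℕ) → A) (w : ℕ → ℕ)
    (h : ¬ ∃ i, i + 1 < n ∧ w (i + 1) < w i) : Gx T n ε w = ε w := by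
  rw [Gx, dif_neg h]

lemma Gx_exists (T : ℕ → A) (n : ℕ) (ε : (ℕ → ℕ) → A) (w : ℕ → ℕ)
    (h : ∃ i, i + 1 < n ∧ w (i + 1) < w i) :
    ∃ i, i + 1 < n ∧ w (i + 1) < w i ∧ Gx T n ε w = T i * Gx T n ε (swn i w) := by
  refine ⟨h.choose, h.choose_spec.1, h.choose_spec.2, ?_⟩
  rw [Gx, dif_pos h]

lemma swn_comm {i j : ℕ} (h : i + 1 < j) (w : ℕ → ℕ) : swn i (swn j w) = swn j (swn i w) := by
  funext l
  simp only [swn, Function.comp, Equiv.swap_apply_def]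
  congr 1
  split_ifs <;> omega

lemma swn_braid (i : ℕ) (w : ℕ → ℕ) :
    swn i (swn (i+1) (swn i w)) = swn (i+1) (swn i (swn (i+1) w)) := by
  funext l
  simp only [swn, Function.comp, Equiv.swap_apply_def]
  congr 1
  split_ifs <;> omega

lemma Gx_desc {q : K} {T : ℕ → A} {n : ℕ} (h : HRel q T n) (ε : (ℕ → ℕ) → A) :
    ∀ (m : ℕ) (w : ℕ → ℕ), mu n w = m → ∀ i, i + 1 < n → w (i + 1) < w i →
      Gx T n ε w = T i * Gx T n ε (swn i w) := by
  intro m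
  induction m using Nat.strong_induction_on with
  | _ m ih =>
  intro w hw i hi hd
  subst hw
  have IH : ∀ (v : ℕ → ℕ), mu n v < mu n w → ∀ i, i + 1 < n → v (i + 1) < v i →
      Gx T n ε v = T i * Gx T n ε (swn i v) := fun v hv => ih _ hv v rfl
  -- far case
  have far : ∀ i j, i + 1 < j → j + 1 < n → w (i + 1) < w i → w (j + 1) < w j →
      T i * Gx T n ε (swn i w) = T j * Gx T n ε (swn j w) := by
    intro i j hij hj hdi hdj
    rw [IH (swn i w) (mu_lt (by omega) hdi) j hj
      (by rw [swn_of_ne w (by omega) (by omega), swn_of_ne w (by omega) (by omega)]; exact hdj),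
      IH (swn j w) (mu_lt (by omega) hdj) i (by omega)
      (by rw [swn_of_ne w (by omega) (by omega), swn_of_ne w (by omega) (by omega)]; exact hdi),
      swn_comm hij, ← mul_assoc, ← mul_assoc, h.comm i j hij hj]
  have near : ∀ i, i + 2 < n → w (i + 1) < w i → w (i + 1 + 1) < w (i + 1) →
      T i * Gx T n ε (swn i w) = T (i + 1) * Gx T n ε (swn (i + 1) w) := by
    intro i hi h1 h2
    have m1 := mu_lt (n := n) (w := w) (i := i) (by omega) h1
    have m2 := mu_lt (n := n) (w := w) (i := i + 1) (by omega) h2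
    have a1 : swn i w (i + 1 + 1) < swn i w (i + 1) := by
      rw [swn_of_ne w (by omega) (by omega), swn_right]; omega
    have a2 : swn (i+1) w (i + 1) < swn (i+1) w i := by
      rw [swn_left, swn_of_ne w (by omega) (by omega)]; omega
    have m3 := mu_lt (n := n) (by omega) a1
    have m4 := mu_lt (n := n) (by omega) a2
    have a3 : swn (i+1) (swn i w) (i + 1) < swn (i+1) (swn i w) i := by
      rw [swn_left, swn_of_ne _ (by omega) (by omega), swn_of_ne _ (by omega) (by omega), swn_left]
      exact h2
    have a4 : swn i (swn (i+1) w) (i + 1 + 1) < swn i (swn (i+1) w) (i+1) := by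
      rw [swn_right, swn_of_ne _ (by omega) (by omega), swn_right, swn_of_ne _ (by omega) (by omega)]
      exact h1
    rw [IH _ m1 (i+1) (by omega) a1, IH _ (by omega) i (by omega) a3,
      IH _ m2 i (by omega) a2, IH _ (by omega) (i+1) (by omega) a4, swn_braid]
    simp only [← mul_assoc]
    rw [h.braid i hi]
  obtain ⟨j, hj, hdj, e⟩ := Gx_exists T n ε w ⟨i, hi, hd⟩
  rw [e]
  rcases lt_trichotomy i j with hij | rfl | hij
  · rcases eq_or_lt_of_le (Nat.succ_le_of_lt hij) with hh | hh
    · obtain rfl : j = i + 1 := by omega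
      exact (near i (by omega) hd hdj).symm
    · exact (far i j hh hj hd hdj).symm
  · rfl
  · rcases eq_or_lt_of_le (Nat.succ_le_of_lt hij) with hh | hh
    · obtain rfl : i = j + 1 := by omega
      exact near j (by omega) hdj hd
    · exact far j i hh hi hdj hd

lemma Gx_eq {q : K} {T : ℕ → A} {n : ℕ} (h : HRel q T n) (ε : (ℕ → ℕ) → A)
    (hε : ∀ w, (¬ ∃ i, i + 1 < n ∧ w (i + 1) < w i) → ∀ i, i + 1 < n → w i = w (i + 1) →
      T i * ε w = q • ε w) :
    ∀ (m : ℕ) (w : ℕ → ℕ), mu n w = m → ∀ i, i + 1 < n → w i = w (i + 1) →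
      T i * Gx T n ε w = q • Gx T n ε w := by
  intro m
  induction m using Nat.strong_induction_on with
  | _ m ih =>
  intro w hw i hi hd
  subst hw
  have IH : ∀ (v : ℕ → ℕ), mu n v < mu n w → ∀ i, i + 1 < n → v i = v (i + 1) →
      T i * Gx T n ε v = q • Gx T n ε v := fun v hv => ih _ hv v rfl
  have D : ∀ (v : ℕ → ℕ) i, i + 1 < n → v (i + 1) < v i →
      Gx T n ε v = T i * Gx T n ε (swn i v) := fun v => Gx_desc h ε _ v rfl
  by_cases hex : ∃ j, j + 1 < n ∧ w (j + 1) < w j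
  · obtain ⟨j, hj, hdj⟩ := hex
    have m1 := mu_lt hj hdj
    have hne : i ≠ j := by rintro rfl; omega
    by_cases hf : i + 1 < j ∨ j + 1 < i
    · have ec : T i * T j = T j * T i := by
        rcases hf with hf | hf
        · exact h.comm i j hf hj
        · exact (h.comm j i hf hi).symm
      rw [D w j hj hdj, ← mul_assoc, ec, mul_assoc, IH _ m1 i hi, mul_smul_comm]
      rw [swn_of_ne _ (by omega) (by omega), swn_of_ne _ (by omega) (by omega), hd]
    · by_cases hf2 : j = i + 1
      · subst hf2
        have a1 : swn (i+1) w (i+1) < swn (i+1) w i := by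
          rw [swn_left, swn_of_ne _ (by omega) (by omega)]; omega
        have m2 := mu_lt hi a1
        rw [D w _ hj hdj, D _ i hi a1]
        have := IH (swn i (swn (i+1) w)) (by omega) (i+1) hj (by
          rw [swn_right, swn_of_ne _ (by omega) (by omega), swn_of_ne _ (by omega) (by omega),
            swn_right, hd])
        have e : ∀ z : A, T i * (T (i+1) * (T i * z)) = T (i+1) * (T i * (T (i+1) * z)) := by
          intro z
          simp only [← mul_assoc]; rw [h.braid i hj]
        rw [e, this, mul_smul_comm, mul_smul_comm]
      · obtain rfl : i = j + 1 := by omega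
        have a1 : swn j w (j+1+1) < swn j w (j+1) := by
          rw [swn_right, swn_of_ne _ (by omega) (by omega)]; omega
        have m2 := mu_lt hi a1
        rw [D w _ hj hdj, D _ (j+1) hi a1]
        have := IH (swn (j+1) (swn j w)) (by omega) j hj (by
          rw [swn_left (j+1), swn_of_ne (i := j+1) _ (by omega) (by omega), swn_left j,
            swn_of_ne _ (by omega) (by omega), hd])
        have e : ∀ z : A, T (j+1) * (T j * (T (j+1) * z)) = T j * (T (j+1) * (T j * z)) := by
          intro z
          simp only [← mul_assoc]; rw [h.braid j hi]
        rw [e, this, mul_smul_comm, mul_smul_comm]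
  · rw [Gx_sorted T n ε w hex]; exact hε w hex i hi hd

end
end HeckeP

namespace HeckeP
open Finset Matrix

/-- multiplicity of a letter -/
def cnt {n : ℕ} (w : Fin n → ℕ) (b : ℕ) : ℕ := ∑ j, if w j = b then 1 else 0

section
variable {K : Type*} [Field K] {ι : Type*} [Fintype ι] [DecidableEq ι]

theorem eps_exists {q : K} (hqi : ∀ k : ℕ, 1 ≤ k → qi q k ≠ 0) {R : Matrix (ι × ι) (ι × ι) K}
    (hr : ∀ n, HRel q (Tm R n) n) (N : ℕ) : ∀ (n : ℕ) (w : Fin n → ℕ), Monotone w →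
    (∀ j, w j < N) → ∃ ε : Matrix (Wd ι n) (Wd ι n) K,
      ε.trace = ∏ b ∈ range N, (sym q (Tm R (cnt w b)) (cnt w b)).trace ∧
      (∀ i, ∀ hi : i + 1 < n, w ⟨i, by omega⟩ = w ⟨i + 1, hi⟩ → Tm R n i * ε = q • ε) ∧
      ∀ L : Matrix (Wd ι n) (Wd ι n) K →ₗ[K] K,
        (∀ a i, ∀ hi : i + 1 < n, w ⟨i, by omega⟩ = w ⟨i + 1, hi⟩ → L (a * Tm R n i) = q • L a) →
        ∀ a, L (a * ε) = L a := by
  induction N with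
  | zero =>
    intro n w _ hw
    obtain rfl : n = 0 := by
      by_contra h
      exact absurd (hw ⟨0, by omega⟩) (by omega)
    refine ⟨1, by simp, fun i hi => by omega, fun L _ a => by rw [mul_one]⟩
  | succ N ih =>
    intro n w hm hw
    have hex : ∃ m, m ≤ n ∧ ∀ j : Fin n, m ≤ (j : ℕ) → N ≤ w j := ⟨n, le_rfl, fun j hj => by omega⟩
    classical
    obtain ⟨m, hmn, hge, hlt⟩ : ∃ m, m ≤ n ∧ (∀ j : Fin n, m ≤ (j : ℕ) → w j = N) ∧
        (∀ j : Fin n, (j : ℕ) < m → w j < N) := by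
      refine ⟨Nat.find hex, (Nat.find_spec hex).1, fun j hj => ?_, fun j hj => ?_⟩
      · have := (Nat.find_spec hex).2 j hj
        have := hw j
        omega
      · by_contra hcon
        exact Nat.find_min hex hj ⟨by omega, fun l hl => (not_lt.mp hcon).trans (hm hl)⟩
    obtain ⟨k, rfl⟩ : ∃ k, n = m + k := ⟨n - m, by omega⟩
    obtain ⟨ε, htr, habs, hfix⟩ := ih m (fun j => w (Fin.castAdd k j))
      (fun a b hab => hm (by rw [Fin.le_def] at *; simpa using hab)) (fun j => hlt _ (by simp))
    have c1 : ∀ b ∈ range N, cnt w b = cnt (fun j => w (Fin.castAdd k j)) b := by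
      intro b hb
      rw [mem_range] at hb
      rw [cnt, Fin.sum_univ_add, cnt, Nat.add_eq_left]
      refine sum_eq_zero (fun j _ => ?_)
      rw [if_neg]
      rw [hge _ (by simp)]
      omega
    have c2 : cnt w N = k := by
      rw [cnt, Fin.sum_univ_add]
      rw [sum_eq_zero (fun j _ => ?_), sum_congr rfl (fun j _ => if_pos (hge _ (by simp)))]
      · simp
      · rw [if_neg]
        have := hlt (Fin.castAdd k j) (by simp)
        omega
    refine ⟨ten ε (sym q (Tm R k) k), ?_, ?_, ?_⟩
    · rw [ten_trace, prod_range_succ, htr, c2]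
      congr 1
      exact prod_congr rfl (fun b hb => by rw [c1 b hb])
    · intro i hi he
      rcases lt_trichotomy (i + 1) m with h | h | h
      · rw [← embL_mul_embR, Tm_embL R h, ← mul_assoc, ← map_mul, habs i h he, map_smul, smul_mul_assoc]
      · have h1 := hlt ⟨i, by omega⟩ (by simp; omega)
        have h2 := hge ⟨i+1, by omega⟩ (by simp; omega)
        omega
      · obtain ⟨l, rfl⟩ : ∃ l, i = m + l := ⟨i - m, by omega⟩
        rw [← embR_mul_embL, Tm_embR R (by omega), ← mul_assoc, ← map_mul,
          sym_abs_left hqi (hr k) k le_rfl l (by omega), map_smul, smul_mul_assoc]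
    · intro L hL a
      have s1 := sym_aug hqi (T := Tm R k) k
        (L ∘ₗ LinearMap.mulLeft K (a * embL K ι m k ε) ∘ₗ (embR K ι m k).toLinearMap)
        (fun b i hi => by
          simp only [LinearMap.comp_apply, LinearMap.mulLeft_apply, AlgHom.toLinearMap_apply, map_mul]
          rw [← mul_assoc, ← Tm_embR R hi]
          refine hL _ _ (by omega) ?_
          rw [hge _ (by simp), hge _ (by simp; omega)]) 1
      have s2 := hfix (L ∘ₗ LinearMap.mulLeft K a ∘ₗ (embL K ι m k).toLinearMap)
        (fun b i hi he => by
          simp only [LinearMap.comp_apply, LinearMap.mulLeft_apply, AlgHom.toLinearMap_apply, map_mul]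
          rw [← mul_assoc, ← Tm_embL R hi]
          exact hL _ _ (by omega) he) 1
      simp only [LinearMap.comp_apply, LinearMap.mulLeft_apply, AlgHom.toLinearMap_apply, map_one,
        mul_one, one_mul] at s1 s2
      rw [← embL_mul_embR, ← mul_assoc, s1, s2]

end
end HeckeP

namespace HeckeP
open Finset Matrix

lemma count_ofFn_card {N n : ℕ} (w : Fin n → Fin N) (b : Fin N) :
    (List.ofFn w : Multiset (Fin N)).count b = #{j | w j = b} := by
  rw [← Fin.univ_val_map, Multiset.count_map, Finset.card_def, Finset.filter_val]
  simp only [eq_comm]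

lemma sum_mono {K : Type*} [CommRing K] (N n : ℕ) (g : Fin N → ℕ → K) :
    ∑ w : Fin n → Fin N with Monotone w, ∏ b, g b (#{j | w j = b}) =
      PowerSeries.coeff n (∏ b, PowerSeries.mk (g b)) := by
  classical
  rw [PowerSeries.coeff_prod]
  simp only [PowerSeries.coeff_mk]
  refine sum_bij (fun w _ => Finsupp.equivFunOnFinite.symm fun b => #{j | w j = b}) ?_ ?_ ?_ ?_
  · intro w _
    rw [mem_finsuppAntidiag]
    refine ⟨?_, fun _ _ => mem_univ _⟩
    simp only [Finsupp.equivFunOnFinite_symm_apply_apply]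
    have := card_eq_sum_card_fiberwise (s := (univ : Finset (Fin n))) (t := (univ : Finset (Fin N)))
      (f := w) (fun _ _ => mem_coe.mpr (mem_univ _))
    simpa using this.symm
  · intro w hw v hv h
    have h := Finsupp.equivFunOnFinite.symm.injective h
    have hp : (List.ofFn w).Perm (List.ofFn v) := by
      rw [← Multiset.coe_eq_coe]
      ext b
      rw [count_ofFn_card, count_ofFn_card]
      exact congrFun h b
    exact List.ofFn_injective (hp.eq_of_sortedLE (List.sortedLE_ofFn_iff.mpr (mem_filter.mp hw).2)
      (List.sortedLE_ofFn_iff.mpr (mem_filter.mp hv).2))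
  · intro l hl
    rw [mem_finsuppAntidiag] at hl
    set s := Finsupp.toMultiset l with hs
    have hlen : (s.sort (· ≤ ·)).length = n := by
      rw [Multiset.length_sort, hs, Finsupp.card_toMultiset, ← hl.1, Finsupp.sum_fintype]
      · simp
      · simp
    have hof : List.ofFn (fun j : Fin n => (s.sort (· ≤ ·)).get (Fin.cast hlen.symm j)) =
        s.sort (· ≤ ·) := by
      apply List.ext_get
      · simp [hlen]
      · intro i h1 h2
        simp
    refine ⟨fun j => (s.sort (· ≤ ·)).get (Fin.cast hlen.symm j), ?_, ?_⟩
    · rw [mem_filter]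
      refine ⟨mem_univ _, ?_⟩
      rw [← List.sortedLE_ofFn_iff, hof]
      exact (Multiset.pairwise_sort s (· ≤ ·)).sortedLE
    · ext b
      rw [Finsupp.equivFunOnFinite_symm_apply_apply, ← count_ofFn_card, hof, Multiset.sort_eq, hs,
        Finsupp.count_toMultiset]
  · intro w _
    rfl

end HeckeP

namespace HeckeP
open Finset Matrix

/-- extension of a word to an infinite word -/
def xt {N n : ℕ} (w : Wd (Fin N) n) : ℕ → ℕ := fun j => if h : j < n then (w ⟨j, h⟩ : ℕ) else 0

lemma xt_apply {N n : ℕ} (w : Wd (Fin N) n) {j : ℕ} (h : j < n) : xt w j = w ⟨j, h⟩ := by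
  simp [xt, h]

lemma xt_sw {N n i : ℕ} (hi : i + 1 < n) (w : Wd (Fin N) n) : xt (sw hi w) = swn i (xt w) := by
  funext j
  by_cases h1 : j = i
  · subst h1
    rw [swn_left, xt_apply _ (by omega), xt_apply _ hi, sw_left]
  · by_cases h2 : j = i + 1
    · subst h2
      rw [swn_right, xt_apply _ (by omega), xt_apply _ (by omega), sw_right]
    · rw [swn_of_ne _ h1 h2]
      by_cases h : j < n
      · rw [xt_apply _ h, xt_apply _ h, sw, Function.comp, Equiv.swap_apply_of_ne_of_ne]
        · intro h; exact h1 (by simpa using h)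
        · intro h; exact h2 (by simpa using h)
      · simp [xt, h]

lemma mono_of_no_desc {n : ℕ} (w : ℕ → ℕ) (h : ¬ ∃ i, i + 1 < n ∧ w (i + 1) < w i) :
    Monotone (fun j : Fin n => w j) := by
  push Not at h
  have : ∀ k i, i + k < n → w i ≤ w (i + k) := by
    intro k
    induction k with
    | zero => intro i _; exact le_rfl
    | succ k ih => intro i hk; exact (ih i (by omega)).trans (h (i + k) (by omega))
  intro a b hab
  have h1 : (a : ℕ) ≤ b := hab
  have := this (b - a) a (by omega)
  rwa [show (a : ℕ) + (b - a) = b by omega] at this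

section
variable {K : Type*} [Field K] {ι : Type*} [Fintype ι] [DecidableEq ι]

/-- sorted word -/
def srt {N n : ℕ} (w : Wd (Fin N) n) : Wd (Fin N) n := w ∘ Tuple.sort w

lemma srt_sw {N n i : ℕ} (hi : i + 1 < n) (w : Wd (Fin N) n) : srt (sw hi w) = srt w :=
  Tuple.comp_perm_comp_sort_eq_comp_sort

lemma srt_mono {N n : ℕ} (w : Wd (Fin N) n) : Monotone (srt w) := Tuple.monotone_sort w

lemma srt_eq {N n : ℕ} {w : Wd (Fin N) n} (h : Monotone w) : srt w = w := by
  rw [srt, Tuple.sort_eq_refl_iff_monotone.mpr h]; rfl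

theorem trace_std {q : K} (hqi : ∀ k : ℕ, 1 ≤ k → qi q k ≠ 0) {R : Matrix (ι × ι) (ι × ι) K}
    (hr : ∀ n, HRel q (Tm R n) n) {N : ℕ} (x : Fin N → K) (n : ℕ)
    (P : Matrix (Wd ι n) (Wd (Fin N) n) K →ₗ[K] Matrix (Wd ι n) (Wd (Fin N) n) K)
    (h1 : ∀ F i, i + 1 < n → P F * Tm (stdR q N) n i = Tm R n i * P F)
    (h2 : ∀ F, (∀ i, i + 1 < n → F * Tm (stdR q N) n i = Tm R n i * F) → P F = F)
    (h3 : ∀ F, P (F * Xi x n) = P F * Xi x n) :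
    LinearMap.trace K _ (mulR (Xi x n) ∘ₗ P) =
      PowerSeries.coeff n (∏ b, PowerSeries.mk fun k => x b ^ k * (sym q (Tm R k) k).trace) := by
  classical
  have hE := eps_exists hqi hr N n
  choose! ε hε1 hε2 hε3 using hE
  set T := Tm R n with hT
  have hn := hr n
  let eN : (ℕ → ℕ) → Matrix (Wd ι n) (Wd ι n) K := fun w =>
    if ∀ j : Fin n, w j < N then ε (fun j : Fin n => w j) else 0
  have heN : ∀ w, (¬ ∃ i, i + 1 < n ∧ w (i + 1) < w i) → ∀ i, i + 1 < n → w i = w (i + 1) →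
      T i * eN w = q • eN w := by
    intro w hw i hi he
    by_cases hb : ∀ j : Fin n, w j < N
    · simp only [eN, if_pos hb]
      exact hε2 _ (mono_of_no_desc w hw) hb i hi he
    · simp [eN, if_neg hb]
  let G : Wd (Fin N) n → Matrix (Wd ι n) (Wd ι n) K := fun w => Gx T n eN (xt w)
  have Ga : ∀ w i, ∀ hi : i + 1 < n, w ⟨i + 1, hi⟩ < w ⟨i, by omega⟩ →
      G w = T i * G (sw hi w) := by
    intro w i hi hd
    simp only [G]
    rw [xt_sw]
    refine Gx_desc hn eN _ _ rfl i hi ?_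
    rw [xt_apply _ hi, xt_apply _ (by omega)]; exact hd
  have Gb : ∀ w i, ∀ hi : i + 1 < n, w ⟨i, by omega⟩ = w ⟨i + 1, hi⟩ → T i * G w = q • G w := by
    intro w i hi hd
    refine Gx_eq hn eN heN _ _ rfl i hi ?_
    rw [xt_apply _ hi, xt_apply _ (by omega), hd]
  have Gc : ∀ w, Monotone w → G w = ε (fun j => (w j : ℕ)) := by
    intro w hw
    have e1 : ∀ j : Fin n, xt w j = w j := fun j => xt_apply w j.2
    simp only [G]
    rw [Gx_sorted]
    · simp only [eN, e1]
      rw [if_pos (fun j => (w j).2)]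
    · rintro ⟨i, hi, hd⟩
      rw [xt_apply _ hi, xt_apply _ (by omega)] at hd
      exact absurd (hw (show (⟨i, by omega⟩ : Fin n) ≤ ⟨i+1, hi⟩ by simp [Fin.le_def])) (not_le.mpr hd)
  let Q : Matrix (Wd ι n) (Wd (Fin N) n) K →ₗ[K] Matrix (Wd ι n) (Wd (Fin N) n) K :=
    { toFun := fun F => Matrix.of fun y w => (G w *ᵥ (fun u => F u (srt w))) y
      map_add' := fun A B => by
        ext y w
        exact congrFun (mulVec_add (G w) (fun u => A u (srt w)) (fun u => B u (srt w))) y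
      map_smul' := fun r A => by
        ext y w
        exact congrFun (mulVec_smul (G w) r (fun u => A u (srt w))) y }
  have Qap : ∀ F y w, Q F y w = (G w *ᵥ (fun u => F u (srt w))) y := fun F y w => rfl
  have TQ : ∀ F i y w, (T i * Q F) y w = ((T i * G w) *ᵥ (fun u => F u (srt w))) y := by
    intro F i y w
    rw [← mulVec_mulVec]; rfl
  have Q1 : ∀ F i, i + 1 < n → Q F * Tm (stdR q N) n i = T i * Q F := by
    intro F i hi
    ext y w
    rw [mul_std q hi, TQ, Qap, Qap, srt_sw]
    split_ifs with he hl
    · rw [Gb w i hi he, smul_mulVec, Pi.smul_apply, smul_eq_mul]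
    · have := Ga (sw hi w) i hi (by rw [sw_left, sw_right]; exact hl)
      rw [sw_sw] at this
      rw [this]
    · have hg : w ⟨i + 1, hi⟩ < w ⟨i, by omega⟩ := lt_of_le_of_ne (not_lt.mp hl) (Ne.symm he)
      have := Ga w i hi hg
      have e : T i * G w = (q - 1) • G w + q • G (sw hi w) := by
        conv_lhs => rw [this, ← mul_assoc, hn.quad i hi, add_mul, smul_mul_assoc, ← this]
        simp
      rw [e, add_mulVec, smul_mulVec, smul_mulVec, Pi.add_apply, Pi.smul_apply, Pi.smul_apply,
        smul_eq_mul, smul_eq_mul, add_comm]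
  have Q2 : ∀ F, (∀ i, i + 1 < n → F * Tm (stdR q N) n i = T i * F) → Q F = F := by
    intro F hF
    have : ∀ m w, mu n (xt w) = m → ∀ y, Q F y w = F y w := by
      intro m
      induction m using Nat.strong_induction_on with
      | _ m ih =>
      rintro w rfl y
      by_cases hex : ∃ i, i + 1 < n ∧ xt w (i + 1) < xt w i
      · obtain ⟨i, hi, hd⟩ := hex
        have hlt := mu_lt hi hd
        rw [← xt_sw hi] at hlt
        have IH := ih _ hlt (sw hi w) rfl
        rw [xt_apply _ hi, xt_apply _ (by omega)] at hd
        have hd' : w ⟨i + 1, hi⟩ < w ⟨i, by omega⟩ := hd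
        have e1 := congrFun (congrFun (hF i hi) y) (sw hi w)
        rw [mul_std q hi, sw_left, sw_right, if_neg hd'.ne, if_pos hd', sw_sw] at e1
        rw [Qap, Ga w i hi hd', ← mulVec_mulVec, e1, Matrix.mul_apply]
        refine sum_congr rfl (fun u _ => ?_)
        rw [← IH u, Qap, srt_sw]
      · have hmono := mono_of_no_desc _ hex
        have hmono : Monotone w := by
          intro a b hab
          have := hmono hab
          simp only [xt_apply _ a.2, xt_apply _ b.2] at this
          exact this
        rw [Qap, Gc w hmono, srt_eq hmono]
        have := hε3 (fun j => (w j : ℕ)) (fun a b hab => hmono hab) (fun j => (w j).2)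
          { toFun := fun a => (a *ᵥ (fun u => F u w)) y
            map_add' := fun a b => by rw [add_mulVec]; rfl
            map_smul' := fun r a => by rw [smul_mulVec]; rfl }
          (fun a i hi he => by
            simp only [LinearMap.coe_mk, AddHom.coe_mk]
            have : T i *ᵥ (fun u => F u w) = q • (fun u => F u w) := by
              funext u
              have e1 := congrFun (congrFun (hF i hi) u) w
              rw [mul_std q hi, if_pos (Fin.ext he)] at e1
              rw [Pi.smul_apply, smul_eq_mul, e1]
              rfl
            rw [← mulVec_mulVec, this, mulVec_smul]; rfl) 1
        simpa using this
    ext y w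
    exact this _ w rfl y
  have QP : Q ∘ₗ P = P := LinearMap.ext fun F => Q2 _ (h1 F)
  have PQ : P ∘ₗ Q = Q := LinearMap.ext fun F => h2 _ (Q1 F)
  have DP : P ∘ₗ mulR (Xi x n) = mulR (Xi x n) ∘ₗ P := LinearMap.ext fun F => h3 F
  have t1 : LinearMap.trace K _ (mulR (Xi x n) ∘ₗ P) = LinearMap.trace K _ (mulR (Xi x n) ∘ₗ Q) := by
    conv_lhs => rw [← QP, ← LinearMap.comp_assoc, LinearMap.trace_comp_comm', ← LinearMap.comp_assoc,
      DP, LinearMap.comp_assoc, PQ]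
  rw [t1, LinearMap.trace_eq_matrix_trace K (Matrix.stdBasis K _ _), Matrix.trace]
  simp only [Matrix.diag, LinearMap.toMatrix_apply]
  rw [Fintype.sum_prod_type]
  have t2 : ∀ y w, (Matrix.stdBasis K (Wd ι n) (Wd (Fin N) n)).repr
      ((mulR (Xi x n) ∘ₗ Q) (Matrix.stdBasis K _ _ (y, w))) (y, w) =
      if Monotone w then (∏ j, x (w j)) * ε (fun j => (w j : ℕ)) y y else 0 := by
    intro y w
    rw [Matrix.stdBasis_eq_single]
    have : (mulR (Xi x n) ∘ₗ Q) (single y w 1) y w = (∏ j, x (w j)) * Q (single y w 1) y w := by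
      rw [LinearMap.comp_apply, mulR_apply, Xi, mul_diagonal, mul_comm]
    have e : (Matrix.stdBasis K (Wd ι n) (Wd (Fin N) n)).repr
      ((mulR (Xi x n) ∘ₗ Q) (single y w 1)) (y, w) = (mulR (Xi x n) ∘ₗ Q) (single y w 1) y w := by
      simp [Matrix.stdBasis, Pi.basis_repr, Pi.basisFun_repr]
    rw [e, this, Qap]
    split_ifs with hm
    · rw [srt_eq hm, Gc w hm]
      simp [mulVec, dotProduct, single_apply]
    · have : w ≠ srt w := fun h => hm (h ▸ srt_mono w)
      simp [mulVec, dotProduct, single_apply, this]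
  simp only [t2]
  rw [sum_comm, ← sum_mono N n (fun b k => x b ^ k * (sym q (Tm R k) k).trace), sum_filter]
  refine sum_congr rfl (fun w _ => ?_)
  split_ifs with hm
  · rw [← mul_sum]
    have e1 : ∑ y, ε (fun j => (w j : ℕ)) y y = (ε (fun j => (w j : ℕ))).trace := rfl
    rw [e1, hε1 _ (fun a b hab => hm hab) (fun j => (w j).2), prod_mul_distrib]
    congr 1
    · rw [Finset.prod_comp]
      symm
      rw [← prod_subset (subset_univ (univ.image w))]
      intro b _ hb
      rw [Finset.filter_eq_empty_iff.mpr]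
      · simp
      · intro j _ h; exact hb (mem_image.mpr ⟨j, mem_univ _, h⟩)
    · rw [Finset.prod_range]
      refine prod_congr rfl (fun b _ => ?_)
      have : cnt (fun j => (w j : ℕ)) b = #{j | w j = b} := by
        rw [cnt, card_filter]
        refine sum_congr rfl (fun j _ => ?_)
        simp [Fin.ext_iff]
      rw [this]
  · simp

end
end HeckeP

namespace HeckeP
open Finset Matrix

section
variable {K : Type*} [Field K]

lemma Tm_triv (q : K) {n i : ℕ} (hi : i + 1 < n) :
    Tm (q • (1 : Matrix (Unit × Unit) (Unit × Unit) K)) n i = q • 1 := by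
  ext w v
  rw [Tm_apply _ hi, if_pos (fun j _ _ => rfl)]
  have : w = v := Subsingleton.elim _ _
  subst this
  simp

lemma HRel_triv (q : K) (n : ℕ) : HRel q (Tm (q • (1 : Matrix (Unit × Unit) (Unit × Unit) K)) n) n := by
  refine ⟨fun i hi => ?_, fun i hi => ?_, fun i j hi hj => ?_⟩
  · rw [Tm_triv q hi]
    simp only [smul_mul_smul_comm, mul_one, smul_smul, ← add_smul]
    congr 1; ring
  · rw [Tm_triv q (by omega), Tm_triv q (by omega)]
  · rw [Tm_triv q (by omega), Tm_triv q (by omega)]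

lemma sym_triv {q : K} (hqi : ∀ k : ℕ, 1 ≤ k → qi q k ≠ 0) (n : ℕ) :
    (sym q (Tm (q • (1 : Matrix (Unit × Unit) (Unit × Unit) K)) n) n).trace = 1 := by
  have := sym_aug hqi (T := Tm (q • (1 : Matrix (Unit × Unit) (Unit × Unit) K)) n) n
    LinearMap.id (fun a i hi => by rw [Tm_triv q hi]; simp) 1
  simp only [LinearMap.id_apply, one_mul] at this
  rw [this, trace_one]
  simp

lemma SS_fix {X Y : Type*} [Fintype X] [DecidableEq X] {q : K} {T : ℕ → Matrix X X K} (m : ℕ)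
    (F : Matrix Y X K) (hF : ∀ i, i < m → F * T i = q • F) : F * SS T m = qi q (m + 1) • F := by
  induction m with
  | zero => simp [SS, qi]
  | succ m ih =>
    rw [SS, Matrix.mul_add, ← Matrix.mul_assoc, hF m (by omega), smul_mul,
      ih (fun i hi => hF i (by omega)), Matrix.mul_one, qi_succ' q (m + 1), add_smul, one_smul, smul_smul]

lemma sym_fix {X Y : Type*} [Fintype X] [DecidableEq X] {q : K} (hqi : ∀ k : ℕ, 1 ≤ k → qi q k ≠ 0)
    {T : ℕ → Matrix X X K} (m : ℕ)
    (F : Matrix Y X K) (hF : ∀ i, i + 1 < m → F * T i = q • F) : F * sym q T m = F := by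
  induction m with
  | zero => simp [sym]
  | succ m ih =>
    rw [sym, Matrix.mul_smul, ← Matrix.mul_assoc, ih (fun i hi => hF i (by omega)),
      SS_fix m F (fun i hi => hF i (by omega)), smul_smul, inv_mul_cancel₀ (hqi _ (by omega)), one_smul]

theorem chi_sym_std {q : K} (hqi : ∀ k : ℕ, 1 ≤ k → qi q k ≠ 0) {N : ℕ} (x : Fin N → K) (n : ℕ) :
    chi x n (sym q (Tm (stdR q N) n) n) =
      PowerSeries.coeff n (∏ b, PowerSeries.mk fun k => x b ^ k) := by
  have hD := std_HD q x
  set s := sym q (Tm (stdR q N) n) n with hs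
  have hc : s * Xi x n = Xi x n * s := hD.comm_Asub (sym_mem q n)
  have := trace_std hqi (fun n => HRel_triv q n) x n (mulR s)
    (fun F i hi => by
      rw [mulR_apply, Tm_triv q hi, Matrix.mul_assoc, sym_abs (hD.hrel n) n le_rfl i hi]
      rw [← hs]; simp)
    (fun F hF => sym_fix hqi n F (fun i hi => by
      rw [hF i hi, Tm_triv q hi, smul_mul, Matrix.one_mul]))
    (fun F => by rw [mulR_apply, mulR_apply, Matrix.mul_assoc, ← hc, Matrix.mul_assoc])
  simp only [sym_triv hqi, mul_one] at this
  rw [← this, trace_lr 1 (s * Xi x n)]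
  · rw [trace_one, chi_apply, hc]; simp
  · intro F; rw [LinearMap.comp_apply, mulR_apply, mulR_apply, Matrix.one_mul, Matrix.mul_assoc]

theorem comm_trace [CharZero K] {ι : Type*} [Fintype ι] [DecidableEq ι] {q : K} (hq : q ≠ 0)
    (hqi : ∀ k : ℕ, 1 ≤ k → qi q k ≠ 0) {R : Matrix (ι × ι) (ι × ι) K}
    (hD : HD q R (fun _ => 1)) {N : ℕ} (x : Fin N → K) (n : ℕ)
    (hs : ∀ k ≤ n, (sym q (Tm R k) k).trace =
      PowerSeries.coeff k (∏ b, PowerSeries.mk fun k => x b ^ k)) :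
    ∃ P : Matrix (Wd ι n) (Wd ι n) K →ₗ[K] Matrix (Wd ι n) (Wd ι n) K,
      (∀ F i, i + 1 < n → P F * Tm R n i = Tm R n i * P F) ∧
      (∀ F, (∀ i, i + 1 < n → F * Tm R n i = Tm R n i * F) → P F = F) ∧
      LinearMap.trace K _ P = PowerSeries.coeff n
        (∏ b, PowerSeries.mk fun k => x b ^ k * (sym q (Tm R k) k).trace) := by
  have hD' := std_HD q x
  have Xi1 : ∀ k, Xi (fun _ : ι => (1 : K)) k = 1 := fun k => by simp [Xi]
  have h1 := chain_agree hqi hD hD' n (fun k hk => by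
    rw [chi_sym_std hqi, chi_apply, Xi1, Matrix.one_mul, hs k hk])
  have h2 := chi_agree hD hD' n h1
  obtain ⟨P₁, P₂, a, b, c, d, e, f⟩ := two_proj hq hqi (hD.hrel n) (hD'.hrel n) (Xi x n)
    (hD'.Xi_comm n) (fun a ha => by
      have := h2 a ha
      rwa [chi_apply, chi_apply, Xi1, Matrix.one_mul] at this)
  refine ⟨P₁, a, b, ?_⟩
  rw [f]
  exact trace_std hqi hD.hrel x n P₂ c d e

end
end HeckeP

namespace HeckeP
open Finset

section
variable {L : Type*} [Field L]

lemma coeff_X_d {A : Type*} [CommRing A] (S : PowerSeries A) (n : ℕ) :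
    PowerSeries.coeff n (PowerSeries.X * PowerSeries.derivative A S) = n * PowerSeries.coeff n S := by
  cases n with
  | zero => simp
  | succ n =>
    rw [PowerSeries.coeff_succ_X_mul, PowerSeries.coeff_derivative]
    push_cast; ring

lemma exists_roots [IsAlgClosed L] (s : ℕ → L) (s0 : s 0 = 1) (n : ℕ) :
    ∃ (N : ℕ) (x : Fin N → L), ∀ k ≤ n, s k =
      PowerSeries.coeff k (∏ b, PowerSeries.mk fun k => x b ^ k) := by
  classical
  set S := PowerSeries.mk s with hS
  have hS0 : PowerSeries.constantCoeff S = 1 := by simp [hS, s0]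
  set g : Polynomial L := PowerSeries.trunc (n + 1) S⁻¹ with hg
  have hg0 : g.coeff 0 = 1 := by
    rw [hg, PowerSeries.coeff_trunc, if_pos (by omega)]
    simp [hS0]
  have hroots : ∀ a ∈ g.roots, a ≠ 0 := by
    rintro a ha rfl
    have := Polynomial.isRoot_of_mem_roots ha
    rw [Polynomial.IsRoot, ← Polynomial.coeff_zero_eq_eval_zero, hg0] at this
    exact one_ne_zero this
  have hsp := IsAlgClosed.splits g
  have e1 : g = Polynomial.C g.leadingCoeff * (g.roots.map (fun a => Polynomial.X - Polynomial.C a)).prod :=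
    hsp.eq_prod_roots
  have e2 : g.roots.map (fun a => Polynomial.X - Polynomial.C a) =
      g.roots.map (fun a => Polynomial.C (-a) * (1 - Polynomial.C a⁻¹ * Polynomial.X)) := by
    refine Multiset.map_congr rfl (fun a ha => ?_)
    have : Polynomial.C a * Polynomial.C a⁻¹ = (1 : Polynomial L) := by
      rw [← Polynomial.C_mul, mul_inv_cancel₀ (hroots a ha), Polynomial.C_1]
    rw [Polynomial.C_neg]
    linear_combination (-Polynomial.X) * this
  rw [e2, Multiset.prod_map_mul] at e1
  have e3 : Polynomial.C g.leadingCoeff * (g.roots.map (fun a => Polynomial.C (-a))).prod = 1 := by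
    have h1 : (g.roots.map (fun a => Polynomial.C (-a))).prod = Polynomial.C (g.roots.map (fun a => -a)).prod := by
      rw [map_multiset_prod, Multiset.map_map]; rfl
    have h2 := congrArg (Polynomial.eval 0) e1
    rw [← Polynomial.coeff_zero_eq_eval_zero, hg0, h1] at h2
    have h3 : Polynomial.eval 0 (g.roots.map (fun a => (1 - Polynomial.C a⁻¹ * Polynomial.X : Polynomial L))).prod = 1 := by
      rw [Polynomial.eval_multiset_prod, Multiset.map_map]
      apply Multiset.prod_eq_one
      intro y hy
      obtain ⟨a, _, rfl⟩ := Multiset.mem_map.mp hy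
      simp
    rw [Polynomial.eval_mul, Polynomial.eval_mul, h3, Polynomial.eval_C, Polynomial.eval_C, mul_one] at h2
    rw [h1, ← Polynomial.C_mul, ← h2, Polynomial.C_1]
  rw [← mul_assoc, e3, one_mul] at e1
  set l := g.roots.toList with hl
  have e4 : g = ∏ b : Fin l.length, (1 - Polynomial.C (l.get b)⁻¹ * Polynomial.X) := by
    rw [e1, ← Multiset.coe_toList g.roots, ← hl, Multiset.map_coe, Multiset.prod_coe,
      ← List.prod_ofFn]
    congr 1
    conv_lhs => rw [← List.ofFn_get l, List.map_ofFn]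
    rfl
  refine ⟨l.length, fun b => (l.get b)⁻¹, fun k hk => ?_⟩
  set H := ∏ b : Fin l.length, PowerSeries.mk fun k => (l.get b)⁻¹ ^ k with hH
  have e5 : (g : PowerSeries L) * H = 1 := by
    have h1 : (g : PowerSeries L) = ∏ b : Fin l.length, (1 - PowerSeries.C (l.get b)⁻¹ * PowerSeries.X) := by
      conv_lhs => rw [e4]
      rw [← Polynomial.coeToPowerSeries.ringHom_apply, map_prod]
      simp
    rw [h1, hH, ← prod_mul_distrib]
    refine prod_eq_one (fun b _ => ?_)
    ext m
    rw [sub_mul, one_mul, mul_assoc, map_sub, PowerSeries.coeff_C_mul]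
    cases m with
    | zero => simp
    | succ m =>
      rw [PowerSeries.coeff_succ_X_mul]
      simp [PowerSeries.coeff_one, pow_succ']
      ring
  have e6 : S * S⁻¹ = 1 := PowerSeries.mul_inv_cancel _ (by rw [hS0]; exact one_ne_zero)
  have e7 : S = H + S * (g - S⁻¹) * H := by
    linear_combination (-S) * e5 + H * e6
  have e8 : (PowerSeries.X : PowerSeries L) ^ (n + 1) ∣ (g - S⁻¹) := by
    rw [PowerSeries.X_pow_dvd_iff]
    intro m hm
    rw [map_sub, Polynomial.coeff_coe, hg, PowerSeries.coeff_trunc, if_pos hm, sub_self]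
  have e9 : (PowerSeries.X : PowerSeries L) ^ (n + 1) ∣ S - H := by
    rw [show S - H = (g - S⁻¹) * (S * H) by linear_combination e7]
    exact e8.mul_right _
  have := PowerSeries.X_pow_dvd_iff.mp e9 k (by omega)
  rw [map_sub, hS, PowerSeries.coeff_mk] at this
  exact sub_eq_zero.mp this

lemma rescale_log {S P : PowerSeries L} (h : PowerSeries.X * PowerSeries.derivative L S = S * P) (a : L) :
    PowerSeries.X * PowerSeries.derivative L (PowerSeries.rescale a S) =
      PowerSeries.rescale a S * PowerSeries.rescale a P := by
  rw [← map_mul, ← h]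
  ext n
  rw [coeff_X_d, PowerSeries.coeff_rescale, PowerSeries.coeff_rescale, coeff_X_d]
  ring

lemma prod_log {N : ℕ} (f g : Fin N → PowerSeries L)
    (h : ∀ b, PowerSeries.X * PowerSeries.derivative L (f b) = f b * g b) :
    PowerSeries.X * PowerSeries.derivative L (∏ b, f b) = (∏ b, f b) * ∑ b, g b := by
  classical
  have : ∀ t : Finset (Fin N), PowerSeries.X * PowerSeries.derivative L (∏ b ∈ t, f b) =
      (∏ b ∈ t, f b) * ∑ b ∈ t, g b := by
    intro t
    induction t using Finset.induction_on with
    | empty => simp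
    | insert b t hb ih =>
      rw [prod_insert hb, sum_insert hb, Derivation.leibniz, smul_eq_mul, smul_eq_mul]
      linear_combination f b * ih + (∏ b ∈ t, f b) * h b
  exact this univ

lemma geom_log : PowerSeries.X * PowerSeries.derivative L (PowerSeries.mk fun _ => (1 : L)) =
    (PowerSeries.mk fun _ => (1 : L)) * PowerSeries.mk (fun n => if n = 0 then 0 else 1) := by
  ext n
  rw [coeff_X_d, PowerSeries.coeff_mul]
  simp only [PowerSeries.coeff_mk, one_mul, mul_one]
  rw [Nat.sum_antidiagonal_eq_sum_range_succ (fun i j => if j = 0 then (0 : L) else 1)]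
  rw [sum_range_succ]
  rw [sum_congr rfl (g := fun _ => (1 : L))]
  · simp
  · intro i hi; rw [if_neg]; have := mem_range.mp hi; omega

theorem final_num [CharZero L] [IsAlgClosed L] (s e p : ℕ → L) (s0 : s 0 = 1)
    (hp : ∀ n : ℕ, n * s n = ∑ ij ∈ antidiagonal n, s ij.1 * (if ij.2 = 0 then 0 else p ij.2))
    (he : ∀ (n N : ℕ) (x : Fin N → L), (∀ k ≤ n, s k =
      PowerSeries.coeff k (∏ b, PowerSeries.mk fun k => x b ^ k)) →
      e n = PowerSeries.coeff n (∏ b, PowerSeries.mk fun k => x b ^ k * s k)) (n : ℕ) :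
    n * e n = ∑ ij ∈ antidiagonal n, e ij.1 * (if ij.2 = 0 then 0 else p ij.2 ^ 2) := by
  obtain ⟨N, x, hx⟩ := exists_roots s s0 n
  set P := PowerSeries.mk (fun n => if n = 0 then 0 else p n) with hP
  have hS : PowerSeries.X * PowerSeries.derivative L (PowerSeries.mk s) = PowerSeries.mk s * P := by
    ext m
    rw [coeff_X_d, PowerSeries.coeff_mul, PowerSeries.coeff_mk, hp]
    simp only [hP, PowerSeries.coeff_mk]
  have hH := prod_log (fun b => PowerSeries.rescale (x b) (PowerSeries.mk fun _ => (1 : L))) _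
    (fun b => rescale_log geom_log (x b))
  have hE := prod_log (fun b => PowerSeries.rescale (x b) (PowerSeries.mk s)) _
    (fun b => rescale_log hS (x b))
  have r1 : ∀ b, PowerSeries.rescale (x b) (PowerSeries.mk fun _ => (1 : L)) =
      PowerSeries.mk fun k => x b ^ k := by intro b; ext k; simp [PowerSeries.coeff_rescale]
  have r2 : ∀ b, PowerSeries.rescale (x b) (PowerSeries.mk s) =
      PowerSeries.mk fun k => x b ^ k * s k := by intro b; ext k; simp [PowerSeries.coeff_rescale]
  simp only [r1] at hH
  simp only [r2] at hE
  have hHc : ∀ m ≤ n, m * s m = ∑ ij ∈ antidiagonal m, s ij.1 * (if ij.2 = 0 then 0 else ∑ b, x b ^ ij.2) := by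
    intro m hm
    have := congrArg (PowerSeries.coeff m) hH
    rw [coeff_X_d, ← hx m hm, PowerSeries.coeff_mul] at this
    rw [this]
    refine sum_congr rfl (fun ij hij => ?_)
    have := mem_antidiagonal.mp hij
    rw [← hx _ (by omega), map_sum]
    congr 1
    split_ifs with h0
    · simp [PowerSeries.coeff_rescale, h0]
    · simp [PowerSeries.coeff_rescale, h0]
  have hpx : ∀ m ≤ n, m ≠ 0 → p m = ∑ b, x b ^ m := by
    intro m
    induction m using Nat.strong_induction_on with
    | _ m ih =>
    intro hm h0
    have := (hp m).symm.trans (hHc m hm)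
    obtain ⟨m, rfl⟩ : ∃ l, m = l + 1 := ⟨m - 1, by omega⟩
    rw [Nat.antidiagonal_succ, sum_cons, sum_cons, s0] at this
    simp only [Nat.add_eq_zero_iff, one_ne_zero, and_false, if_false, one_mul] at this
    have e2 : ∀ ij ∈ map (Function.Embedding.prodMap ⟨Nat.succ, Nat.succ_injective⟩ (Function.Embedding.refl ℕ)) (antidiagonal m),
        s ij.1 * (if ij.2 = 0 then 0 else p ij.2) = s ij.1 * (if ij.2 = 0 then 0 else ∑ b, x b ^ ij.2) := by
      intro ij hij
      obtain ⟨kl, hkl, rfl⟩ := mem_map.mp hij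
      have := mem_antidiagonal.mp hkl
      simp only [Function.Embedding.prodMap, Function.Embedding.coeFn_mk, Prod.map, Function.Embedding.refl_apply]
      split_ifs with h
      · rfl
      · rw [ih kl.2 (by omega) (by omega) h]
    rw [sum_congr rfl e2] at this
    exact add_right_cancel this
  have hEm : ∀ m ≤ n, PowerSeries.coeff m (∏ b, PowerSeries.mk fun k => x b ^ k * s k) = e m :=
    fun m hm => (he m N x (fun k hk => hx k (by omega))).symm
  have := congrArg (PowerSeries.coeff n) hE
  rw [coeff_X_d, hEm n le_rfl, PowerSeries.coeff_mul] at this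
  rw [this]
  refine sum_congr rfl (fun ij hij => ?_)
  have := mem_antidiagonal.mp hij
  rw [hEm _ (by omega), map_sum]
  congr 1
  split_ifs with h0
  · simp [PowerSeries.coeff_rescale, h0, hP]
  · simp only [PowerSeries.coeff_rescale, hP, PowerSeries.coeff_mk, if_neg h0]
    rw [← sum_mul, ← hpx _ (by omega) h0, sq]

end
end HeckeP

namespace HeckeP
open Finset Matrix

section
variable {K L : Type*} [Field K] [Field L] [Algebra K L] {Z : Type*} [Fintype Z] [DecidableEq Z]

/-- commutant -/
def Cm (T : ℕ → Matrix Z Z K) (n : ℕ) : Submodule K (Matrix Z Z K) where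
  carrier := {F | ∀ i, i + 1 < n → F * T i = T i * F}
  add_mem' := fun {a b} ha hb i hi => by rw [add_mul, mul_add, ha i hi, hb i hi]
  zero_mem' := fun i hi => by simp
  smul_mem' := fun r a ha i hi => by rw [smul_mul_assoc, mul_smul_comm, ha i hi]

lemma mem_Cm {T : ℕ → Matrix Z Z K} {n : ℕ} {F : Matrix Z Z K} :
    F ∈ Cm T n ↔ ∀ i, i + 1 < n → F * T i = T i * F := Iff.rfl

/-- extension of scalars for matrices -/
abbrev bc (K L : Type*) [Field K] [Field L] [Algebra K L] (Z : Type*) [Fintype Z] [DecidableEq Z] :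
    Matrix Z Z K →ₐ[K] Matrix Z Z L := (Algebra.ofId K L).mapMatrix

lemma bc_trace (a : Matrix Z Z K) : (bc K L Z a).trace = algebraMap K L a.trace := by
  simp [Matrix.trace, Algebra.ofId_apply]

lemma Inn_bc {T : ℕ → Matrix Z Z K} {n : ℕ} {φ : Matrix Z Z K →ₗ[K] Matrix Z Z K}
    (hφ : φ ∈ Inn K T n) : ∃ φ' : Matrix Z Z L →ₗ[L] Matrix Z Z L,
      (∀ F, φ' (bc K L Z F) = bc K L Z (φ F)) ∧
      LinearMap.trace L _ φ' = algebraMap K L (LinearMap.trace K _ φ) ∧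
      (∀ F, (∀ i, i + 1 < n → F * bc K L Z (T i) = bc K L Z (T i) * F) → φ' F = F * φ' 1) := by
  induction hφ using Submodule.span_induction with
  | mem x hx =>
    obtain ⟨a, ha, b, hb, rfl⟩ := hx
    refine ⟨LinearMap.mulLeft L (bc K L Z a) ∘ₗ LinearMap.mulRight L (bc K L Z b), ?_, ?_, ?_⟩
    · intro F; simp
    · rw [trace_lr (bc K L Z a) (bc K L Z b) _ (fun F => by simp [mul_assoc]),
        trace_lr a b _ (fun F => by simp [mul_assoc]), bc_trace, bc_trace, map_mul]
    · intro F hF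
      have : ∀ c ∈ Asub K T n, F * bc K L Z c = bc K L Z c * F := by
        intro c hc
        induction hc using Algebra.adjoin_induction with
        | mem a ha => obtain ⟨i, hi, rfl⟩ := ha; exact hF i hi
        | algebraMap r =>
          rw [AlgHom.commutes, IsScalarTower.algebraMap_apply K L]
          exact (Algebra.commutes _ _).symm
        | add x y _ _ hx hy => rw [map_add, add_mul, mul_add, hx, hy]
        | mul x y _ _ hx hy => rw [map_mul, ← mul_assoc, hx, mul_assoc, hy, mul_assoc]
      simp only [LinearMap.comp_apply, LinearMap.mulLeft_apply, LinearMap.mulRight_apply, one_mul]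
      rw [← mul_assoc, ← mul_assoc, this a ha]
  | zero => exact ⟨0, by simp, by simp, by simp⟩
  | add x y _ _ hx hy =>
    obtain ⟨f, f1, f2, f3⟩ := hx
    obtain ⟨g, g1, g2, g3⟩ := hy
    refine ⟨f + g, fun F => ?_, ?_, fun F hF => ?_⟩
    · rw [LinearMap.add_apply, f1, g1, LinearMap.add_apply, map_add]
    · rw [map_add, map_add, map_add, f2, g2]
    · rw [LinearMap.add_apply, LinearMap.add_apply, f3 F hF, g3 F hF, mul_add]
  | smul r x _ hx =>
    obtain ⟨f, f1, f2, f3⟩ := hx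
    refine ⟨algebraMap K L r • f, fun F => ?_, ?_, fun F hF => ?_⟩
    · rw [LinearMap.smul_apply, f1, LinearMap.smul_apply, map_smul, algebraMap_smul]
    · rw [map_smul, map_smul, f2, smul_eq_mul, smul_eq_mul, map_mul]
    · rw [LinearMap.smul_apply, LinearMap.smul_apply, f3 F hF, mul_smul_comm]

theorem comm_finrank [CharZero K] {q : K} (hq : q ≠ 0)
    (hqi : ∀ k : ℕ, 1 ≤ k → (∑ i ∈ range k, q ^ i) ≠ 0) {T : ℕ → Matrix Z Z K} {n : ℕ}
    (h : HRel q T n) (P : Matrix Z Z L →ₗ[L] Matrix Z Z L)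
    (h1 : ∀ F i, i + 1 < n → P F * bc K L Z (T i) = bc K L Z (T i) * P F)
    (h2 : ∀ F, (∀ i, i + 1 < n → F * bc K L Z (T i) = bc K L Z (T i) * F) → P F = F) :
    LinearMap.trace L _ P = (Module.finrank K (Cm T n) : L) := by
  obtain ⟨φ, hφ, p1, p2⟩ := exists_proj hq hqi h
  obtain ⟨φ', f1, f2, f3⟩ := Inn_bc (L := L) hφ
  have hpr : LinearMap.IsProj (Cm T n) φ := ⟨fun F i hi => p1 F i hi, fun F hF => p2 F hF⟩
  have t := hpr.trace
  rw [t, map_natCast] at f2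
  have one : φ' 1 = 1 := by
    have := f1 1
    rwa [p2 1 (fun i _ => by simp), map_one] at this
  have g1 : ∀ F i, i + 1 < n → φ' F * bc K L Z (T i) = bc K L Z (T i) * φ' F := by
    intro F i hi
    have : LinearMap.mulRight L (bc K L Z (T i)) ∘ₗ φ' = LinearMap.mulLeft L (bc K L Z (T i)) ∘ₗ φ' := by
      refine (Matrix.stdBasis L Z Z).ext (fun yw => ?_)
      rw [Matrix.stdBasis_eq_single]
      have e : single yw.1 yw.2 (1 : L) = bc K L Z (single yw.1 yw.2 1) := by
        ext a b; simp [single_apply, apply_ite]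
      simp only [LinearMap.comp_apply, LinearMap.mulLeft_apply, LinearMap.mulRight_apply]
      rw [e, f1, ← map_mul, ← map_mul, p1 _ i hi]
    exact LinearMap.congr_fun this F
  have c1 : P ∘ₗ φ' = φ' := LinearMap.ext fun F => h2 _ (g1 F)
  have c2 : φ' ∘ₗ P = P := LinearMap.ext fun F => by
    rw [LinearMap.comp_apply, f3 _ (h1 F), one, mul_one]
  rw [← f2, ← c1, LinearMap.trace_comp_comm', c2]

lemma qi_bc (q : K) (k : ℕ) : qi (algebraMap K L q) k = algebraMap K L (qi q k) := by
  simp [qi]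

lemma SS_bc (T : ℕ → Matrix Z Z K) (m : ℕ) :
    SS (fun i => bc K L Z (T i)) m = bc K L Z (SS T m) := (SS_map T (bc K L Z) m).symm

lemma sym_bc (q : K) (T : ℕ → Matrix Z Z K) (m : ℕ) :
    sym (algebraMap K L q) (fun i => bc K L Z (T i)) m = bc K L Z (sym q T m) := by
  induction m with
  | zero => simp [sym]
  | succ m ih =>
    rw [sym, sym, ih, SS_bc, map_smul, map_mul, qi_bc, ← map_inv₀, algebraMap_smul]

end

section
variable {K L : Type*} [Field K] [Field L] [Algebra K L] {ι : Type*} [Fintype ι] [DecidableEq ι]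

lemma Tm_bc (R : Matrix (ι × ι) (ι × ι) K) (n i : ℕ) :
    Tm (bc K L (ι × ι) R) n i = bc K L _ (Tm R n i) := by
  ext w v
  simp only [Tm, of_apply, AlgHom.mapMatrix_apply, map_apply]
  split_ifs <;> simp

lemma HD_bc {q : K} {R : Matrix (ι × ι) (ι × ι) K} (h : HD q R (fun _ => 1)) :
    HD (algebraMap K L q) (bc K L (ι × ι) R) (fun _ => 1) where
  quad := by
    rw [← map_mul, h.quad, map_add, map_smul, map_smul, map_one,
      ← algebraMap_smul L (q - 1), ← algebraMap_smul L q, map_sub, map_one]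
  braid := by
    simp only [Tm_bc, ← map_mul]
    rw [h.braid]
  wt := fun a b c d => by simp

theorem main_matrix [CharZero K] {q : K} (hq : q ≠ 0)
    (hqi : ∀ k : ℕ, 1 ≤ k → qi q k ≠ 0) {R : Matrix (ι × ι) (ι × ι) K} (hD : HD q R (fun _ => 1))
    (s e : ℕ → ℕ) (p : ℕ → ℚ) (hs : ∀ n, (sym q (Tm R n) n).trace = s n)
    (he : ∀ n, Module.finrank K (Cm (Tm R n) n) = e n)
    (hp : ∀ n : ℕ, (n * s n : ℚ) = ∑ ij ∈ antidiagonal n, s ij.1 * (if ij.2 = 0 then 0 else p ij.2))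
    (n : ℕ) :
    (n * e n : ℚ) = ∑ ij ∈ antidiagonal n, e ij.1 * (if ij.2 = 0 then 0 else p ij.2 ^ 2) := by
  let L := AlgebraicClosure K
  haveI : CharZero L := charZero_of_injective_algebraMap (algebraMap K L).injective
  have hq' : algebraMap K L q ≠ 0 := by simpa using hq
  have hqi' : ∀ k : ℕ, 1 ≤ k → qi (algebraMap K L q) k ≠ 0 := by
    intro k hk
    rw [qi_bc]; simpa using hqi k hk
  have tr : ∀ k, (sym (algebraMap K L q) (Tm (bc K L (ι × ι) R) k) k).trace = (s k : L) := by
    intro k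
    have : Tm (bc K L (ι × ι) R) k = fun i => bc K L _ (Tm R k i) := funext fun i => Tm_bc R k i
    rw [this, sym_bc, bc_trace, hs, map_natCast]
  have s0 : (s 0 : L) = 1 := by
    rw [← tr 0, sym, trace_one]; simp
  have := final_num (L := L) (fun n => (s n : L)) (fun n => (e n : L)) (fun n => ((p n : ℚ) : L)) s0
    (fun n => by
      have := congrArg (fun r : ℚ => (r : L)) (hp n)
      push_cast at this
      rw [this]
      refine sum_congr rfl (fun ij _ => ?_)
      split_ifs <;> simp)
    (fun n N x hx => by
      obtain ⟨P, P1, P2, P3⟩ := comm_trace hq' hqi' (HD_bc (L := L) hD) x n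
        (fun k hk => by rw [tr]; exact hx k hk)
      simp only [Tm_bc] at P1 P2
      rw [← he, ← comm_finrank hq hqi (hD.hrel n) P P1 P2, P3]
      simp only [tr]) n
  have inj : Function.Injective (fun r : ℚ => (r : L)) := Rat.cast_injective
  apply inj
  push_cast
  rw [this]
  refine sum_congr rfl (fun ij _ => ?_)
  split_ifs <;> simp

end
end HeckeP

namespace HeckeP
open Finset Matrix TensorProduct

section
variable {K : Type*} [Field K] {ι : Type*} [Fintype ι] [DecidableEq ι]

lemma span_dim {X A : Type*} [Fintype X] [AddCommGroup A] [Module K A] (m : X → A)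
    (Φ : Submodule K (X → K)) (hΦ : ∀ φ, φ ∈ Φ ↔ ∃ l : A →ₗ[K] K, ∀ w, φ w = l (m w)) :
    Module.finrank K (Submodule.span K (Set.range m)) = Module.finrank K Φ := by
  classical
  let e : Module.Dual K (X → K) ≃ₗ[K] (X → K) := ((Pi.basisFun K X).constr K).symm
  have h1 : LinearMap.range (Fintype.linearCombination K m) = Submodule.span K (Set.range m) :=
    Fintype.range_linearCombination K m
  rw [← h1, ← LinearMap.finrank_range_dualMap_eq_finrank_range, ← LinearEquiv.finrank_map_eq e]
  have he : ∀ l : A →ₗ[K] K, ∀ w, e ((Fintype.linearCombination K m).dualMap l) w = l (m w) := by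
    intro l w
    change ((Fintype.linearCombination K m).dualMap l) (Pi.basisFun K X w) = _
    rw [LinearMap.dualMap_apply, Pi.basisFun_apply, Fintype.linearCombination_apply_single, one_smul]
  have key : Submodule.map (e : Module.Dual K (X → K) →ₗ[K] (X → K))
      (LinearMap.range (Fintype.linearCombination K m).dualMap) = Φ := by
    ext φ
    rw [hΦ]
    constructor
    · rintro ⟨_, ⟨l, rfl⟩, rfl⟩
      exact ⟨l, he l⟩
    · rintro ⟨l, hl⟩
      refine ⟨_, ⟨l, rfl⟩, ?_⟩
      funext w
      rw [hl]; exact he l w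
  rw [key]

/-- replace letters at positions i and i+1 -/
def upd {n i : ℕ} (_hi : i + 1 < n) (w : Wd ι n) (a b : ι) : Wd ι n :=
  fun j => if (j : ℕ) = i then a else if (j : ℕ) = i + 1 then b else w j

lemma ofFn_upd {n i : ℕ} (hi : i + 1 < n) (w : Wd ι n) (a b : ι) :
    List.ofFn (upd hi w a b) = (List.ofFn w).take i ++ (a :: b :: (List.ofFn w).drop (i + 2)) := by
  refine List.ext_getElem ?_ (fun j h1 h2 => ?_)
  · simp; omega
  · rw [List.getElem_append]
    rw [List.getElem_ofFn]
    simp only [upd]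
    have hn : j < n := by simpa using h1
    have hlen : (List.take i (List.ofFn w)).length = i := by simp; omega
    simp only [hlen]
    rcases lt_trichotomy j i with h | h | h
    · rw [if_neg (by omega), if_neg (by omega), dif_pos h]
      simp
    · subst h
      simp
    · rw [if_neg (by omega), dif_neg (by omega)]
      by_cases h5 : j = i + 1
      · subst h5
        simp
      · rw [if_neg h5]
        obtain ⟨k, rfl⟩ : ∃ k, j = i + 2 + k := ⟨j - i - 2, by omega⟩
        have h6 : i + 2 + k - i = k + 2 := by omega
        simp only [h6, List.getElem_cons_succ, List.getElem_drop, List.getElem_ofFn]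

/-- monomial of a word -/
def mw {A : Type*} [Ring A] (v : ι → A) {n : ℕ} (w : Wd ι n) : A := ((List.ofFn w).map v).prod

variable {V : Type*} [AddCommGroup V] [Module K V]

lemma hom_quadMul {B : Type*} [Semiring B] [Algebra K B] (b : Module.Basis ι K V)
    (f : TensorAlgebra K V →ₐ[K] B) (r : V ⊗[K] V) :
    f (quadMul K V r) = ∑ ab : ι × ι, (b.tensorProduct b).repr r ab •
      (f (TensorAlgebra.ι K (b ab.1)) * f (TensorAlgebra.ι K (b ab.2))) := by
  conv_lhs => rw [← (b.tensorProduct b).sum_repr r]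
  rw [map_sum, map_sum]
  refine sum_congr rfl (fun ab _ => ?_)
  rw [map_smul, map_smul, Module.Basis.tensorProduct_apply']
  simp [quadMul]

/-- functions on words orthogonal to the relations -/
def Rl (b : Module.Basis ι K V) (W : Submodule K (V ⊗[K] V)) (n : ℕ) : Submodule K (Wd ι n → K) where
  carrier := {φ | ∀ i, ∀ hi : i + 1 < n, ∀ w : Wd ι n, ∀ r ∈ W,
    ∑ ab : ι × ι, (b.tensorProduct b).repr r ab * φ (upd hi w ab.1 ab.2) = 0}
  add_mem' := fun {φ ψ} h1 h2 i hi w r hr => by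
    simp only [Pi.add_apply, mul_add, sum_add_distrib, h1 i hi w r hr, h2 i hi w r hr, add_zero]
  zero_mem' := fun i hi w r hr => by simp
  smul_mem' := fun c φ h i hi w r hr => by
    simp only [Pi.smul_apply, smul_eq_mul, mul_left_comm _ c, ← mul_sum, h i hi w r hr, mul_zero]

/-- functions on all words orthogonal to the relations -/
def Ml (b : Module.Basis ι K V) (W : Submodule K (V ⊗[K] V)) : Submodule K (List ι → K) where
  carrier := {φ | ∀ u t : List ι, ∀ r ∈ W,
    ∑ ab : ι × ι, (b.tensorProduct b).repr r ab * φ (u ++ ab.1 :: ab.2 :: t) = 0}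
  add_mem' := fun {φ ψ} h1 h2 i w r hr => by
    simp only [Pi.add_apply, mul_add, sum_add_distrib, h1 i w r hr, h2 i w r hr, add_zero]
  zero_mem' := fun i w r hr => by simp
  smul_mem' := fun c φ h i w r hr => by
    simp only [Pi.smul_apply, smul_eq_mul, mul_left_comm _ c, ← mul_sum, h i w r hr, mul_zero]

/-- removing the last letter -/
def rho (b : Module.Basis ι K V) (W : Submodule K (V ⊗[K] V)) (a : ι) : Ml b W →ₗ[K] Ml b W where
  toFun := fun φ => ⟨fun u => φ.1 (u ++ [a]), fun u t r hr => by
    have := φ.2 u (t ++ [a]) r hr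
    simpa using this⟩
  map_add' := fun φ ψ => rfl
  map_smul' := fun c φ => rfl

lemma rho_prod (b : Module.Basis ι K V) (W : Submodule K (V ⊗[K] V)) (l : List ι) :
    ∀ (φ : Ml b W) (u : List ι), ((l.map fun a => (rho b W a : Module.End K (Ml b W))).prod φ).1 u = φ.1 (u ++ l) := by
  induction l with
  | nil => intro φ u; simp
  | cons a l ih =>
    intro φ u
    rw [List.map_cons, List.prod_cons]
    have := ih φ (u ++ [a])
    rw [List.append_assoc] at this
    exact this

lemma Rl_iff (b : Module.Basis ι K V) (W : Submodule K (V ⊗[K] V)) (n : ℕ) (φ : Wd ι n → K) :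
    φ ∈ Rl b W n ↔ ∃ l : RingQuot (quadRel K V W) →ₗ[K] K, ∀ w, φ w =
      l (mw (fun a => RingQuot.mkAlgHom K (quadRel K V W) (TensorAlgebra.ι K (b a))) w) := by
  constructor
  · intro hφ
    classical
    let φ' : List ι → K := fun l => if h : l.length = n then φ (fun j => l.get (j.cast h.symm)) else 0
    have hof : ∀ w : Wd ι n, φ' (List.ofFn w) = φ w := by
      intro w
      simp only [φ']
      rw [dif_pos (by simp)]
      congr 1
      funext j
      simp
    have hw : ∀ l : List ι, l.length = n → ∃ w : Wd ι n, l = List.ofFn w := by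
      rintro l rfl
      exact ⟨l.get, (List.ofFn_get l).symm⟩
    have hM : φ' ∈ Ml b W := by
      intro u t r hr
      by_cases hl : u.length + 2 + t.length = n
      · have hi : u.length + 1 < n := by omega
        by_cases hne : Nonempty ι
        · obtain ⟨a0⟩ := hne
          obtain ⟨w, hw⟩ := hw (u ++ a0 :: a0 :: t) (by simp; omega)
          rw [← hφ _ hi w r hr]
          refine sum_congr rfl (fun ab _ => ?_)
          rw [← hof, ofFn_upd, ← hw]
          congr 2
          simp
        · exact Finset.sum_eq_zero (fun ab _ => absurd ⟨ab.1⟩ hne)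
      · refine Finset.sum_eq_zero (fun ab _ => ?_)
        simp only [φ']
        rw [dif_neg (by simp; omega), mul_zero]
    let f : TensorAlgebra K V →ₐ[K] Module.End K (Ml b W) :=
      TensorAlgebra.lift K (b.constr K (fun a => (rho b W a : Module.End K (Ml b W))))
    have hf : ∀ a, f (TensorAlgebra.ι K (b a)) = rho b W a := by
      intro a
      simp only [f]
      rw [TensorAlgebra.lift_ι_apply, Module.Basis.constr_basis]
    have hfr : ∀ ⦃x y⦄, quadRel K V W x y → f x = f y := by
      rintro x y ⟨rfl, r, hr, rfl⟩
      rw [map_zero, hom_quadMul b f r]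
      refine LinearMap.ext (fun ψ => Subtype.ext (funext fun u => ?_))
      have := ψ.2 u [] r hr
      rw [LinearMap.sum_apply, Submodule.coe_sum, Finset.sum_apply]
      rw [LinearMap.zero_apply, Submodule.coe_zero, Pi.zero_apply, ← this]
      refine sum_congr rfl (fun ab _ => ?_)
      rw [hf, hf, LinearMap.smul_apply, Submodule.coe_smul, Pi.smul_apply, smul_eq_mul]
      congr 1
      change ψ.1 ((u ++ [ab.1]) ++ [ab.2]) = _
      rw [List.append_assoc]; rfl
    let ψ := RingQuot.liftAlgHom K (⟨f, hfr⟩ : {f : TensorAlgebra K V →ₐ[K] Module.End K (Ml b W) // ∀ ⦃x y⦄, quadRel K V W x y → f x = f y})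
    refine ⟨{ toFun := fun x => (ψ x ⟨φ', hM⟩).1 [], map_add' := fun x y => by rw [map_add]; rfl,
              map_smul' := fun c x => by rw [map_smul]; rfl }, fun w => ?_⟩
    change _ = (ψ (mw _ w) ⟨φ', hM⟩).1 []
    have : ψ (mw (fun a => RingQuot.mkAlgHom K (quadRel K V W) (TensorAlgebra.ι K (b a))) w) =
        ((List.ofFn w).map fun a => (rho b W a : Module.End K (Ml b W))).prod := by
      rw [mw, map_list_prod, List.map_map]
      congr 2
      funext a
      simp only [ψ, Function.comp]
      rw [RingQuot.liftAlgHom_mkAlgHom_apply]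
      exact hf a
    rw [this, rho_prod, List.nil_append]
    exact (hof w).symm
  · rintro ⟨l, hl⟩ i hi w r hr
    set π := RingQuot.mkAlgHom K (quadRel K V W) with hπ
    have h0 : π (quadMul K V r) = 0 := by
      have hrel : quadRel K V W (quadMul K V r) 0 := ⟨rfl, r, hr, rfl⟩
      rw [hπ]
      exact (RingQuot.mkAlgHom_rel K hrel).trans (map_zero _)
    rw [hom_quadMul b] at h0
    let v : ι → RingQuot (quadRel K V W) := fun a => π (TensorAlgebra.ι K (b a))
    have key : ∀ a c, mw v (upd hi w a c) =
        (((List.ofFn w).take i).map v).prod * (v a * v c) * (((List.ofFn w).drop (i + 2)).map v).prod := by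
      intro a c
      rw [mw, ofFn_upd]
      simp [mul_assoc]
    have : ∑ ab : ι × ι, (b.tensorProduct b).repr r ab • mw v (upd hi w ab.1 ab.2) = 0 := by
      have h3 : ∀ (c : K) (x y z : RingQuot (quadRel K V W)), c • (x * y * z) = x * (c • y) * z := by
        intro c x y z; rw [mul_smul_comm, smul_mul_assoc]
      simp only [key, h3]
      rw [← sum_mul, ← mul_sum]
      change _ * (∑ ab : ι × ι, (b.tensorProduct b).repr r ab • (π (TensorAlgebra.ι K (b ab.1)) * π (TensorAlgebra.ι K (b ab.2)))) * _ = 0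
      rw [h0, mul_zero, zero_mul]
    have h2 := congrArg l this
    rw [map_sum, map_zero] at h2
    rw [← h2]
    refine sum_congr rfl (fun ab _ => ?_)
    rw [map_smul, smul_eq_mul, hl]

open scoped Pointwise in
theorem quadDim_eq (b : Module.Basis ι K V) (W : Submodule K (V ⊗[K] V)) (n : ℕ) :
    quadDim K V W n = Module.finrank K (Rl b W n) := by
  rw [← span_dim _ (Rl b W n) (Rl_iff b W n), quadDim]
  have h1 : LinearMap.range (TensorAlgebra.ι K (M := V)) =
      Submodule.span K (Set.range fun a => TensorAlgebra.ι K (b a)) := by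
    rw [LinearMap.range_eq_map, ← b.span_eq, Submodule.map_span, ← Set.range_comp]
    rfl
  rw [h1, Submodule.span_pow, Submodule.map_span]
  have key : Set.image (RingQuot.mkAlgHom K (quadRel K V W)).toLinearMap
      ((Set.range fun a => TensorAlgebra.ι K (b a)) ^ n) = Set.range (fun w : Wd ι n =>
      mw (fun a => RingQuot.mkAlgHom K (quadRel K V W) (TensorAlgebra.ι K (b a))) w) := by
    ext x
    constructor
    · rintro ⟨y, hy, rfl⟩
      obtain ⟨f, rfl⟩ := Set.mem_pow.mp hy
      choose g hg using fun j => (f j).2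
      refine ⟨g, ?_⟩
      simp only [AlgHom.toLinearMap_apply]
      rw [mw, map_list_prod, List.map_ofFn, List.map_ofFn]
      congr 2
      funext j
      simp only [Function.comp, ← hg j]
    · rintro ⟨g, rfl⟩
      refine ⟨(List.ofFn fun j => TensorAlgebra.ι K (b (g j))).prod,
        Set.mem_pow.mpr ⟨fun j => ⟨_, g j, rfl⟩, rfl⟩, ?_⟩
      simp only [AlgHom.toLinearMap_apply]
      rw [mw, map_list_prod, List.map_ofFn, List.map_ofFn]
      rfl
  rw [key]

end
end HeckeP

namespace HeckeP
open Finset Matrix TensorProduct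

section
variable {K : Type*} [Field K] {ι : Type*} [Fintype ι] [DecidableEq ι]

lemma upd_left {n i : ℕ} (hi : i + 1 < n) (w : Wd ι n) (a b : ι) : upd hi w a b ⟨i, by omega⟩ = a := by
  simp [upd]

lemma upd_right {n i : ℕ} (hi : i + 1 < n) (w : Wd ι n) (a b : ι) : upd hi w a b ⟨i + 1, hi⟩ = b := by
  simp [upd]

lemma upd_self {n i : ℕ} (hi : i + 1 < n) (w : Wd ι n) :
    upd hi w (w ⟨i, by omega⟩) (w ⟨i + 1, hi⟩) = w := by
  funext j
  simp only [upd]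
  split_ifs with h1 h2
  · congr 1; exact Fin.ext h1.symm
  · congr 1; exact Fin.ext h2.symm
  · rfl

lemma upd_upd {n i : ℕ} (hi : i + 1 < n) (w : Wd ι n) (a b c d : ι) :
    upd hi (upd hi w a b) c d = upd hi w c d := by
  funext j
  simp only [upd]
  split_ifs <;> rfl

lemma vecMul_Tm (M : Matrix (ι × ι) (ι × ι) K) {n i : ℕ} (hi : i + 1 < n) (φ : Wd ι n → K) (v : Wd ι n) :
    (φ ᵥ* Tm M n i) v = ∑ ab : ι × ι, φ (upd hi v ab.1 ab.2) *
      M ab (v ⟨i, by omega⟩, v ⟨i + 1, hi⟩) := by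
  rw [Matrix.vecMul, dotProduct]
  symm
  refine Fintype.sum_of_injective (fun ab : ι × ι => upd hi v ab.1 ab.2) ?_ _ _ ?_ ?_
  · rintro ⟨a, b⟩ ⟨c, d⟩ h
    have h1 := congrFun h ⟨i, by omega⟩
    have h2 := congrFun h ⟨i + 1, hi⟩
    simp only [upd_left, upd_right] at h1 h2
    rw [h1, h2]
  · intro w hw
    rw [Tm_apply M hi, if_neg, mul_zero]
    intro h
    apply hw
    refine ⟨(w ⟨i, by omega⟩, w ⟨i + 1, hi⟩), ?_⟩
    funext j
    simp only [upd]
    split_ifs with h1 h2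
    · congr 1; exact Fin.ext h1.symm
    · congr 1; exact Fin.ext h2.symm
    · exact (h j h1 h2).symm
  · rintro ⟨a, b⟩
    simp only
    rw [Tm_apply M hi, if_pos, upd_left, upd_right]
    intro j h1 h2
    simp [upd, h1, h2]

variable {V : Type*} [AddCommGroup V] [Module K V]

lemma bridge (b : Module.Basis ι K V) (Op : V ⊗[K] V →ₗ[K] V ⊗[K] V) (c : K) (n : ℕ) (φ : Wd ι n → K) :
    φ ∈ Rl b (LinearMap.range (Op - c • LinearMap.id)) n ↔
      ∀ i, i + 1 < n → φ ᵥ* Tm (LinearMap.toMatrix (b.tensorProduct b) (b.tensorProduct b) Op) n i = c • φ := by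
  set M := LinearMap.toMatrix (b.tensorProduct b) (b.tensorProduct b) Op with hM
  have key : ∀ i (hi : i + 1 < n) (w : Wd ι n) (cd : ι × ι),
      ∑ ab : ι × ι, (b.tensorProduct b).repr ((Op - c • LinearMap.id : V ⊗[K] V →ₗ[K] V ⊗[K] V) (b.tensorProduct b cd)) ab *
        φ (upd hi w ab.1 ab.2) = (φ ᵥ* Tm M n i) (upd hi w cd.1 cd.2) - c * φ (upd hi w cd.1 cd.2) := by
    intro i hi w cd
    rw [vecMul_Tm M hi, upd_left, upd_right]
    simp only [upd_upd]
    have h1 : ∀ ab, (b.tensorProduct b).repr ((Op - c • LinearMap.id : V ⊗[K] V →ₗ[K] V ⊗[K] V) (b.tensorProduct b cd)) ab =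
        M ab cd - c * (if cd = ab then 1 else 0) := by
      intro ab
      rw [hM, LinearMap.toMatrix_apply, LinearMap.sub_apply, map_sub, Finsupp.sub_apply, LinearMap.smul_apply,
        LinearMap.id_apply, map_smul, Finsupp.smul_apply, Module.Basis.repr_self, Finsupp.single_apply, smul_eq_mul]
    simp only [h1, sub_mul, sum_sub_distrib]
    congr 1
    · exact sum_congr rfl (fun ab _ => mul_comm _ _)
    · simp [mul_assoc]
  constructor
  · intro h i hi
    funext v
    have h1 := h i hi v _ ⟨b.tensorProduct b (v ⟨i, by omega⟩, v ⟨i + 1, hi⟩), rfl⟩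
    rw [key, upd_self] at h1
    rw [Pi.smul_apply, smul_eq_mul]
    exact sub_eq_zero.mp h1
  · rintro h i hi w _ ⟨x, rfl⟩
    let L : V ⊗[K] V →ₗ[K] K :=
      { toFun := fun r => ∑ ab : ι × ι, (b.tensorProduct b).repr r ab * φ (upd hi w ab.1 ab.2)
        map_add' := fun x y => by simp [add_mul, sum_add_distrib]
        map_smul' := fun r x => by simp [mul_sum, mul_assoc] }
    have : L ∘ₗ (Op - c • LinearMap.id) = 0 := by
      refine (b.tensorProduct b).ext (fun cd => ?_)
      have := key i hi w cd
      rw [h i hi, Pi.smul_apply, smul_eq_mul, sub_self] at this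
      exact this
    exact LinearMap.congr_fun this x

lemma sDim_eq (b : Module.Basis ι K V) {q : K} (hqi : ∀ k : ℕ, 1 ≤ k → qi q k ≠ 0)
    (R : V ⊗[K] V →ₗ[K] V ⊗[K] V) {x : ι → K}
    (hD : HD q (LinearMap.toMatrix (b.tensorProduct b) (b.tensorProduct b) R) x) (n : ℕ) :
    (sym q (Tm (LinearMap.toMatrix (b.tensorProduct b) (b.tensorProduct b) R) n) n).trace = sDim K V q R n := by
  set M := LinearMap.toMatrix (b.tensorProduct b) (b.tensorProduct b) R with hM
  rw [sDim, quadDim_eq b]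
  set S := sym q (Tm M n) n with hS
  have hproj : LinearMap.IsProj (Rl b (LinearMap.range (R - q • LinearMap.id)) n) (Matrix.toLin' Sᵀ) := by
    constructor
    · intro φ
      rw [bridge]
      intro i hi
      rw [Matrix.toLin'_apply, Matrix.mulVec_transpose, Matrix.vecMul_vecMul, ← hM, hS,
        sym_abs (hD.hrel n) n le_rfl i hi, Matrix.vecMul_smul]
    · intro φ hφ
      rw [bridge] at hφ
      rw [Matrix.toLin'_apply, Matrix.mulVec_transpose]
      have := sym_fix hqi (T := Tm M n) n (Matrix.of fun (_ : Unit) w => φ w) (fun i hi => by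
        ext u w
        have := congrFun (hφ i hi) w
        exact this)
      funext w
      exact congrFun (congrFun this ()) w
  have h2 := hproj.trace
  rw [Matrix.trace_toLin'_eq, Matrix.trace_transpose] at h2
  exact h2

end
end HeckeP

namespace HeckeP
open Finset Matrix TensorProduct

section
variable {K : Type*} [Field K] {ι : Type*} [Fintype ι] [DecidableEq ι]
variable {V : Type*} [AddCommGroup V] [Module K V]

lemma repr_assoc (b : Module.Basis ι K V) (z : V ⊗[K] (V ⊗[K] V)) (x y t : ι) :
    ((b.tensorProduct b).tensorProduct b).repr ((TensorProduct.assoc K V V V).symm z) ((x, y), t) =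
      (b.tensorProduct (b.tensorProduct b)).repr z (x, (y, t)) := by
  induction z with
  | zero => simp
  | add z w hz hw => simp only [map_add, Finsupp.add_apply, hz, hw]
  | tmul u v =>
    induction v with
    | zero => simp
    | add z w hz hw => simp only [map_add, tmul_add, Finsupp.add_apply, hz, hw]
    | tmul v w => simp [Module.Basis.tensorProduct_repr_tmul_apply]; ring

/-- triples and words of length three -/
def e3 (ι : Type*) : (ι × ι) × ι ≃ Wd ι 3 where
  toFun := fun x => ![x.1.1, x.1.2, x.2]
  invFun := fun w => ((w 0, w 1), w 2)
  left_inv := fun x => rfl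
  right_inv := fun w => by funext j; fin_cases j <;> rfl

lemma e3s (w : Wd ι 3) : (e3 ι).symm w = ((w 0, w 1), w 2) := rfl

lemma mat_R1 (b : Module.Basis ι K V) (R : V ⊗[K] V →ₗ[K] V ⊗[K] V) :
    LinearMap.toMatrix (((b.tensorProduct b).tensorProduct b).reindex (e3 ι))
      (((b.tensorProduct b).tensorProduct b).reindex (e3 ι)) (LinearMap.rTensor V R) =
      Tm (LinearMap.toMatrix (b.tensorProduct b) (b.tensorProduct b) R) 3 0 := by
  ext w v
  rw [LinearMap.toMatrix_apply, Tm_apply _ (by omega), LinearMap.toMatrix_apply,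
    Module.Basis.reindex_apply, Module.Basis.repr_reindex_apply]
  have h : (∀ j : Fin 3, (j : ℕ) ≠ 0 → (j : ℕ) ≠ 0 + 1 → w j = v j) ↔ v 2 = w 2 := by
    simp [Fin.forall_fin_succ, eq_comm]
  simp only [h]
  simp only [e3s]
  rw [Module.Basis.tensorProduct_apply, LinearMap.rTensor_tmul, Module.Basis.tensorProduct_repr_tmul_apply,
    Module.Basis.repr_self, Finsupp.single_apply]
  split_ifs <;> simp

lemma mat_R2 (b : Module.Basis ι K V) (R : V ⊗[K] V →ₗ[K] V ⊗[K] V) :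
    LinearMap.toMatrix (((b.tensorProduct b).tensorProduct b).reindex (e3 ι))
      (((b.tensorProduct b).tensorProduct b).reindex (e3 ι))
      ((TensorProduct.assoc K V V V).symm.toLinearMap ∘ₗ LinearMap.lTensor V R ∘ₗ
      (TensorProduct.assoc K V V V).toLinearMap) =
      Tm (LinearMap.toMatrix (b.tensorProduct b) (b.tensorProduct b) R) 3 1 := by
  ext w v
  rw [LinearMap.toMatrix_apply, Tm_apply _ (by omega), LinearMap.toMatrix_apply,
    Module.Basis.reindex_apply, Module.Basis.repr_reindex_apply]
  have h : (∀ j : Fin 3, (j : ℕ) ≠ 1 → (j : ℕ) ≠ 1 + 1 → w j = v j) ↔ v 0 = w 0 := by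
    simp [Fin.forall_fin_succ, eq_comm]
  simp only [h]
  simp only [e3s, LinearMap.comp_apply, LinearEquiv.coe_coe]
  rw [repr_assoc, Module.Basis.tensorProduct_apply, Module.Basis.tensorProduct_apply,
    TensorProduct.assoc_tmul, LinearMap.lTensor_tmul, Module.Basis.tensorProduct_repr_tmul_apply,
    Module.Basis.repr_self, Finsupp.single_apply, Module.Basis.tensorProduct_apply]
  split_ifs <;> simp

lemma HD_of (b : Module.Basis ι K V) {q : K} {R : V ⊗[K] V →ₗ[K] V ⊗[K] V} (hR : IsHecke K V q R) :
    HD q (LinearMap.toMatrix (b.tensorProduct b) (b.tensorProduct b) R) (fun _ => 1) where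
  quad := by
    have h : R ∘ₗ R = (q - 1) • R + q • LinearMap.id := by
      have := hR.2
      refine LinearMap.ext (fun x => ?_)
      have h1 := LinearMap.congr_fun this x
      simp only [LinearMap.comp_apply, LinearMap.add_apply, LinearMap.sub_apply, LinearMap.smul_apply,
        LinearMap.id_apply, map_sub, map_smul, LinearMap.zero_apply] at h1 ⊢
      rw [sub_smul, one_smul, ← sub_eq_zero, ← h1, smul_add]
      abel
    rw [← LinearMap.toMatrix_comp, h, map_add, map_smul, map_smul, LinearMap.toMatrix_id]
  braid := by
    rw [← mat_R1, ← mat_R2, ← LinearMap.toMatrix_comp, ← LinearMap.toMatrix_comp,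
      ← LinearMap.toMatrix_comp, ← LinearMap.toMatrix_comp]
    congr 1
    exact hR.1
  wt := fun a b c d => by simp

lemma Tm_inv {A B : Matrix (ι × ι) (ι × ι) K} (h : A * B = 1) {n i : ℕ} (hi : i + 1 < n) :
    Tm A n i * Tm B n i = 1 := by
  obtain ⟨k, rfl⟩ : ∃ k, n = i + (2 + k) := ⟨n - i - 2, by omega⟩
  have e : ∀ R : Matrix (ι × ι) (ι × ι) K,
      Tm R (i + (2 + k)) i = (embR K ι i (2+k)) (embL K ι 2 k (Tm R 2 0)) := by
    intro R
    rw [← Tm_embL R (by omega), ← Tm_embR R (by omega)]; rfl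
  rw [e, e, ← map_mul, ← map_mul, Tm_two, Tm_two, submatrix_mul_equiv, h, submatrix_one_equiv, map_one, map_one]

lemma repr_theta {D : Type*} [AddCommGroup D] [Module K D] (c : Module.Basis ι K D) (b : Module.Basis ι K V)
    (z : (D ⊗[K] D) ⊗[K] (V ⊗[K] V)) (s t u v : ι) :
    ((c.tensorProduct b).tensorProduct (c.tensorProduct b)).repr
      ((TensorProduct.tensorTensorTensorComm K D V D V).symm z) ((s, t), (u, v)) =
    ((c.tensorProduct c).tensorProduct (b.tensorProduct b)).repr z ((s, u), (t, v)) := by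
  induction z with
  | zero => simp
  | add z w hz hw => simp only [map_add, Finsupp.add_apply, hz, hw]
  | tmul x y =>
    induction x with
    | zero => simp
    | add z w hz hw => simp only [map_add, add_tmul, Finsupp.add_apply, hz, hw]
    | tmul x x' =>
      induction y with
      | zero => simp
      | add z w hz hw => simp only [map_add, tmul_add, Finsupp.add_apply, hz, hw]
      | tmul y y' =>
        rw [TensorProduct.tensorTensorTensorComm_symm, TensorProduct.tensorTensorTensorComm_tmul]
        simp only [Module.Basis.tensorProduct_repr_tmul_apply, smul_eq_mul]; ring

/-- invariant functions on words -/
def Fx (M : Matrix (ι × ι) (ι × ι) K) (n : ℕ) : Submodule K (Wd ι n → K) where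
  carrier := {φ | ∀ i, i + 1 < n → φ ᵥ* Tm M n i = φ}
  add_mem' := fun {φ ψ} h1 h2 i hi => by rw [Matrix.add_vecMul, h1 i hi, h2 i hi]
  zero_mem' := fun i hi => by rw [Matrix.zero_vecMul]
  smul_mem' := fun c φ h i hi => by rw [Matrix.smul_vecMul, h i hi]

lemma quadDim_fix (b : Module.Basis ι K V) (Op : V ⊗[K] V →ₗ[K] V ⊗[K] V) (n : ℕ) :
    quadDim K V (Submodule.span K {y | ∃ x, Op x = x + y}) n =
      Module.finrank K (Fx (LinearMap.toMatrix (b.tensorProduct b) (b.tensorProduct b) Op) n) := by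
  have hW : Submodule.span K {y | ∃ x, Op x = x + y} =
      LinearMap.range (Op - (1 : K) • LinearMap.id) := by
    have : {y | ∃ x, Op x = x + y} =
        ((LinearMap.range (Op - (1 : K) • LinearMap.id) : Submodule K (V ⊗[K] V)) : Set (V ⊗[K] V)) := by
      ext y
      simp only [Set.mem_setOf_eq, LinearMap.coe_range, Set.mem_range, LinearMap.sub_apply, one_smul,
        LinearMap.id_apply]
      exact exists_congr fun x => ⟨fun h => by rw [h]; abel, fun h => by rw [← h]; abel⟩
    rw [this, Submodule.span_eq]
  have key : Rl b (LinearMap.range (Op - (1 : K) • LinearMap.id)) n =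
      Fx (LinearMap.toMatrix (b.tensorProduct b) (b.tensorProduct b) Op) n := by
    ext φ
    rw [bridge]
    simp only [one_smul]
    rfl
  rw [hW, quadDim_eq b, key]

lemma quadDim_fix2 (b : Module.Basis ι K V) (Op : V ⊗[K] V →ₗ[K] V ⊗[K] V) (n : ℕ)
    (Q : Matrix (ι × ι) (ι × ι) K)
    (hQ : ∀ u v s t, (b.tensorProduct b).repr (Op (b s ⊗ₜ[K] b t)) (u, v) = Q (u, v) (s, t)) :
    quadDim K V (Submodule.span K {y | ∃ x, Op x = x + y}) n = Module.finrank K (Fx Q n) := by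
  have h : LinearMap.toMatrix (b.tensorProduct b) (b.tensorProduct b) Op = Q := by
    ext ⟨u, v⟩ ⟨s, t⟩
    rw [LinearMap.toMatrix_apply, Module.Basis.tensorProduct_apply, hQ]
  rw [quadDim_fix b, h]

variable [FiniteDimensional K V]

lemma repr_dual (b : Module.Basis ι K V) (z : Module.Dual K V ⊗[K] Module.Dual K V) (s t : ι) :
    (b.dualBasis.tensorProduct b.dualBasis).repr z (s, t) =
      TensorProduct.dualDistribEquiv K V V z (b s ⊗ₜ b t) := by
  induction z with
  | zero => simp
  | add z w hz hw => simp only [map_add, Finsupp.add_apply, LinearMap.add_apply, hz, hw]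
  | tmul x y =>
    rw [Module.Basis.tensorProduct_repr_tmul_apply, Module.Basis.dualBasis_repr, Module.Basis.dualBasis_repr]
    change _ = x (b s) * y (b t)
    simp [mul_comm]

lemma mat_bar (b : Module.Basis ι K V) (R Ri : V ⊗[K] V →ₗ[K] V ⊗[K] V) (s t u v s' t' u' v' : ι) :
    LinearMap.toMatrix ((b.dualBasis.tensorProduct b).tensorProduct (b.dualBasis.tensorProduct b))
      ((b.dualBasis.tensorProduct b).tensorProduct (b.dualBasis.tensorProduct b)) (barOp K V R Ri)
      ((s', t'), (u', v')) ((s, t), (u, v)) =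
    LinearMap.toMatrix (b.tensorProduct b) (b.tensorProduct b) Ri (s, u) (s', u') *
    LinearMap.toMatrix (b.tensorProduct b) (b.tensorProduct b) R (t', v') (t, v) := by
  rw [LinearMap.toMatrix_apply, LinearMap.toMatrix_apply, LinearMap.toMatrix_apply, barOp]
  simp only [LinearMap.comp_apply, LinearEquiv.coe_coe]
  rw [repr_theta, Module.Basis.tensorProduct_apply, Module.Basis.tensorProduct_apply,
    Module.Basis.tensorProduct_apply, TensorProduct.tensorTensorTensorComm_tmul, TensorProduct.map_tmul,
    Module.Basis.tensorProduct_repr_tmul_apply, repr_dual, dualOp]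
  simp only [LinearMap.comp_apply, LinearEquiv.coe_coe, LinearEquiv.apply_symm_apply]
  rw [LinearMap.dualMap_apply, smul_eq_mul, Module.Basis.tensorProduct_apply, Module.Basis.tensorProduct_apply, mul_comm]
  congr 1
  have : ∀ y : V ⊗[K] V, TensorProduct.dualDistribEquiv K V V (b.dualBasis s ⊗ₜ b.dualBasis u) y =
      (b.tensorProduct b).repr y (s, u) := by
    intro y
    induction y with
    | zero => simp
    | add z w hz hw => simp only [map_add, Finsupp.add_apply, hz, hw]
    | tmul x y =>
      change b.dualBasis s x * b.dualBasis u y = _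
      rw [Module.Basis.tensorProduct_repr_tmul_apply]
      simp [mul_comm]
  exact this _

lemma Tm_bar {A B : Matrix (ι × ι) (ι × ι) K} {Q : Matrix ((ι × ι) × (ι × ι)) ((ι × ι) × (ι × ι)) K}
    (hQ : ∀ s t u v s' t' u' v', Q ((s', t'), (u', v')) ((s, t), (u, v)) = B (s, u) (s', u') * A (t', v') (t, v))
    {n i : ℕ} (hi : i + 1 < n) (f g f' g' : Wd ι n) :
    Tm Q n i (fun j => (f' j, g' j)) (fun j => (f j, g j)) = Tm B n i f f' * Tm A n i g' g := by
  rw [Tm_apply _ hi, Tm_apply _ hi, Tm_apply _ hi, hQ]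
  by_cases h1 : ∀ j : Fin n, (j : ℕ) ≠ i → (j : ℕ) ≠ i + 1 → f j = f' j
  · by_cases h2 : ∀ j : Fin n, (j : ℕ) ≠ i → (j : ℕ) ≠ i + 1 → g' j = g j
    · rw [if_pos h1, if_pos h2, if_pos]
      intro j a b
      rw [h1 j a b, h2 j a b]
    · rw [if_neg h2, mul_zero, if_neg]
      intro h
      exact h2 fun j a b => (Prod.ext_iff.mp (h j a b)).2
  · rw [if_neg h1, zero_mul, if_neg]
    intro h
    exact h1 fun j a b => (Prod.ext_iff.mp (h j a b)).1.symm

/-- functions on words in pairs are matrices -/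
def zipE (K ι : Type*) [Field K] (n : ℕ) : (Wd (ι × ι) n → K) ≃ₗ[K] Matrix (Wd ι n) (Wd ι n) K where
  toFun := fun φ => Matrix.of fun f g => φ (fun j => (f j, g j))
  invFun := fun F w => F (fun j => (w j).1) (fun j => (w j).2)
  left_inv := fun φ => rfl
  right_inv := fun F => rfl
  map_add' := fun φ ψ => rfl
  map_smul' := fun c φ => rfl

lemma zip_vecMul {A B : Matrix (ι × ι) (ι × ι) K} {Q : Matrix ((ι × ι) × (ι × ι)) ((ι × ι) × (ι × ι)) K}
    (hQ : ∀ s t u v s' t' u' v', Q ((s', t'), (u', v')) ((s, t), (u, v)) = B (s, u) (s', u') * A (t', v') (t, v))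
    {n i : ℕ} (hi : i + 1 < n) (φ : Wd (ι × ι) n → K) :
    zipE K ι n (φ ᵥ* Tm Q n i) = Tm B n i * zipE K ι n φ * Tm A n i := by
  ext f g
  change ∑ w : Wd (ι × ι) n, φ w * Tm Q n i w (fun j => (f j, g j)) = _
  rw [Matrix.mul_apply]
  simp only [Matrix.mul_apply, sum_mul]
  rw [← Fintype.sum_prod_type_right']
  refine Fintype.sum_equiv (Equiv.arrowProdEquivProdArrow _ _ _) _ _ (fun w => ?_)
  have := Tm_bar hQ hi f g (fun j => (w j).1) (fun j => (w j).2)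
  change φ w * Tm Q n i (fun j => ((w j).1, (w j).2)) (fun j => (f j, g j)) =
    Tm B n i f (fun j => (w j).1) * φ w * Tm A n i (fun j => (w j).2) g
  rw [this]; ring

lemma quadDim_fix3 {V : Type*} [AddCommGroup V] [md0 : Module K V] (b : Module.Basis ι K V) (S : Set (V ⊗[K] V)) (n : ℕ)
    (m : AddCommMonoid V) (md : @Module K V _ m)
    (hm : m = AddCommGroup.toAddCommMonoid) (hmd : HEq md md0)
    (b' : @Module.Basis ι K V _ m md)
    (hb : HEq b b')
    (Op : @LinearMap K K _ _ (RingHom.id K) (@TensorProduct K _ V V m m md md) (@TensorProduct K _ V V m m md md)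
      _ _ _ _)
    (hS : HEq S {y | ∃ x, Op x = x + y})
    (Q : Matrix (ι × ι) (ι × ι) K)
    (hQ : ∀ x y, LinearMap.toMatrix (b'.tensorProduct b') (b'.tensorProduct b') Op x y = Q x y) :
    quadDim K V (Submodule.span K S) n = Module.finrank K (Fx Q n) := by
  subst hm
  obtain rfl := eq_of_heq hmd
  obtain rfl := eq_of_heq hb
  obtain rfl := eq_of_heq hS
  have h : LinearMap.toMatrix (b.tensorProduct b) (b.tensorProduct b) Op = Q := Matrix.ext hQ
  rw [quadDim_fix b, h]

end
end HeckeP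

namespace HeckeP
open Finset Matrix TensorProduct

section
variable {K : Type*} [Field K] {ι : Type*} [Fintype ι] [DecidableEq ι]
variable {V : Type*} [AddCommGroup V] [Module K V] [FiniteDimensional K V]

lemma eDim_Fx (b : Module.Basis ι K V) (R Ri : V ⊗[K] V →ₗ[K] V ⊗[K] V) (n : ℕ)
    (Q : Matrix ((ι × ι) × (ι × ι)) ((ι × ι) × (ι × ι)) K)
    (hQ : ∀ s t u v s' t' u' v', Q ((s', t'), (u', v')) ((s, t), (u, v)) =
      LinearMap.toMatrix (b.tensorProduct b) (b.tensorProduct b) Ri (s, u) (s', u') *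
      LinearMap.toMatrix (b.tensorProduct b) (b.tensorProduct b) R (t', v') (t, v)) :
    eDim K V R Ri n = Module.finrank K (Fx Q n) := by
  unfold eDim
  refine quadDim_fix3 (b.dualBasis.tensorProduct b) _ n TensorProduct.addCommMonoid
    TensorProduct.leftModule ?_ ?_ ?_ ?_ ?_ ?_ Q ?_
  case refine_1 => rfl
  case refine_2 => exact HEq.rfl
  case refine_3 => exact (b.dualBasis.tensorProduct b)
  case refine_4 => exact HEq.rfl
  case refine_5 => exact barOp K V R Ri
  case refine_6 => exact HEq.rfl
  case refine_7 =>
    rintro ⟨⟨u, v⟩, ⟨u', v'⟩⟩ ⟨⟨s, t⟩, ⟨s', t'⟩⟩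
    have := mat_bar b R Ri s t s' t' u v u' v'
    exact this.trans (hQ _ _ _ _ _ _ _ _).symm

lemma eDim_eq (b : Module.Basis ι K V) (R Ri : V ⊗[K] V →ₗ[K] V ⊗[K] V)
    (h1 : R ∘ₗ Ri = LinearMap.id) (h2 : Ri ∘ₗ R = LinearMap.id) (n : ℕ) :
    Module.finrank K (Cm (Tm (LinearMap.toMatrix (b.tensorProduct b) (b.tensorProduct b) R) n) n) =
      eDim K V R Ri n := by
  let Q : Matrix ((ι × ι) × (ι × ι)) ((ι × ι) × (ι × ι)) K := Matrix.of fun x y =>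
    LinearMap.toMatrix (b.tensorProduct b) (b.tensorProduct b) Ri (y.1.1, y.2.1) (x.1.1, x.2.1) *
    LinearMap.toMatrix (b.tensorProduct b) (b.tensorProduct b) R (x.1.2, x.2.2) (y.1.2, y.2.2)
  have hQ : ∀ s t u v s' t' u' v', Q ((s', t'), (u', v')) ((s, t), (u, v)) =
    LinearMap.toMatrix (b.tensorProduct b) (b.tensorProduct b) Ri (s, u) (s', u') *
    LinearMap.toMatrix (b.tensorProduct b) (b.tensorProduct b) R (t', v') (t, v) :=
    fun s t u v s' t' u' v' => rfl
  rw [eDim_Fx b R Ri n Q hQ]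
  rw [← LinearEquiv.finrank_map_eq (zipE K ι n) (Fx Q n)]
  set A := LinearMap.toMatrix (b.tensorProduct b) (b.tensorProduct b) R with hA
  set B := LinearMap.toMatrix (b.tensorProduct b) (b.tensorProduct b) Ri with hB
  have hAB : A * B = 1 := by
    rw [hA, hB, ← LinearMap.toMatrix_comp, h1, LinearMap.toMatrix_id]
  have hBA : B * A = 1 := by
    rw [hA, hB, ← LinearMap.toMatrix_comp, h2, LinearMap.toMatrix_id]
  have key : Cm (Tm A n) n = Submodule.map (zipE K ι n : (Wd (ι × ι) n → K) →ₗ[K] Matrix (Wd ι n) (Wd ι n) K)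
      (Fx Q n) := by
    ext F
    obtain ⟨φ, rfl⟩ := (zipE K ι n).surjective F
    rw [mem_Cm]
    have hm : zipE K ι n φ ∈ Submodule.map (zipE K ι n : (Wd (ι × ι) n → K) →ₗ[K] Matrix (Wd ι n) (Wd ι n) K)
        (Fx Q n) ↔ φ ∈ Fx Q n := by
      constructor
      · rintro ⟨ψ, hψ, h⟩
        rwa [← (zipE K ι n).injective h]
      · exact fun h => ⟨φ, h, rfl⟩
    rw [hm]
    refine forall_congr' fun i => forall_congr' fun hi => ?_
    rw [← (zipE K ι n).injective.eq_iff, zip_vecMul hQ hi]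
    have i1 := Tm_inv hAB hi
    have i2 := Tm_inv hBA hi
    constructor
    · intro h
      rw [mul_assoc, h, ← mul_assoc, i2, one_mul]
    · intro h
      conv_rhs => rw [← h]
      rw [← mul_assoc, ← mul_assoc, i1, one_mul]
  rw [key]

end
end HeckeP

open PowerSeries in
/-- Equations (23)–(24): with `P_S = Σ s_n X^n` and `P_E = Σ e_n X^n` in `ℚ[[X]]`,
if the logarithmic-derivative coefficients `p_n` are defined by
`X·P_S' = P_S · Σ_{n≥1} p_n X^n`, then `X·P_E' = P_E · Σ_{n≥1} p_n² X^n`;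
that is, `P_E = P_S ⋆ P_S` is the λ-ring product of `P_S` with itself. -/
theorem poincare_E_eq_lambda_product
    (K : Type*) [Field K] [CharZero K] (V : Type*) [AddCommGroup V] [Module K V]
    [FiniteDimensional K V] (q : K) (hq : q ≠ 0)
    (R Rinv : V ⊗[K] V →ₗ[K] V ⊗[K] V) (hR : IsHecke K V q R)
    (hRinv : R ∘ₗ Rinv = LinearMap.id ∧ Rinv ∘ₗ R = LinearMap.id)
    (hqint : ∀ k : ℕ, 1 ≤ k → (∑ i ∈ Finset.range k, q ^ i) ≠ 0)
    (p : ℕ → ℚ)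
    (hp : PowerSeries.X * d⁄dX ℚ (PowerSeries.mk fun n => (sDim K V q R n : ℚ)) =
      (PowerSeries.mk fun n => (sDim K V q R n : ℚ)) *
        PowerSeries.mk (fun n => if n = 0 then 0 else p n)) :
    PowerSeries.X * d⁄dX ℚ (PowerSeries.mk fun n => (eDim K V R Rinv n : ℚ)) =
      (PowerSeries.mk fun n => (eDim K V R Rinv n : ℚ)) *
        PowerSeries.mk (fun n => if n = 0 then 0 else (p n) ^ 2) := by

  classical
  let b := Module.finBasis K V
  have hqi : ∀ k : ℕ, 1 ≤ k → HeckeP.qi q k ≠ 0 := hqint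
  have hD := HeckeP.HD_of b hR
  have hp' : ∀ n : ℕ, (n * sDim K V q R n : ℚ) = ∑ ij ∈ Finset.HasAntidiagonal.antidiagonal n,
      sDim K V q R ij.1 * (if ij.2 = 0 then 0 else p ij.2) := by
    intro n
    have := congrArg (PowerSeries.coeff n) hp
    rw [HeckeP.coeff_X_d, PowerSeries.coeff_mul, PowerSeries.coeff_mk] at this
    rw [this]
    simp only [PowerSeries.coeff_mk]
  have main := HeckeP.main_matrix hq hqi hD (fun n => sDim K V q R n) (fun n => eDim K V R Rinv n) p
    (fun n => HeckeP.sDim_eq b hqi R hD n) (fun n => HeckeP.eDim_eq b R Rinv hRinv.1 hRinv.2 n) hp'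
  ext n
  rw [HeckeP.coeff_X_d, PowerSeries.coeff_mul, PowerSeries.coeff_mk, main n]
  simp only [PowerSeries.coeff_mk]
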